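/- Every minor-minimal enemy is 5-connected. -/

import Mathlib

open SimpleGraph

/-- `K7vee` is the graph obtained from `K 7` by deleting two edges with a common end. -/
def K7vee : SimpleGraph (Fin 7) :=
  (completeGraph (Fin 7)).deleteEdges {s(0, 1), s(0, 2)}

/-- `K6vee` is the graph obtained from `K 6` by deleting two edges with a common end. -/
def K6vee : SimpleGraph (Fin 6) :=
  (completeGraph (Fin 6)).deleteEdges {s(0, 1), s(0, 2)}

/-- The complete multipartite graph with four parts of size two. -/
def K2222 : SimpleGraph (Fin 4 × Fin 2) :=
  SimpleGraph.comap Prod.fst (completeGraph (Fin 4))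

/-- `H` is a minor of `G`: there is a model of `H` in `G`, i.e. a family of pairwise disjoint
nonempty connected branch sets, one for each vertex of `H`, with edges of `G` between branch
sets corresponding to adjacent vertices of `H`. -/
def IsMinor {W V : Type} (H : SimpleGraph W) (G : SimpleGraph V) : Prop :=
  ∃ bag : W → Set V,
    (∀ w, (G.induce (bag w)).Connected) ∧
    (∀ w w', w ≠ w' → Disjoint (bag w) (bag w')) ∧
    (∀ w w', H.Adj w w' → ∃ u ∈ bag w, ∃ v ∈ bag w', G.Adj u v)

/-- A graph is `k`-connected if it has more than `k` vertices and stays connected after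
removing any set of fewer than `k` vertices. -/
def IsKConnected {V : Type} [Fintype V] (k : ℕ) (G : SimpleGraph V) : Prop :=
  k < Fintype.card V ∧ ∀ S : Set V, S.ncard < k → (G.induce (Sᶜ : Set V)).Connected

/-- A separation of `G`: `A ∪ B = V(G)` and no edge joins `A - B` to `B - A`. -/
def IsSeparation {V : Type} (G : SimpleGraph V) (A B : Set V) : Prop :=
  A ∪ B = Set.univ ∧ ∀ ⦃u v : V⦄, G.Adj u v → ¬(u ∈ A \ B ∧ v ∈ B \ A)

/-- `(G, Z)` is internally `k`-connected: every separation `(A,B)` of `G` with `Z ⊆ A`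
and `B - A ≠ ∅` has order at least `k`. -/
def InternallyConnected {V : Type} (G : SimpleGraph V) (Z : Set V) (k : ℕ) : Prop :=
  ∀ A B : Set V, IsSeparation G A B → Z ⊆ A → (B \ A).Nonempty →
    k ≤ (A ∩ B).ncard

/-- A `Z`-rooted `K₄`-model in `G`. -/
def HasRootedK4Model {V : Type} (G : SimpleGraph V) (Z : Set V) : Prop :=
  ∃ B : Fin 4 → Set V,
    (∀ i, (G.induce (B i)).Connected) ∧
    (∀ i j, i ≠ j → Disjoint (B i) (B j)) ∧
    (∀ i, ∃! z : V, z ∈ Z ∧ z ∈ B i) ∧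
    (∀ z ∈ Z, ∃ i, z ∈ B i) ∧
    (∀ i j, i ≠ j → ∃ u ∈ B i, ∃ v ∈ B j, G.Adj u v)

/-- A `Z`-rooted `K*₄,₂`-model in `G`. -/
def HasRootedK42starModel {V : Type} (G : SimpleGraph V) (Z : Set V) : Prop :=
  ∃ (B : Fin 4 → Set V) (C : Fin 2 → Set V),
    (∀ i, (G.induce (B i)).Connected) ∧
    (∀ j, (G.induce (C j)).Connected) ∧
    (∀ i j, i ≠ j → Disjoint (B i) (B j)) ∧
    (∀ i j, i ≠ j → Disjoint (C i) (C j)) ∧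
    (∀ i j, Disjoint (B i) (C j)) ∧
    (∀ i, ∃! z : V, z ∈ Z ∧ z ∈ B i) ∧
    (∀ z ∈ Z, ∃ i, z ∈ B i) ∧
    (∀ i j, ∃ u ∈ B i, ∃ v ∈ C j, G.Adj u v) ∧
    (∃ u ∈ C 0, ∃ v ∈ C 1, G.Adj u v)

/-- An enemy: a `4`-connected graph with `|E(G)| ≥ 4|V(G)| - 8`, with no `K7vee`-minor,
not isomorphic to `K_{2,2,2,2}`. -/
def Enemy {V : Type} [Fintype V] (G : SimpleGraph V) : Prop :=
  IsKConnected 4 G ∧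
    4 * (Fintype.card V : ℤ) - 8 ≤ (G.edgeSet.ncard : ℤ) ∧
    ¬ IsMinor K7vee G ∧
    IsEmpty (G ≃g K2222)

/-- A minor-minimal enemy: an enemy, no minor of which, other than itself, is an enemy. -/
def MinorMinimalEnemy {V : Type} [Fintype V] (G : SimpleGraph V) : Prop :=
  Enemy G ∧ ∀ (W : Type) [Fintype W] (H : SimpleGraph W),
    IsMinor H G → Enemy H → Nonempty (H ≃g G)

/-- The simple graph obtained from `G` by contracting the edge `uv`
(`v` is merged into `u`). -/
def contractEdge {V : Type} (G : SimpleGraph V) (u v : V) :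
    SimpleGraph {x : V // x ≠ v} :=
  SimpleGraph.fromRel (fun x y => G.Adj ↑x ↑y ∨ ((x : V) = u ∧ G.Adj v ↑y))

/-- A graph is `7`-contraction-critical if its chromatic number is `7` and
every minor of it, other than itself, has chromatic number less than `7`. -/
def ContractionCritical7 {V : Type} [Fintype V] (G : SimpleGraph V) : Prop :=
  G.chromaticNumber = 7 ∧
    ∀ (W : Type) [Fintype W] (H : SimpleGraph W),
      IsMinor H G → IsEmpty (H ≃g G) → H.chromaticNumber < 7

set_option linter.unusedSectionVars false

namespace EnemyProof

open Finset Classical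

variable {V : Type}

/-- Two vertex sets are joined by an edge. -/
def Touch (G : SimpleGraph V) (s t : Finset V) : Prop :=
  ∃ u ∈ s, ∃ v ∈ t, G.Adj u v

/-- `s` induces a connected subgraph. -/
def Conn (G : SimpleGraph V) (s : Finset V) : Prop :=
  s.Nonempty ∧ ∀ U ⊆ s, U.Nonempty → (∀ a ∈ U, ∀ b ∈ s, G.Adj a b → b ∈ U) → U = s

theorem Touch.symm {G : SimpleGraph V} {s t : Finset V} (h : Touch G s t) : Touch G t s := by
  obtain ⟨u, hu, v, hv, huv⟩ := h
  exact ⟨v, hv, u, hu, huv.symm⟩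

theorem Touch.mono {G : SimpleGraph V} {s t s' t' : Finset V} (h : Touch G s t)
    (hs : s ⊆ s') (ht : t ⊆ t') : Touch G s' t' := by
  obtain ⟨u, hu, v, hv, huv⟩ := h
  exact ⟨u, hs hu, v, ht hv, huv⟩

theorem conn_singleton (G : SimpleGraph V) (v : V) : Conn G {v} := by
  refine ⟨singleton_nonempty v, fun U hU hne _ => ?_⟩
  exact (Finset.subset_singleton_iff.mp hU).resolve_left hne.ne_empty

theorem Conn.union {G : SimpleGraph V} {s t : Finset V} (hs : Conn G s) (ht : Conn G t)
    (h : (s ∩ t).Nonempty ∨ Touch G s t) : Conn G (s ∪ t) := by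
  have key : ∀ U ⊆ s ∪ t, (∀ a ∈ U, ∀ b ∈ s ∪ t, G.Adj a b → b ∈ U) →
      ∀ r, r ⊆ s ∪ t → Conn G r → (U ∩ r).Nonempty → r ⊆ U := by
    intro U _ hcl r hr hc hne
    have := hc.2 (U ∩ r) inter_subset_right hne (fun a ha b hb hab => by
      simp only [mem_inter] at ha ⊢
      exact ⟨hcl a ha.1 b (hr hb) hab, hb⟩)
    rw [← this]; exact inter_subset_left
  refine ⟨hs.1.mono subset_union_left, fun U hU hne hcl => ?_⟩
  have Ks := key U hU hcl s subset_union_left hs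
  have Kt := key U hU hcl t subset_union_right ht
  refine hU.antisymm ?_
  have st : s ⊆ U → t ⊆ U := by
    intro hsU
    rcases h with ⟨x, hx⟩ | ⟨u, hu, v, hv, huv⟩
    · simp only [mem_inter] at hx
      exact Kt ⟨x, by simp [hx.2, hsU hx.1]⟩
    · exact Kt ⟨v, by simp [hv, hcl u (hsU hu) v (by simp [hv]) huv]⟩
  have ts : t ⊆ U → s ⊆ U := by
    intro htU
    rcases h with ⟨x, hx⟩ | ⟨u, hu, v, hv, huv⟩
    · simp only [mem_inter] at hx
      exact Ks ⟨x, by simp [hx.1, htU hx.2]⟩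
    · exact Ks ⟨u, by simp [hu, hcl v (htU hv) u (by simp [hu]) huv.symm]⟩
  obtain ⟨x, hx⟩ := hne
  rcases mem_union.mp (hU hx) with hxs | hxt
  · have := Ks ⟨x, by simp [hx, hxs]⟩
    exact union_subset this (st this)
  · have := Kt ⟨x, by simp [hx, hxt]⟩
    exact union_subset (ts this) this

theorem Conn.insert_vertex {G : SimpleGraph V} {s : Finset V} (hs : Conn G s) {v : V}
    (h : ∃ u ∈ s, G.Adj u v) : Conn G (insert v s) := by
  obtain ⟨u, hu, huv⟩ := h
  rw [Finset.insert_eq]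
  exact (conn_singleton G v).union hs (Or.inr ⟨v, by simp, u, hu, huv.symm⟩)

theorem Conn.mono_graph {G H : SimpleGraph V} (hGH : G ≤ H) {s : Finset V} (hs : Conn G s) :
    Conn H s :=
  ⟨hs.1, fun U hU hne hcl => hs.2 U hU hne fun a ha b hb hab => hcl a ha b hb (hGH hab)⟩

theorem conn_pair {G : SimpleGraph V} {u v : V} (h : G.Adj u v) : Conn G {u, v} := by
  exact (conn_singleton G v).insert_vertex ⟨v, by simp, h.symm⟩

/-- A nonempty proper part of a connected set sends an edge to the rest. -/
theorem Conn.exists_adj {G : SimpleGraph V} {s : Finset V} (hs : Conn G s) {U : Finset V}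
    {x y : V} (hx : x ∈ s) (hxU : x ∈ U) (hy : y ∈ s) (hyU : y ∉ U) :
    ∃ a ∈ s, a ∈ U ∧ ∃ b ∈ s, b ∉ U ∧ G.Adj a b := by
  by_contra hcon
  push Not at hcon
  have := hs.2 (s ∩ U) inter_subset_left ⟨x, by simp [hx, hxU]⟩ (fun a ha b hb hab => by
    simp only [mem_inter] at ha ⊢
    refine ⟨hb, ?_⟩
    by_contra hbU
    exact hcon a ha.1 ha.2 b hb hbU hab)
  have h2 : y ∈ s ∩ U := by rw [this]; exact hy
  exact hyU (mem_inter.mp h2).2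

theorem Conn.induce {G : SimpleGraph V} {s : Finset V} (hs : Conn G s) :
    (G.induce (s : Set V)).Connected := by
  have hne : Nonempty (s : Set V) := hs.1.to_subtype
  refine ⟨fun a b => ?_⟩
  have := hs.2 (s.filter fun x => ∃ hx : x ∈ (s : Set V), (G.induce (s : Set V)).Reachable a ⟨x, hx⟩)
    (filter_subset _ _) ⟨a.1, by
      have ha := a.2
      simp only [mem_filter]
      exact ⟨by simp, ha, SimpleGraph.Reachable.refl _⟩⟩
    (fun x hx y hy hxy => by
      simp only [mem_filter] at hx ⊢
      obtain ⟨_, hx, hr⟩ := hx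
      have hy' : y ∈ (s : Set V) := by simpa using hy
      refine ⟨hy, hy', hr.trans (SimpleGraph.Adj.reachable ?_)⟩
      simpa using hxy)
  have hb : b.1 ∈ s := by simp
  obtain ⟨_, _, h⟩ := mem_filter.mp (this.symm.subset hb)
  exact h

theorem conn_of_induce {G : SimpleGraph V} {s : Finset V}
    (hs : (G.induce (s : Set V)).Connected) : Conn G s := by
  obtain ⟨x0⟩ := hs.nonempty
  refine ⟨⟨x0.1, by simp⟩, fun U hU ⟨x, hx⟩ hcl => hU.antisymm fun y hy => ?_⟩
  have hr := hs.preconnected ⟨x, by simpa using hU hx⟩ ⟨y, by simpa using hy⟩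
  rw [SimpleGraph.reachable_iff_reflTransGen] at hr
  have : ∀ z : (s : Set V), Relation.ReflTransGen (G.induce (s : Set V)).Adj ⟨x, by simpa using hU hx⟩ z → z.1 ∈ U := by
    intro z hz
    induction hz with
    | refl => exact hx
    | tail _ h ih => exact hcl _ ih _ (by simp) (by simpa using h)
  exact this _ hr

theorem conn_iff {G : SimpleGraph V} {s : Finset V} :
    Conn G s ↔ (G.induce (s : Set V)).Connected :=
  ⟨Conn.induce, conn_of_induce⟩

variable [Fintype V]

/-- The outer vertex boundary of `F`. -/
noncomputable def bd (G : SimpleGraph V) (F : Finset V) : Finset V :=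
  univ.filter fun v => v ∉ F ∧ ∃ u ∈ F, G.Adj u v

theorem mem_bd {G : SimpleGraph V} {F : Finset V} {v : V} :
    v ∈ bd G F ↔ v ∉ F ∧ ∃ u ∈ F, G.Adj u v := by
  simp [bd]

/-- The connected component of `v` in the subgraph induced on `M`. -/
theorem exists_component (G : SimpleGraph V) {M : Finset V} {v : V} (hv : v ∈ M) :
    ∃ K ⊆ M, v ∈ K ∧ Conn G K ∧ ∀ a ∈ K, ∀ b ∈ M, G.Adj a b → b ∈ K := by
  obtain ⟨K, hK, hmax⟩ := Finset.exists_max_image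
    (univ.filter fun K : Finset V => K ⊆ M ∧ v ∈ K ∧ Conn G K) Finset.card
    ⟨{v}, by simp [hv, conn_singleton]⟩
  simp only [mem_filter, mem_univ, true_and] at hK hmax
  refine ⟨K, hK.1, hK.2.1, hK.2.2, fun a ha b hb hab => ?_⟩
  by_contra hbK
  have := hmax (insert b K) ⟨insert_subset hb hK.1, by simp [hK.2.1], hK.2.2.insert_vertex ⟨a, ha, hab⟩⟩
  rw [card_insert_of_notMem hbK] at this
  omega

theorem isMinor_iff {W : Type} (H : SimpleGraph W) (G : SimpleGraph V) :
    IsMinor H G ↔ ∃ bag : W → Finset V, (∀ w, Conn G (bag w)) ∧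
      (∀ w w', w ≠ w' → Disjoint (bag w) (bag w')) ∧
      (∀ w w', H.Adj w w' → Touch G (bag w) (bag w')) := by
  constructor
  · rintro ⟨bag, hc, hd, ha⟩
    refine ⟨fun w => (bag w).toFinset, fun w => ?_, fun w w' h => ?_, fun w w' h => ?_⟩
    · rw [conn_iff, Set.coe_toFinset]; exact hc w
    · simpa using hd w w' h
    · simpa [Touch] using ha w w' h
  · rintro ⟨bag, hc, hd, ha⟩
    refine ⟨fun w => (bag w : Set V), fun w => (hc w).induce, fun w w' h => ?_, fun w w' h => ?_⟩
    · simpa using hd w w' h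
    · simpa [Touch] using ha w w' h

/-- The subgraph of `H` induced on `R` is `k`-connected. -/
def KConn (H : SimpleGraph V) (R : Finset V) (k : ℕ) : Prop :=
  k < #R ∧ ∀ U ⊆ R, U.Nonempty → (R \ (U ∪ bd H U)).Nonempty → k ≤ #(bd H U ∩ R)

theorem isKConnected_iff (k : ℕ) (G : SimpleGraph V) : IsKConnected k G ↔ KConn G univ k := by
  simp only [IsKConnected, KConn, card_univ, inter_univ]
  refine and_congr_right fun hk => ⟨fun h U _ hU hne => ?_, fun h S hS => ?_⟩
  · by_contra hlt
    push Not at hlt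
    have hc := h (bd G U : Set V) (by simpa using hlt)
    rw [show ((bd G U : Set V)ᶜ) = (((bd G U)ᶜ : Finset V) : Set V) by simp, ← conn_iff] at hc
    obtain ⟨y, hy⟩ := hne
    obtain ⟨x, hx⟩ := hU
    simp only [mem_sdiff, mem_univ, mem_union, true_and, not_or] at hy
    obtain ⟨a, ha, haU, b, hb, hbU, hab⟩ := hc.exists_adj (U := U) (x := x) (y := y)
      (by simp [mem_bd, hx]) hx (by simp [hy.2]) hy.1
    simp only [mem_compl] at hb
    exact hb (mem_bd.mpr ⟨hbU, a, haU, hab⟩)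
  · rw [show (Sᶜ : Set V) = ((S.toFinsetᶜ : Finset V) : Set V) by simp, ← conn_iff]
    have hS' : #S.toFinset < k := by rwa [← Set.ncard_eq_toFinset_card']
    have hne : (S.toFinsetᶜ).Nonempty := by
      rw [← card_pos, card_compl]; omega
    refine ⟨hne, fun U hU hUne hcl => ?_⟩
    have hsub : bd G U ⊆ S.toFinset := by
      intro v hv
      obtain ⟨hvU, a, ha, hav⟩ := mem_bd.mp hv
      by_contra hvS
      exact hvU (hcl a ha v (by simpa using hvS) hav)
    by_contra hne'
    have : (univ \ (U ∪ bd G U)).Nonempty := by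
      obtain ⟨x, hx, hxU⟩ := Finset.exists_of_ssubset (hU.ssubset_of_ne hne')
      refine ⟨x, ?_⟩
      simp only [mem_sdiff, mem_univ, mem_union, true_and, not_or]
      exact ⟨hxU, fun h => (mem_compl.mp hx) (hsub h)⟩
    have := h U (subset_univ _) hUne this
    have := card_le_card hsub
    omega

theorem isMinor_trans {W X : Type} [Fintype W] [Fintype X] {A : SimpleGraph X} {B : SimpleGraph W} {G : SimpleGraph V}
    (hAB : IsMinor A B) (hBG : IsMinor B G) : IsMinor A G := by
  rw [isMinor_iff] at *
  obtain ⟨p, pc, pd, pa⟩ := hAB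
  obtain ⟨q, qc, qd, qa⟩ := hBG
  refine ⟨fun x => (p x).biUnion q, fun x => ⟨?_, ?_⟩, fun x y hxy => ?_, fun x y hxy => ?_⟩
  · obtain ⟨w, hw⟩ := (pc x).1
    obtain ⟨v, hv⟩ := (qc w).1
    exact ⟨v, mem_biUnion.mpr ⟨w, hw, hv⟩⟩
  · intro U hU ⟨u, hu⟩ hcl
    have full : ∀ w ∈ p x, (U ∩ q w).Nonempty → q w ⊆ U := by
      intro w hw hne
      have := (qc w).2 (U ∩ q w) inter_subset_right hne (fun a ha b hb hab => by
        simp only [mem_inter] at ha ⊢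
        exact ⟨hcl a ha.1 b (mem_biUnion.mpr ⟨w, hw, hb⟩) hab, hb⟩)
      rw [← this]; exact inter_subset_left
    have hI : (p x).filter (fun w => q w ⊆ U) = p x := by
      refine (pc x).2 _ (filter_subset _ _) ?_ ?_
      · obtain ⟨w, hw, huw⟩ := mem_biUnion.mp (hU hu)
        exact ⟨w, mem_filter.mpr ⟨hw, full w hw ⟨u, by simp [hu, huw]⟩⟩⟩
      · intro a ha b hb hab
        rw [mem_filter] at ha ⊢
        obtain ⟨s, hs, t, ht, hst⟩ := qa a b hab
        exact ⟨hb, full b hb ⟨t, mem_inter.mpr ⟨hcl s (ha.2 hs) t (mem_biUnion.mpr ⟨b, hb, ht⟩) hst, ht⟩⟩⟩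
    refine hU.antisymm fun v hv => ?_
    obtain ⟨w, hw, hvw⟩ := mem_biUnion.mp hv
    rw [← hI] at hw
    exact (mem_filter.mp hw).2 hvw
  · rw [disjoint_biUnion_left]
    intro a ha
    rw [disjoint_biUnion_right]
    intro b hb
    refine qd a b ?_
    rintro rfl
    exact Finset.disjoint_left.mp (pd x y hxy) ha hb
  · obtain ⟨a, ha, b, hb, hab⟩ := pa x y hxy
    exact (qa a b hab).mono (subset_biUnion_of_mem q ha) (subset_biUnion_of_mem q hb)

/-- Vertices chosen from disjoint sets exhaust a set of the same size. -/
theorem exists_index_of_injective {k : ℕ} {s : Fin k → V} (hs : Function.Injective s)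
    {S : Finset V} (hS : ∀ i, s i ∈ S) (hk : #S = k) {x : V} (hx : x ∈ S) : ∃ i, s i = x := by
  have : univ.image s = S := by
    refine eq_of_subset_of_card_le (fun y hy => ?_) ?_
    · obtain ⟨i, _, rfl⟩ := mem_image.mp hy
      exact hS i
    · rw [card_image_of_injective _ hs]; simp [hk]
  rw [← this] at hx
  obtain ⟨i, _, h⟩ := mem_image.mp hx
  exact ⟨i, h⟩

theorem Conn.subset_of_edges {H : SimpleGraph V} {s A : Finset V} (hs : Conn H s)
    (hA : ∀ a b, H.Adj a b → a ∈ A ∧ b ∈ A) (hne : (s ∩ A).Nonempty) : s ⊆ A := by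
  have := hs.2 (s ∩ A) inter_subset_left hne fun a _ b hb hab => by
    simp [hb, (hA a b hab).2]
  rw [← this]; exact inter_subset_right

/-- The spanning subgraph of `H` whose edges are those with both ends in `A`. -/
def within (H : SimpleGraph V) (A : Finset V) : SimpleGraph V where
  Adj a b := H.Adj a b ∧ a ∈ A ∧ b ∈ A
  symm := ⟨fun _ _ h => ⟨h.1.symm, h.2.2, h.2.1⟩⟩
  loopless := ⟨fun _ h => H.loopless.irrefl _ h.1⟩

theorem within_le (H : SimpleGraph V) (A : Finset V) : within H A ≤ H := fun _ _ h => h.1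

/-- Menger's theorem for vertex sets `X` and `Y`, with connected sets instead of paths. -/
theorem menger_aux (k n : ℕ) : ∀ (H : SimpleGraph V) (X Y : Finset V), H.edgeSet.ncard = n →
    (∀ U, Disjoint U Y → k ≤ #(bd H U ∪ (X \ U))) →
    ∃ P : Fin k → Finset V, (∀ i, Conn H (P i)) ∧ (∀ i j, i ≠ j → Disjoint (P i) (P j)) ∧
      ∀ i, (P i ∩ X).Nonempty ∧ (P i ∩ Y).Nonempty := by
  induction n using Nat.strong_induction_on with
  | _ n ih =>
  intro H X Y hn hyp
  by_cases hE : ∃ u v, H.Adj u v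
  swap
  · push Not at hE
    have h1 := hyp (univ \ Y) sdiff_disjoint
    have hb : bd H (univ \ Y) = ∅ := by
      ext x; simp [mem_bd, hE]
    rw [hb, empty_union] at h1
    have h2 : X \ (univ \ Y) = X ∩ Y := by ext; simp
    rw [h2] at h1
    obtain ⟨T, hT, hTk⟩ := exists_subset_card_eq h1
    let e := (T.equivFinOfCardEq hTk).symm
    refine ⟨fun i => {(e i : V)}, fun i => conn_singleton _ _, fun i j hij => ?_, fun i => ?_⟩
    · simp only [disjoint_singleton_left, mem_singleton]
      exact fun h => hij (e.injective (Subtype.ext h))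
    · have := mem_inter.mp (hT (e i).2)
      exact ⟨⟨e i, by simp [this.1]⟩, ⟨e i, by simp [this.2]⟩⟩
  obtain ⟨u0, v0, huv0⟩ := hE
  let H' := H.deleteEdges {s(u0, v0)}
  have hH' : H' ≤ H := deleteEdges_le _
  have hlt : H'.edgeSet.ncard < n := by
    rw [← hn]
    refine Set.ncard_lt_ncard ?_ (Set.toFinite _)
    refine ⟨edgeSet_mono hH', fun h => ?_⟩
    have := h (show s(u0, v0) ∈ H.edgeSet from huv0)
    simp [H'] at this
  by_cases hyp' : ∀ U, Disjoint U Y → k ≤ #(bd H' U ∪ (X \ U))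
  · obtain ⟨P, h1, h2, h3⟩ := ih _ hlt H' X Y rfl hyp'
    exact ⟨P, fun i => (h1 i).mono_graph hH', h2, h3⟩
  push Not at hyp'
  obtain ⟨U, hUY, hUk⟩ := hyp'
  have hk := hyp U hUY
  have adjH : ∀ a b, H.Adj a b → ¬ H'.Adj a b → s(a, b) = s(u0, v0) := by
    intro a b h h'
    by_contra hne
    exact h' (by simp [H', deleteEdges_adj, h, hne])
  -- the deleted edge leaves `U`
  obtain ⟨u, v, huv, huU, hvU, hedge⟩ : ∃ u v, H.Adj u v ∧ u ∈ U ∧ v ∉ U ∧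
      (∀ a b, H.Adj a b → ¬ H'.Adj a b → (a = u ∧ b = v) ∨ (a = v ∧ b = u)) := by
    have : ¬ (bd H U ∪ (X \ U)) ⊆ bd H' U ∪ (X \ U) := fun h => by
      have := card_le_card h; omega
    obtain ⟨w, hw, hw'⟩ := not_subset.mp this
    have hwb : w ∈ bd H U := by
      rcases mem_union.mp hw with h | h
      · exact h
      · exact absurd (mem_union_right _ h) hw'
    obtain ⟨hwU, a, ha, haw⟩ := mem_bd.mp hwb
    have hna : ¬ H'.Adj a w := fun h => hw' (mem_union_left _ (mem_bd.mpr ⟨hwU, a, ha, h⟩))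
    refine ⟨a, w, haw, ha, hwU, fun c d h h' => ?_⟩
    have h1 := adjH c d h h'
    have h2 := adjH a w haw hna
    rw [← h2] at h1
    simpa using h1
  let S := bd H' U ∪ (X \ U)
  have hSU : ∀ x ∈ S, x ∉ U := by
    intro x hx
    rcases mem_union.mp hx with h | h
    · exact (mem_bd.mp h).1
    · exact (mem_sdiff.mp h).2
  have hbdsub : bd H U ⊆ insert v S := by
    intro w hw
    obtain ⟨hwU, a, ha, haw⟩ := mem_bd.mp hw
    by_cases h : H'.Adj a w
    · exact mem_insert_of_mem (mem_union_left _ (mem_bd.mpr ⟨hwU, a, ha, h⟩))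
    · rcases hedge a w haw h with ⟨_, rfl⟩ | ⟨rfl, _⟩
      · exact mem_insert_self _ _
      · exact absurd ha hvU
  have hXS : ∀ x ∈ X, x ∉ U → x ∈ S := fun x hx hxU => mem_union_right _ (mem_sdiff.mpr ⟨hx, hxU⟩)
  have hkS : k ≤ #(insert v S) := by
    refine hk.trans (card_le_card (union_subset hbdsub fun x hx => ?_))
    exact mem_insert_of_mem (mem_union_right _ hx)
  have hvS : v ∉ S := by
    intro h
    rw [insert_eq_of_mem h] at hkS
    exact absurd hkS (by simpa [S] using hUk)
  have huS : u ∉ S := fun h => hSU u h huU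
  have hc2 : #(insert v S) = k := by
    have : #S < k := hUk
    rw [card_insert_of_notMem hvS] at hkS ⊢; omega
  have hc1 : #(insert u S) = k := by
    rw [card_insert_of_notMem huS]; rwa [card_insert_of_notMem hvS] at hc2
  let A := U ∪ S
  let B := univ \ U
  have hAB : ∀ x, x ∈ A → x ∈ B → x ∈ S := by
    intro x hA hB
    rcases mem_union.mp hA with h | h
    · exact absurd h (mem_sdiff.mp hB).2
    · exact h
  have ltA : ∀ C, (within H' C).edgeSet.ncard < n := fun C =>
    lt_of_le_of_lt (Set.ncard_le_ncard (edgeSet_mono (within_le H' C)) (Set.toFinite _)) hlt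
  obtain ⟨P, Pc, Pd, Pm⟩ := ih _ (ltA A) (within H' A) X (insert u S) rfl (by
    intro U1 hU1
    have hdis : ∀ x ∈ U1, x ≠ u ∧ x ∉ S := fun x hx => by
      have := Finset.disjoint_left.mp hU1 hx
      simpa using this
    refine (hyp (U1 ∩ U) (hUY.mono_left inter_subset_right)).trans (card_le_card ?_)
    intro w hw
    rcases mem_union.mp hw with h | h
    · obtain ⟨hw1, a, ha, haw⟩ := mem_bd.mp h
      simp only [mem_inter] at ha hw1
      have hH : H'.Adj a w := by
        by_contra hc
        rcases hedge a w haw hc with ⟨rfl, _⟩ | ⟨rfl, _⟩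
        · exact (hdis a ha.1).1 rfl
        · exact hvU ha.2
      have hwA : w ∈ A := by
        by_cases hwU : w ∈ U
        · exact mem_union_left _ hwU
        · exact mem_union_right _ (mem_union_left _ (mem_bd.mpr ⟨hwU, a, ha.2, hH⟩))
      refine mem_union_left _ (mem_bd.mpr ⟨fun hwU1 => ?_, a, ha.1, hH, mem_union_left _ ha.2, hwA⟩)
      rcases mem_union.mp hwA with h | h
      · exact hw1 ⟨hwU1, h⟩
      · exact (hdis w hwU1).2 h
    · simp only [mem_sdiff, mem_inter] at h
      refine mem_union_right _ (mem_sdiff.mpr ⟨h.1, fun hwU1 => ?_⟩)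
      exact (hdis w hwU1).2 (hXS w h.1 fun hU => h.2 ⟨hwU1, hU⟩))
  obtain ⟨Q, Qc, Qd, Qm⟩ := ih _ (ltA B) (within H' B) (insert v S) Y rfl (by
    intro U1 hU1
    refine (hyp (U ∪ (U1 ∩ B)) ?_).trans (card_le_card ?_)
    · rw [disjoint_union_left]
      exact ⟨hUY, hU1.mono_left inter_subset_left⟩
    intro w hw
    rcases mem_union.mp hw with h | h
    · obtain ⟨hw1, a, ha, haw⟩ := mem_bd.mp h
      simp only [mem_union, mem_inter, not_or, not_and] at hw1
      have hwB : w ∈ B := by simp [B, hw1.1]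
      have hwU1 : w ∉ U1 := fun h => hw1.2 h hwB
      rcases mem_union.mp ha with haU | ha
      · exact mem_union_right _ (mem_sdiff.mpr ⟨hbdsub (mem_bd.mpr ⟨hw1.1, a, haU, haw⟩), hwU1⟩)
      · obtain ⟨ha1, haB⟩ := mem_inter.mp ha
        have haU : a ∉ U := (mem_sdiff.mp haB).2
        refine mem_union_left _ (mem_bd.mpr ⟨hwU1, a, ha1, ?_, haB, hwB⟩)
        by_contra hc
        rcases hedge a w haw hc with ⟨rfl, _⟩ | ⟨_, rfl⟩
        · exact haU huU
        · exact hw1.1 huU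
    · simp only [mem_sdiff, mem_union, mem_inter, not_or, not_and] at h
      have hwB : w ∈ B := by simp [B, h.2.1]
      exact mem_union_right _ (mem_sdiff.mpr ⟨mem_insert_of_mem (hXS w h.1 h.2.1),
        fun h1 => h.2.2 h1 hwB⟩))
  choose p hp using fun i => (Pm i).2
  choose q hq using fun i => (Qm i).1
  simp only [mem_inter] at hp hq
  have pinj : Function.Injective p := fun i j h => by
    by_contra hij
    exact Finset.disjoint_left.mp (Pd i j hij) (hp i).1 (h ▸ (hp j).1)
  have qinj : Function.Injective q := fun i j h => by
    by_contra hij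
    exact Finset.disjoint_left.mp (Qd i j hij) (hq i).1 (h ▸ (hq j).1)
  have PA : ∀ i, P i ⊆ A := fun i => (Pc i).subset_of_edges (fun a b h => h.2)
    ⟨p i, mem_inter.mpr ⟨(hp i).1, by
      rcases mem_insert.mp (hp i).2 with h | h
      · rw [h]; exact mem_union_left _ huU
      · exact mem_union_right _ h⟩⟩
  have QB : ∀ i, Q i ⊆ B := fun i => (Qc i).subset_of_edges (fun a b h => h.2)
    ⟨q i, mem_inter.mpr ⟨(hq i).1, by
      rcases mem_insert.mp (hq i).2 with h | h
      · rw [h]; simp [B, hvU]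
      · simp [B, hSU _ h]⟩⟩
  have punique : ∀ i x, x ∈ P i → x ∈ insert u S → x = p i := fun i x hx hxS => by
    obtain ⟨j, rfl⟩ := exists_index_of_injective pinj (fun i => (hp i).2) hc1 hxS
    by_contra hne
    exact Finset.disjoint_left.mp (Pd i j fun h => hne (by rw [h])) hx (hp j).1
  have qunique : ∀ i x, x ∈ Q i → x ∈ insert v S → x = q i := fun i x hx hxS => by
    obtain ⟨j, rfl⟩ := exists_index_of_injective qinj (fun i => (hq i).2) hc2 hxS
    by_contra hne
    exact Finset.disjoint_left.mp (Qd i j fun h => hne (by rw [h])) hx (hq j).1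
  let f : V → V := fun x => if x = u then v else x
  have hf : ∀ i, ∃ j, q j = f (p i) := fun i => by
    refine exists_index_of_injective qinj (fun i => (hq i).2) hc2 ?_
    simp only [f]
    split_ifs with h
    · exact mem_insert_self _ _
    · exact mem_insert_of_mem ((mem_insert.mp (hp i).2).resolve_left h)
  choose g hg using hf
  have ginj : Function.Injective g := fun i j h => by
    apply pinj
    have h1 : f (p i) = f (p j) := by rw [← hg i, ← hg j, h]
    simp only [f] at h1
    have hi := mem_insert.mp (hp i).2
    have hj := mem_insert.mp (hp j).2
    split_ifs at h1 with h2 h3 h3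
    · rw [h2, h3]
    · exact absurd (hj.resolve_left h3) (h1 ▸ hvS)
    · exact absurd (hi.resolve_left h2) (h1 ▸ hvS)
    · exact h1
  refine ⟨fun i => P i ∪ Q (g i), fun i => ?_, fun i j hij => ?_, fun i => ?_⟩
  · refine ((Pc i).mono_graph ((within_le _ _).trans hH')).union
      ((Qc (g i)).mono_graph ((within_le _ _).trans hH')) ?_
    by_cases h : p i = u
    · refine Or.inr ⟨u, h ▸ (hp i).1, v, ?_, huv⟩
      have := hg i
      simp only [f, h, if_true] at this
      exact this ▸ (hq (g i)).1
    · left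
      have := hg i
      simp only [f, h, if_false] at this
      exact ⟨p i, mem_inter.mpr ⟨(hp i).1, this ▸ (hq (g i)).1⟩⟩
  · have cross : ∀ i j, i ≠ j → Disjoint (P i) (Q (g j)) := fun i j hij => by
      rw [Finset.disjoint_left]
      intro x hx hx'
      have hxS := hAB x (PA i hx) (QB _ hx')
      have h1 := punique i x hx (mem_insert_of_mem hxS)
      have h2 := qunique _ x hx' (mem_insert_of_mem hxS)
      rw [hg j] at h2
      simp only [f] at h2
      split_ifs at h2 with h3
      · exact hvS (h2 ▸ hxS)
      · exact hij (pinj (h1.symm.trans h2))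
    simp only [disjoint_union_left, disjoint_union_right]
    exact ⟨⟨Pd i j hij, (cross j i hij.symm).symm⟩, cross i j hij, Qd _ _ fun h => hij (ginj h)⟩
  · obtain ⟨x, hx⟩ := (Pm i).1
    obtain ⟨y, hy⟩ := (Qm (g i)).2
    simp only [mem_inter] at hx hy
    exact ⟨⟨x, by simp [hx.1, hx.2]⟩, ⟨y, by simp [hy.1, hy.2]⟩⟩

/-- A connected set meeting `X` and `Y` contains one that meets both exactly once. -/
theorem Conn.exists_thin {G : SimpleGraph V} {P X Y : Finset V} (hP : Conn G P)
    (hX : (P ∩ X).Nonempty) (hY : (P ∩ Y).Nonempty) :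
    ∃ P' ⊆ P, Conn G P' ∧ (∃ x, P' ∩ X = {x}) ∧ ∃ y, P' ∩ Y = {y} := by
  obtain ⟨K, hK, hmin⟩ := Finset.exists_min_image
    (univ.filter fun K : Finset V => K ⊆ P ∧ Conn G K ∧ (K ∩ X).Nonempty ∧ (K ∩ Y).Nonempty)
    Finset.card ⟨P, by simp [hP, hX, hY]⟩
  simp only [mem_filter, mem_univ, true_and] at hK hmin
  obtain ⟨hKP, hKc, hKX, hKY⟩ := hK
  have small : ∀ L ⊆ K, Conn G L → (L ∩ X).Nonempty → (L ∩ Y).Nonempty → L = K := by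
    intro L hL hc hx hy
    exact eq_of_subset_of_card_le hL (hmin L ⟨hL.trans hKP, hc, hx, hy⟩)
  have key : ∀ X Y : Finset V, (K ∩ X).Nonempty → (K ∩ Y).Nonempty →
      (∀ L ⊆ K, Conn G L → (L ∩ X).Nonempty → (L ∩ Y).Nonempty → L = K) →
      ∃ x, K ∩ X = {x} := by
    intro X Y ⟨x, hx⟩ ⟨y, hy⟩ small
    simp only [mem_inter] at hx hy
    refine ⟨x, ?_⟩
    ext x2
    simp only [mem_inter, mem_singleton]
    refine ⟨fun h2 => ?_, fun h => h ▸ hx⟩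
    by_contra hne
    by_cases hyx : y = x
    · subst hyx
      have := small {y} (by simpa using hx.1) (conn_singleton G y) ⟨y, by simp [hx.2]⟩ ⟨y, by simp [hy.2]⟩
      rw [← this] at h2
      exact hne (by simpa using h2.1)
    · obtain ⟨L, hL, hyL, hLc, hLcl⟩ := exists_component G (M := K.erase x) (v := y) (by simp [hyx, hy.1])
      have hxL : x ∉ L := fun h => by simpa using hL h
      by_cases h2L : x2 ∈ L
      · have := small L (hL.trans (erase_subset _ _)) hLc ⟨x2, by simp [h2L, h2.2]⟩ ⟨y, by simp [hyL, hy.2]⟩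
        exact hxL (this ▸ hx.1)
      · obtain ⟨a, haK, haL, b, hbK, hbL, hab⟩ := hKc.exists_adj hy.1 hyL hx.1 hxL
        have hbx : b = x := by
          by_contra hb
          exact hbL (hLcl a haL b (by simp [hb, hbK]) hab)
        subst hbx
        have := small (insert b L) (insert_subset hbK (hL.trans (erase_subset _ _)))
          (hLc.insert_vertex ⟨a, haL, hab⟩) ⟨b, by simp [hx.2]⟩ ⟨y, by simp [hyL, hy.2]⟩
        rw [← this] at h2
        simp [hne, h2L] at h2
  refine ⟨K, hKP, hKc, key X Y hKX hKY small, key Y X hKY hKX fun L hL hc hy hx => small L hL hc hx hy⟩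

/-- Menger's theorem inside the subgraph induced on `M`. -/
theorem menger {G : SimpleGraph V} {M X Y : Finset V} (k : ℕ) (hX : X ⊆ M)
    (hyp : ∀ U ⊆ M, Disjoint U Y → k ≤ #((bd G U ∩ M) ∪ (X \ U))) :
    ∃ (P : Fin k → Finset V) (x y : Fin k → V), (∀ i, Conn G (P i)) ∧ (∀ i, P i ⊆ M) ∧
      (∀ i j, i ≠ j → Disjoint (P i) (P j)) ∧ (∀ i, P i ∩ X = {x i}) ∧ ∀ i, P i ∩ Y = {y i} := by
  obtain ⟨P, Pc, Pd, Pm⟩ := menger_aux k _ (within G M) X Y rfl (by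
    intro U hU
    refine (hyp (U ∩ M) inter_subset_right (hU.mono_left inter_subset_left)).trans (card_le_card ?_)
    intro w hw
    simp only [mem_union, mem_inter, mem_bd, mem_sdiff] at hw ⊢
    rcases hw with ⟨⟨h1, a, ⟨haU, haM⟩, haw⟩, hwM⟩ | ⟨hwX, h⟩
    · exact Or.inl ⟨fun h => h1 ⟨h, hwM⟩, a, haU, haw, haM, hwM⟩
    · exact Or.inr ⟨hwX, fun h' => h ⟨h', hX hwX⟩⟩)
  have PM : ∀ i, P i ⊆ M := fun i => (Pc i).subset_of_edges (fun a b h => h.2) (by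
    obtain ⟨x, hx⟩ := (Pm i).1
    simp only [mem_inter] at hx
    exact ⟨x, by simp [hx.1, hX hx.2]⟩)
  choose P' hP' hc hx hy using fun i =>
    ((Pc i).mono_graph (within_le G M)).exists_thin (Pm i).1 (Pm i).2
  choose x hx using hx
  choose y hy using hy
  exact ⟨P', x, y, hc, fun i => (hP' i).trans (PM i),
    fun i j hij => (Pd i j hij).mono (hP' i) (hP' j), hx, hy⟩

/-- Two vertices of the octahedron-like graph `K_{2,2,2,2}` on `Fin 8` are adjacent iff they lie
in different pairs `2 * i`, `2 * i + 1`. -/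
abbrev OctAdj (i j : Fin 8) : Prop := i.val / 2 ≠ j.val / 2

/-- The sets `p k ∪ q k` form a model of `K7vee` in the pattern `A`. -/
def IsPairModel {n : ℕ} (A : Fin n → Fin n → Bool) (p q : Fin 7 → Fin n) : Prop :=
  (∀ i, p i = q i ∨ A (p i) (q i) = true) ∧
  (∀ i j, i < j → p i ≠ p j ∧ p i ≠ q j ∧ q i ≠ p j ∧ q i ≠ q j) ∧
  ∀ i j, i < j → (i = 0 → 2 < j) →
    (A (p i) (p j) || A (p i) (q j) || A (q i) (p j) || A (q i) (q j)) = true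

instance {n : ℕ} (A : Fin n → Fin n → Bool) (p q : Fin 7 → Fin n) :
    Decidable (IsPairModel A p q) := by
  unfold IsPairModel; infer_instance

theorem isMinor_K7vee_of_bags {G : SimpleGraph V} (D : Fin 7 → Finset V) (hc : ∀ i, Conn G (D i))
    (hd : ∀ i j, i < j → Disjoint (D i) (D j))
    (ha : ∀ i j, i < j → (i = 0 → 2 < j) → Touch G (D i) (D j)) : IsMinor K7vee G := by
  rw [isMinor_iff]
  refine ⟨D, hc, fun i j hij => ?_, fun i j hij => ?_⟩
  · rcases lt_or_gt_of_ne hij with h | h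
    · exact hd i j h
    · exact (hd j i h).symm
  · have hne : i ≠ j := hij.ne
    have key : ∀ i j : Fin 7, i < j → K7vee.Adj i j → i = 0 → 2 < j := by
      intro i j _ h h0
      subst h0
      fin_cases j <;> simp_all [K7vee]
    rcases lt_or_gt_of_ne hne with h | h
    · exact ha i j h (key i j h hij)
    · exact (ha j i h (key j i h hij.symm)).symm

theorem isMinor_K7vee_of_pairs {n : ℕ} {G : SimpleGraph V} (D : Fin n → Finset V)
    (hc : ∀ i, Conn G (D i)) (hd : ∀ i j, i ≠ j → Disjoint (D i) (D j))
    {A : Fin n → Fin n → Bool} (hA : ∀ i j, A i j = true → Touch G (D i) (D j))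
    {p q : Fin 7 → Fin n} (h : IsPairModel A p q) : IsMinor K7vee G := by
  obtain ⟨h1, h2, h3⟩ := h
  refine isMinor_K7vee_of_bags (fun i => D (p i) ∪ D (q i)) (fun i => ?_) (fun i j hij => ?_)
    fun i j hij h0 => ?_
  · rcases h1 i with h | h
    · simpa [h] using hc (q i)
    · exact (hc _).union (hc _) (Or.inr (hA _ _ h))
  · obtain ⟨a, b, c, d⟩ := h2 i j hij
    simp only [disjoint_union_left, disjoint_union_right]
    exact ⟨⟨hd _ _ a, hd _ _ c⟩, hd _ _ b, hd _ _ d⟩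
  · have := h3 i j hij h0
    simp only [Bool.or_eq_true] at this
    rcases this with ((h | h) | h) | h
    · exact (hA _ _ h).mono subset_union_left subset_union_left
    · exact (hA _ _ h).mono subset_union_left subset_union_right
    · exact (hA _ _ h).mono subset_union_right subset_union_left
    · exact (hA _ _ h).mono subset_union_right subset_union_right

/-- `K_{2,2,2,2}` on `0, …, 7` without the edges `02`, `04`, and a vertex `8` adjacent to
`a, b, c, d`. -/
def patternFour (a b c d : Fin 8) (i j : Fin 9) : Bool :=
  if i.val = 8 then (j.val = a.val || j.val = b.val || j.val = c.val || j.val = d.val)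
  else if j.val = 8 then (i.val = a.val || i.val = b.val || i.val = c.val || i.val = d.val)
  else i.val / 2 ≠ j.val / 2 && !((i.val = 0 && (j.val = 2 || j.val = 4)) ||
    (j.val = 0 && (i.val = 2 || i.val = 4)))

/-- `K_{2,2,2,2}` on `0, …, 7` without the triangle `024`, and a vertex `8` adjacent to
`0, 2, 4, e`. -/
def patternThree (e : Fin 8) (i j : Fin 9) : Bool :=
  if i.val = 8 then (j.val = 0 || j.val = 2 || j.val = 4 || j.val = e.val)
  else if j.val = 8 then (i.val = 0 || i.val = 2 || i.val = 4 || i.val = e.val)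
  else i.val / 2 ≠ j.val / 2 && !(i.val < 6 && j.val < 6 && i.val % 2 = 0 && j.val % 2 = 0)

def modelFst : Fin 20 → Fin 7 → Fin 9 := ![
  ![4, 0, 5, 6, 8, 3, 7], ![4, 8, 5, 6, 1, 2, 7], ![0, 1, 4, 5, 8, 3, 6], ![3, 6, 2, 8, 1, 4, 7],
  ![8, 1, 5, 4, 6, 3, 7], ![8, 1, 4, 5, 7, 3, 6], ![8, 6, 3, 5, 1, 4, 7], ![8, 1, 5, 4, 7, 2, 6],
  ![8, 5, 1, 7, 3, 4, 6], ![8, 3, 6, 4, 7, 1, 5], ![8, 1, 3, 4, 6, 5, 7], ![8, 2, 6, 4, 7, 1, 5],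
  ![8, 4, 1, 7, 2, 5, 6], ![8, 5, 6, 4, 7, 1, 3], ![8, 3, 7, 5, 6, 1, 4], ![8, 1, 4, 5, 6, 3, 7],
  ![8, 1, 3, 5, 6, 4, 7], ![8, 7, 4, 5, 1, 2, 6], ![8, 2, 7, 5, 6, 1, 4], ![8, 4, 7, 1, 3, 5, 6]]

def modelSnd : Fin 20 → Fin 7 → Fin 9 := ![
  ![4, 0, 5, 2, 1, 3, 7], ![4, 3, 5, 0, 1, 2, 7], ![0, 1, 4, 2, 7, 3, 6], ![3, 0, 2, 5, 1, 4, 7],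
  ![8, 1, 5, 2, 0, 3, 7], ![8, 1, 4, 2, 0, 3, 6], ![8, 0, 3, 2, 1, 4, 7], ![8, 1, 5, 3, 0, 2, 6],
  ![8, 2, 1, 0, 3, 4, 6], ![8, 3, 6, 2, 0, 1, 5], ![8, 1, 3, 2, 0, 5, 7], ![8, 2, 6, 3, 0, 1, 5],
  ![8, 3, 1, 0, 2, 5, 6], ![8, 5, 6, 2, 0, 1, 3], ![8, 3, 7, 2, 0, 1, 4], ![8, 1, 4, 2, 0, 3, 7],
  ![8, 1, 3, 2, 0, 4, 7], ![8, 0, 4, 3, 1, 2, 6], ![8, 2, 7, 3, 0, 1, 4], ![8, 2, 0, 1, 3, 5, 6]]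

theorem patternFour_model : ∀ a b c d : Fin 8, a < b → b < c → c < d →
    ∃ k, IsPairModel (patternFour a b c d) (modelFst k) (modelSnd k) := by
  decide +kernel

theorem patternThree_model : ∀ e : Fin 8, e = 1 ∨ e = 3 ∨ e = 5 →
    IsPairModel (patternThree e) ![5, 8, 4, 6, 1, 3, 7] ![5, 0, 4, 2, 1, 3, 7] ∨
    IsPairModel (patternThree e) ![0, 1, 5, 7, 8, 3, 6] ![0, 1, 5, 4, 2, 3, 6] ∨
    IsPairModel (patternThree e) ![0, 1, 5, 7, 8, 3, 6] ![0, 1, 5, 2, 4, 3, 6] := by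
  decide +kernel

/-- Nine bags, indexed by `Fin 9`, from eight bags and one more. -/
def addBag (B : Fin 8 → Finset V) (C : Finset V) (i : Fin 9) : Finset V :=
  if h : i.val < 8 then B ⟨i.val, h⟩ else C

theorem conn_addBag {G : SimpleGraph V} {B : Fin 8 → Finset V} {C : Finset V}
    (hB : ∀ i, Conn G (B i)) (hC : Conn G C) (i : Fin 9) : Conn G (addBag B C i) := by
  unfold addBag; split_ifs; exacts [hB _, hC]

theorem disjoint_addBag {B : Fin 8 → Finset V} {C : Finset V}
    (hd : ∀ i j, i ≠ j → Disjoint (B i) (B j)) (hdC : ∀ i, Disjoint (B i) C) (i j : Fin 9)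
    (hij : i ≠ j) : Disjoint (addBag B C i) (addBag B C j) := by
  unfold addBag
  split_ifs with h1 h2 h2
  · exact hd _ _ fun h => hij (by ext; simpa using h)
  · exact hdC _
  · exact (hdC _).symm
  · exact absurd (by omega : i = j) hij

theorem isMinor_of_octahedral_of_four {G : SimpleGraph V} {B : Fin 8 → Finset V} {C : Finset V}
    (hB : ∀ i, Conn G (B i)) (hC : Conn G C) (hd : ∀ i j, i ≠ j → Disjoint (B i) (B j))
    (hdC : ∀ i, Disjoint (B i) C)
    (ha : ∀ i j, i < j → OctAdj i j → (i = 0 → j ≠ 2 ∧ j ≠ 4) → Touch G (B i) (B j))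
    (h4 : 4 ≤ #(univ.filter fun i => Touch G (B i) C)) : IsMinor K7vee G := by
  obtain ⟨T, hT, hT4⟩ := exists_subset_card_eq h4
  let e := T.orderEmbOfFin hT4
  have he : ∀ i, Touch G (B (e i)) C := fun i => by
    have := hT (T.orderEmbOfFin_mem hT4 i)
    simpa using this
  have hlt : ∀ i j : Fin 4, i < j → e i < e j := fun i j h => e.strictMono h
  obtain ⟨k, hk⟩ := patternFour_model (e 0) (e 1) (e 2) (e 3) (hlt _ _ (by decide))
    (hlt _ _ (by decide)) (hlt _ _ (by decide))
  refine isMinor_K7vee_of_pairs (addBag B C) (conn_addBag hB hC) (disjoint_addBag hd hdC) ?_ hk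
  have hsym : ∀ i j, i ≠ j → OctAdj i j → (i = 0 → j ≠ 2 ∧ j ≠ 4) → (j = 0 → i ≠ 2 ∧ i ≠ 4) →
      Touch G (B i) (B j) := by
    intro i j hne h h1 h2
    rcases lt_or_gt_of_ne hne with hl | hl
    · exact ha i j hl h h1
    · exact (ha j i hl h.symm h2).symm
  have hmem : ∀ j : Fin 8, (j.val = (e 0).val ∨ j.val = (e 1).val ∨ j.val = (e 2).val ∨
      j.val = (e 3).val) → Touch G (B j) C := by
    rintro j (h | h | h | h) <;> rw [Fin.ext h] <;> exact he _
  intro i j hij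
  unfold patternFour at hij
  unfold addBag
  split_ifs at hij with h1 h2
  · simp only [Bool.or_eq_true, decide_eq_true_eq] at hij
    have hj : j.val < 8 := by omega
    simp only [h1, lt_irrefl, dif_neg, not_false_eq_true, hj, dif_pos]
    exact (hmem ⟨j, hj⟩ (by simpa [or_assoc] using hij)).symm
  · simp only [Bool.or_eq_true, decide_eq_true_eq] at hij
    have hi : i.val < 8 := by omega
    simp only [h2, lt_irrefl, dif_neg, not_false_eq_true, hi, dif_pos]
    exact hmem ⟨i, hi⟩ (by simpa [or_assoc] using hij)
  · have hi : i.val < 8 := by omega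
    have hj : j.val < 8 := by omega
    simp only [hi, hj, dif_pos]
    simp only [ne_eq, decide_not, Bool.and_eq_true, Bool.not_eq_eq_eq_not, Bool.not_true,
      decide_eq_false_iff_not, Bool.or_eq_false_iff, Bool.and_eq_false_imp, decide_eq_true_eq] at hij
    refine hsym _ _ (fun h => hij.1 (by simp only [Fin.mk.injEq] at h; rw [h])) hij.1
      (fun h => ?_) fun h => ?_
    · have := hij.2.1 (congrArg Fin.val h)
      exact ⟨fun h' => this.1 (congrArg Fin.val h'), fun h' => this.2 (congrArg Fin.val h')⟩
    · have := hij.2.2 (congrArg Fin.val h)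
      exact ⟨fun h' => this.1 (congrArg Fin.val h'), fun h' => this.2 (congrArg Fin.val h')⟩

theorem isMinor_of_octahedral_of_three {G : SimpleGraph V} {B : Fin 8 → Finset V} {C : Finset V}
    (hB : ∀ i, Conn G (B i)) (hC : Conn G C) (hd : ∀ i j, i ≠ j → Disjoint (B i) (B j))
    (hdC : ∀ i, Disjoint (B i) C)
    (ha : ∀ i j, OctAdj i j → ¬ ((i = 0 ∨ i = 2 ∨ i = 4) ∧ (j = 0 ∨ j = 2 ∨ j = 4)) →
      Touch G (B i) (B j))
    (h0 : Touch G (B 0) C) (h2 : Touch G (B 2) C) (h4 : Touch G (B 4) C) {e : Fin 8}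
    (he : e = 1 ∨ e = 3 ∨ e = 5) (heC : Touch G (B e) C) : IsMinor K7vee G := by
  suffices hA : ∀ i j, patternThree e i j = true → Touch G (addBag B C i) (addBag B C j) by
    rcases patternThree_model e he with h | h | h <;>
      exact isMinor_K7vee_of_pairs (addBag B C) (conn_addBag hB hC) (disjoint_addBag hd hdC) hA h
  have hmem : ∀ j : Fin 8, (j.val = 0 ∨ j.val = 2 ∨ j.val = 4 ∨
      j.val = e.val) → Touch G (B j) C := by
    rintro j (h | h | h | h)
    · rw [show j = 0 from Fin.ext h]; exact h0
    · rw [show j = 2 from Fin.ext h]; exact h2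
    · rw [show j = 4 from Fin.ext h]; exact h4
    · rw [Fin.ext h]; exact heC
  intro i j hij
  unfold patternThree at hij
  unfold addBag
  split_ifs at hij with h1 h2
  · simp only [Bool.or_eq_true, decide_eq_true_eq] at hij
    have hj : j.val < 8 := by omega
    simp only [h1, lt_irrefl, dif_neg, not_false_eq_true, hj, dif_pos]
    exact (hmem ⟨j, hj⟩ (by simpa [or_assoc] using hij)).symm
  · simp only [Bool.or_eq_true, decide_eq_true_eq] at hij
    have hi : i.val < 8 := by omega
    simp only [h2, lt_irrefl, dif_neg, not_false_eq_true, hi, dif_pos]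
    exact hmem ⟨i, hi⟩ (by simpa [or_assoc] using hij)
  · have hi : i.val < 8 := by omega
    have hj : j.val < 8 := by omega
    simp only [hi, hj, dif_pos]
    simp only [ne_eq, decide_not, Bool.and_eq_true, Bool.not_eq_eq_eq_not, Bool.not_true,
      decide_eq_false_iff_not, Bool.and_eq_false_imp, decide_eq_true_eq] at hij
    refine ha _ _ hij.1 ?_
    simp only [Fin.ext_iff]
    rintro ⟨h, h'⟩
    simp only [Fin.val_zero] at h h'
    have := hij.2
    omega

/-- Automorphisms of `K_{2,2,2,2}` are transitive on ordered triangles. -/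
theorem exists_octahedral_automorphism : ∀ a b c : Fin 8, OctAdj a b → OctAdj a c → OctAdj b c →
    ∃ s : Fin 8 → Fin 8, s 0 = a ∧ s 2 = b ∧ s 4 = c ∧ ∀ i j, (OctAdj (s i) (s j) ↔ OctAdj i j) ∧
      (s i = s j → i = j) := by
  let f : Fin 8 → Fin 8 := fun a => if a.val % 2 = 0 then a + 1 else a - 1
  have : ∀ a b c : Fin 8, OctAdj a b → OctAdj a c → OctAdj b c → ∃ d : Fin 8, ∀ i j,
    (OctAdj (![a, f a, b, f b, c, f c, d, f d] i) (![a, f a, b, f b, c, f c, d, f d] j) ↔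
      OctAdj i j) ∧
    (![a, f a, b, f b, c, f c, d, f d] i = ![a, f a, b, f b, c, f c, d, f d] j → i = j) := by
    decide +kernel
  intro a b c h1 h2 h3
  obtain ⟨d, hd⟩ := this a b c h1 h2 h3
  exact ⟨_, rfl, rfl, rfl, hd⟩

/-- Twice the number of edges of `G` inside `R`. -/
noncomputable def ec (G : SimpleGraph V) (R : Finset V) : ℕ :=
  #((R ×ˢ R).filter fun p => G.Adj p.1 p.2)

/-- The number of neighbours of `v` in `R`. -/
noncomputable def dg (G : SimpleGraph V) (R : Finset V) (v : V) : ℕ :=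
  #(R.filter fun u => G.Adj v u)

theorem ec_eq_sum (G : SimpleGraph V) (R : Finset V) : ec G R = ∑ v ∈ R, dg G R v := by
  unfold ec dg
  rw [Finset.card_filter, Finset.sum_product]
  simp only [Finset.card_filter]

theorem ec_univ (G : SimpleGraph V) : ec G univ = 2 * G.edgeSet.ncard := by
  rw [ec_eq_sum, ← SimpleGraph.coe_edgeFinset, Set.ncard_coe_finset,
    ← SimpleGraph.sum_degrees_eq_twice_card_edges]
  refine Finset.sum_congr rfl fun v _ => ?_
  rw [← SimpleGraph.card_neighborFinset_eq_degree]
  unfold dg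
  congr 1
  ext u; simp

theorem ec_induce (G : SimpleGraph V) (R : Finset V) :
    ec (G.induce (R : Set V)) univ = ec G R := by
  unfold ec
  refine Finset.card_bij (fun p _ => (p.1.1, p.2.1)) (fun p hp => ?_) (fun p _ q _ h => ?_)
    fun p hp => ?_
  · simpa using hp
  · simp only [Prod.mk.injEq] at h
    exact Prod.ext (Subtype.ext h.1) (Subtype.ext h.2)
  · simp only [mem_filter, mem_product] at hp
    exact ⟨(⟨p.1, by simpa using hp.1.1⟩, ⟨p.2, by simpa using hp.1.2⟩), by simpa using hp.2, rfl⟩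

theorem ec_even (G : SimpleGraph V) (R : Finset V) : ∃ m, ec G R = 2 * m :=
  ⟨_, (ec_induce G R).symm.trans (ec_univ _)⟩

theorem ec_add_ec_le {G : SimpleGraph V} {R C D S : Finset V} (hR : R ⊆ C ∪ D)
    (hC : S ⊆ C) (hD : S ⊆ D)
    (hCD : ∀ a ∈ R, ∀ b ∈ R, a ∉ C → b ∉ D → ¬ G.Adj a b) :
    ec G R + ec G S ≤ ec G C + ec G D := by
  unfold ec
  refine le_trans (add_le_add (card_le_card ?_) (card_le_card ?_))
    (card_union_add_card_inter _ _).le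
  · rintro ⟨a, b⟩ h
    simp only [mem_filter, mem_product, mem_union] at h ⊢
    obtain ⟨⟨ha, hb⟩, hab⟩ := h
    have ha' := mem_union.mp (hR ha)
    have hb' := mem_union.mp (hR hb)
    have h1 : a ∉ C → b ∈ D := fun h => by_contra fun h' => hCD a ha b hb h h' hab
    have h2 : b ∉ C → a ∈ D := fun h => by_contra fun h' => hCD b hb a ha h h' hab.symm
    by_cases haC : a ∈ C <;> by_cases hbC : b ∈ C <;> simp_all
  · rintro ⟨a, b⟩ h
    simp only [mem_filter, mem_product, mem_inter] at h ⊢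
    exact ⟨⟨⟨hC h.1.1, hC h.1.2⟩, h.2⟩, ⟨hD h.1.1, hD h.1.2⟩, h.2⟩

theorem ec_insert (G : SimpleGraph V) {R : Finset V} {v : V} (hv : v ∉ R) :
    ec G (insert v R) = ec G R + 2 * dg G R v := by
  have h1 : ∀ u ∈ R, dg G (insert v R) u = dg G R u + if G.Adj u v then 1 else 0 := by
    intro u _
    unfold dg
    rw [filter_insert]
    split_ifs with h
    · rw [card_insert_of_notMem (by simp [hv])]
    · rfl
  have h2 : dg G (insert v R) v = dg G R v := by
    unfold dg
    rw [filter_insert, if_neg (G.loopless.irrefl v)]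
  rw [ec_eq_sum, sum_insert hv, sum_congr rfl h1, sum_add_distrib, ← ec_eq_sum, h2]
  have : ∑ x ∈ R, (if G.Adj x v then 1 else 0) = dg G R v := by
    unfold dg
    rw [Finset.card_filter]
    exact sum_congr rfl fun x _ => by simp [G.adj_comm]
  omega

theorem ec_erase (G : SimpleGraph V) {R : Finset V} {v : V} (hv : v ∈ R) :
    ec G R = ec G (R.erase v) + 2 * dg G (R.erase v) v := by
  rw [← ec_insert G (notMem_erase v R), insert_erase hv]

theorem dg_erase (G : SimpleGraph V) (R : Finset V) (v : V) : dg G (R.erase v) v = dg G R v := by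
  unfold dg
  congr 1
  ext u
  simp only [mem_filter, mem_erase]
  exact ⟨fun h => ⟨h.1.2, h.2⟩, fun h => ⟨⟨h.2.ne', h.1⟩, h.2⟩⟩

theorem dg_le (G : SimpleGraph V) (R : Finset V) (v : V) : dg G R v ≤ #R := card_filter_le _ _

theorem dg_lt (G : SimpleGraph V) {R : Finset V} {v : V} (hv : v ∈ R) : dg G R v < #R := by
  rw [← dg_erase]
  have := dg_le G (R.erase v) v
  rw [card_erase_of_mem hv] at this
  have := card_pos.mpr ⟨v, hv⟩
  omega

theorem ec_le (G : SimpleGraph V) (R : Finset V) : ec G R ≤ #R * (#R - 1) := by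
  rw [ec_eq_sum]
  refine (sum_le_card_nsmul R _ (#R - 1) fun v hv => ?_).trans (by simp)
  have := dg_lt G hv
  omega

theorem KConn.induce {H : SimpleGraph V} {R : Finset V} {k : ℕ} (h : KConn H R k) :
    KConn (H.induce (R : Set V)) univ k := by
  refine ⟨by simpa using h.1, fun U _ hU hne => ?_⟩
  have hb : bd H (U.map ⟨Subtype.val, Subtype.val_injective⟩) ∩ R =
      (bd (H.induce (R : Set V)) U).map ⟨Subtype.val, Subtype.val_injective⟩ := by
    ext x
    simp only [mem_inter, mem_bd, mem_map, Function.Embedding.coeFn_mk]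
    constructor
    · rintro ⟨⟨h1, u, ⟨u', hu', rfl⟩, h2⟩, hx⟩
      exact ⟨⟨x, by simpa using hx⟩, ⟨fun h => h1 ⟨_, h, rfl⟩, u', hu', by simpa using h2⟩, rfl⟩
    · rintro ⟨x', ⟨h1, u, hu, h2⟩, rfl⟩
      refine ⟨⟨?_, u, ⟨u, hu, rfl⟩, by simpa using h2⟩, by simp⟩
      rintro ⟨y, hy, hxy⟩
      exact h1 (Subtype.ext hxy ▸ hy)
  have := h.2 (U.map ⟨Subtype.val, Subtype.val_injective⟩) (by
    intro x hx
    obtain ⟨y, _, rfl⟩ := mem_map.mp hx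
    simp) (by simpa using hU) (by
    obtain ⟨y, hy⟩ := hne
    refine ⟨y, ?_⟩
    simp only [mem_sdiff, mem_union, not_or, mem_univ, true_and] at hy ⊢
    refine ⟨by simp, ?_, fun h => ?_⟩
    · rw [mem_map]
      rintro ⟨z, hz, hzy⟩
      exact hy.1 (Subtype.ext hzy ▸ hz)
    · have : (y : V) ∈ bd H (U.map ⟨Subtype.val, Subtype.val_injective⟩) ∩ R := by simp [h]
      rw [hb] at this
      obtain ⟨z, hz, hzy⟩ := mem_map.mp this
      exact hy.2 (Subtype.ext hzy ▸ hz))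
  rw [hb, card_map] at this
  refine this.trans_eq ?_
  congr 1
  ext x; simp

/-- `φ` labels the vertices of `R` so that `H` restricted to `R` is `K_{2,2,2,2}`. -/
structure IsOctahedral (H : SimpleGraph V) (R : Finset V) (φ : Fin 8 → V) : Prop where
  injective : Function.Injective φ
  image : univ.image φ = R
  adj : ∀ i j, H.Adj (φ i) (φ j) ↔ OctAdj i j

theorem exists_isOctahedral {H : SimpleGraph V} {R : Finset V}
    (e : H.induce (R : Set V) ≃g K2222) : ∃ φ, IsOctahedral H R φ := by
  let p : Fin 8 → Fin 4 × Fin 2 := fun i => (⟨i.val / 2, by omega⟩, ⟨i.val % 2, by omega⟩)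
  have hp : Function.Injective p := fun i j h => by
    simp only [p, Prod.mk.injEq, Fin.mk.injEq] at h
    ext; omega
  refine ⟨fun i => (e.symm (p i)).1, fun i j h => hp (e.symm.injective (Subtype.ext h)), ?_,
    fun i j => ?_⟩
  · ext x
    simp only [mem_image, mem_univ, true_and]
    constructor
    · rintro ⟨i, rfl⟩; simp
    · intro hx
      let y := e ⟨x, by simpa using hx⟩
      refine ⟨⟨2 * y.1.val + y.2.val, by omega⟩, ?_⟩
      have : p ⟨2 * y.1.val + y.2.val, by omega⟩ = y := by
        ext
        · simp only [p]; omega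
        · simp only [p]; omega
      rw [this]; simp [y]
  · have := e.symm.map_adj_iff (v := p i) (w := p j)
    rw [← SimpleGraph.comap_adj (f := Subtype.val) (G := H)]
    refine this.trans ?_
    simp [K2222, p]

/-- A graph on a proper vertex subset that is a minor of a minor-minimal enemy is not an enemy. -/
theorem exists_isOctahedral_of_minor {G : SimpleGraph V} (hG : MinorMinimalEnemy G)
    {H : SimpleGraph V} {R : Finset V} (hR : R ≠ univ) (bag : V → Finset V)
    (hc : ∀ v ∈ R, Conn G (bag v)) (hd : ∀ v ∈ R, ∀ w ∈ R, v ≠ w → Disjoint (bag v) (bag w))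
    (ha : ∀ v ∈ R, ∀ w ∈ R, H.Adj v w → Touch G (bag v) (bag w)) (h4 : KConn H R 4)
    (he : 8 * #R ≤ ec H R + 16) : ∃ φ, IsOctahedral H R φ := by
  by_contra hno
  have hminor : IsMinor (H.induce (R : Set V)) G := by
    rw [isMinor_iff]
    refine ⟨fun v => bag v, fun v => hc v (by simp), fun v w hvw => ?_, fun v w hvw => ?_⟩
    · exact hd v (by simp) w (by simp) fun h => hvw (Subtype.ext h)
    · exact ha v (by simp) w (by simp) (by simpa using hvw)
  have hcard : Fintype.card (R : Set V) = #R := by simp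
  have henemy : Enemy (H.induce (R : Set V)) := by
    refine ⟨(isKConnected_iff _ _).mpr h4.induce, ?_, fun h => hG.1.2.2.1 (isMinor_trans h hminor),
      ⟨fun e => hno (exists_isOctahedral e)⟩⟩
    have h1 := ec_univ (H.induce (R : Set V))
    rw [ec_induce] at h1
    rw [hcard]; omega
  obtain ⟨e⟩ := hG.2 _ _ hminor henemy
  have h1 := Fintype.card_congr e.toEquiv
  rw [hcard] at h1
  exact hR (eq_univ_of_card R h1)

/-- A system of connecting sets as in Menger's theorem which uses every common vertex of `X`
and `Y`. -/
theorem menger_through {G : SimpleGraph V} {M X Y : Finset V} (k : ℕ) (hX : X ⊆ M)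
    (hXY : #(X ∩ Y) ≤ k)
    (hyp : ∀ U ⊆ M, Disjoint U Y → k ≤ #((bd G U ∩ M) ∪ (X \ U))) :
    ∃ (P : Fin k → Finset V) (x y : Fin k → V), (∀ i, Conn G (P i)) ∧ (∀ i, P i ⊆ M) ∧
      (∀ i j, i ≠ j → Disjoint (P i) (P j)) ∧ (∀ i, P i ∩ X = {x i}) ∧ (∀ i, P i ∩ Y = {y i}) ∧
      ∀ z ∈ X ∩ Y, ∃ i, z ∈ P i := by
  let good : (Fin k → Finset V) → Prop := fun P => (∀ i, Conn G (P i)) ∧ (∀ i, P i ⊆ M) ∧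
      (∀ i j, i ≠ j → Disjoint (P i) (P j)) ∧ (∀ i, ∃ x, P i ∩ X = {x}) ∧ ∀ i, ∃ y, P i ∩ Y = {y}
  obtain ⟨P, hP, hmin⟩ := Finset.exists_min_image (univ.filter good) (fun P => ∑ i, #(P i)) (by
    obtain ⟨P, x, y, h1, h2, h3, h4, h5⟩ := menger k hX hyp
    exact ⟨P, by simp only [mem_filter, mem_univ, true_and]
                 exact ⟨h1, h2, h3, fun i => ⟨_, h4 i⟩, fun i => ⟨_, h5 i⟩⟩⟩)
  simp only [mem_filter, mem_univ, true_and] at hP hmin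
  obtain ⟨h1, h2, h3, h4, h5⟩ := hP
  choose x hx using h4
  choose y hy using h5
  refine ⟨P, x, y, h1, h2, h3, hx, hy, fun z hz => ?_⟩
  by_contra hcon
  push Not at hcon
  obtain ⟨hzX, hzY⟩ := mem_inter.mp hz
  have hsmall : ∀ i, #(P i) = 1 := by
    intro i
    by_contra hne
    have h2i : 2 ≤ #(P i) := by
      have := (h1 i).1.card_pos
      omega
    have hg : good (Function.update P i {z}) := by
      refine ⟨fun j => ?_, fun j => ?_, fun j l hjl => ?_, fun j => ?_, fun j => ?_⟩
      · by_cases h : j = i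
        · subst h; simp [conn_singleton]
        · simp [h, h1 j]
      · by_cases h : j = i
        · subst h; simp [hX hzX]
        · simp [h, h2 j]
      · by_cases h : j = i <;> by_cases h' : l = i
        · exact absurd (h.trans h'.symm) hjl
        · subst h; simp [h', hcon]
        · subst h'; simp [h, hcon]
        · simp [h, h', h3 j l hjl]
      · by_cases h : j = i
        · subst h; exact ⟨z, by simp [hzX]⟩
        · exact ⟨x j, by simp [h, hx j]⟩
      · by_cases h : j = i
        · subst h; exact ⟨z, by simp [hzY]⟩
        · exact ⟨y j, by simp [h, hy j]⟩
    have := hmin _ hg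
    rw [← Finset.add_sum_erase _ _ (mem_univ i), ← Finset.add_sum_erase _ _ (mem_univ i)] at this
    have h6 : ∑ j ∈ univ.erase i, #(Function.update P i {z} j) = ∑ j ∈ univ.erase i, #(P j) := by
      refine sum_congr rfl fun j hj => ?_
      rw [Function.update_of_ne (ne_of_mem_erase hj)]
    rw [h6, Function.update_self, card_singleton] at this
    omega
  have hxP : ∀ i, P i = {x i} := fun i => by
    obtain ⟨a, ha⟩ := card_eq_one.mp (hsmall i)
    have : x i ∈ P i ∩ X := by rw [hx i]; simp
    have := (mem_inter.mp this).1
    rw [ha] at this ⊢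
    rw [mem_singleton.mp this]
  have hxXY : ∀ i, x i ∈ (X ∩ Y).erase z := by
    intro i
    have e1 : x i ∈ P i ∩ X := by rw [hx i]; simp
    have e2 : y i ∈ P i ∩ Y := by rw [hy i]; simp
    have e3 : y i = x i := by
      have := (mem_inter.mp e2).1
      rw [hxP i] at this
      exact mem_singleton.mp this
    rw [e3] at e2
    simp only [mem_inter, mem_erase] at e1 e2 ⊢
    refine ⟨?_, e1.2, e2.2⟩
    rintro rfl
    exact hcon i e1.1
  have hinj : Function.Injective x := fun i j h => by
    by_contra hij
    have := h3 i j hij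
    rw [hxP i, hxP j, h] at this
    simp at this
  have : #(univ.image x) ≤ #((X ∩ Y).erase z) := card_le_card fun a ha => by
    obtain ⟨i, _, rfl⟩ := mem_image.mp ha
    exact hxXY i
  rw [card_image_of_injective _ hinj, card_erase_of_mem hz] at this
  have h8 := card_pos.mpr ⟨z, hz⟩
  have h9 : #(univ : Finset (Fin k)) = k := by simp
  omega

theorem isMinor_of_octahedral_of_four_relabel {G : SimpleGraph V} {B : Fin 8 → Finset V}
    {C : Finset V} (hB : ∀ i, Conn G (B i)) (hC : Conn G C)
    (hd : ∀ i j, i ≠ j → Disjoint (B i) (B j)) (hdC : ∀ i, Disjoint (B i) C) {r s t : Fin 8}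
    (hrs : OctAdj r s) (hrt : OctAdj r t) (hst : OctAdj s t)
    (ha : ∀ i j, OctAdj i j → (i = r → j ≠ s ∧ j ≠ t) → (j = r → i ≠ s ∧ i ≠ t) →
      Touch G (B i) (B j))
    {v : Fin 4 → Fin 8} (hv : Function.Injective v) (h4 : ∀ i, Touch G (B (v i)) C) :
    IsMinor K7vee G := by
  obtain ⟨f, f0, f2, f4, hf⟩ := exists_octahedral_automorphism r s t hrs hrt hst
  have finj : Function.Injective f := fun i j h => (hf i j).2 h
  have fsurj := Finite.surjective_of_injective finj
  refine isMinor_of_octahedral_of_four (B := fun i => B (f i)) (C := C) (fun i => hB _) hC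
    (fun i j hij => hd _ _ (finj.ne hij)) (fun i => hdC _) (fun i j hij hadj h0 => ?_) ?_
  · refine ha _ _ ((hf i j).1.mpr hadj) (fun h => ?_) fun h => ?_
    · rw [← f0] at h
      obtain ⟨a, b⟩ := h0 (finj h)
      rw [← f2, ← f4]
      exact ⟨finj.ne a, finj.ne b⟩
    · rw [← f0] at h
      rw [finj h] at hij
      exact absurd hij (Fin.not_lt_zero i)
  · choose g hg using fun i => fsurj (v i)
    have ginj : Function.Injective g := fun i j h => hv (by rw [← hg i, ← hg j, h])
    have : #(univ.image g) = 4 := by rw [card_image_of_injective _ ginj]; simp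
    rw [← this]
    refine card_le_card fun i hi => ?_
    obtain ⟨j, _, rfl⟩ := mem_image.mp hi
    simp [hg, h4]

/-- In a minor-minimal enemy all small boundaries are trivial. -/
theorem four_le_bd {G : SimpleGraph V} (hG : MinorMinimalEnemy G) {U : Finset V} (hU : U.Nonempty)
    {y : V} (hy : y ∉ U) (hy' : y ∉ bd G U) : 4 ≤ #(bd G U) := by
  have := ((isKConnected_iff 4 G).mp hG.1.1).2 U (subset_univ _) hU ⟨y, by simp [hy, hy']⟩
  simpa using this

theorem le_ec_univ {G : SimpleGraph V} (hG : MinorMinimalEnemy G) :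
    8 * Fintype.card V ≤ ec G univ + 16 := by
  have := hG.1.2.1
  rw [ec_univ]
  omega

theorem seven_le_card {G : SimpleGraph V} (hG : MinorMinimalEnemy G) : 7 ≤ Fintype.card V := by
  have h1 := le_ec_univ hG
  have h2 := ec_le G univ
  have h3 := hG.1.1.1
  rw [card_univ] at h2
  by_contra h
  have : Fintype.card V = 5 ∨ Fintype.card V = 6 := by omega
  rcases this with h | h <;> rw [h] at h1 h2 <;> omega

/-- The boundary of a component of the complement of `D` lies in `D`, and has size at least four
if `D` has. -/
theorem four_le_bd_component {G : SimpleGraph V} (hG : MinorMinimalEnemy G) {D K : Finset V}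
    (hD : 4 ≤ #D) (hK : K ⊆ univ \ D) (hne : K.Nonempty)
    (hcl : ∀ a ∈ K, ∀ b ∈ univ \ D, G.Adj a b → b ∈ K) : bd G K ⊆ D ∧ 4 ≤ #(bd G K) := by
  have hsub : bd G K ⊆ D := by
    intro v hv
    obtain ⟨h1, a, ha, hav⟩ := mem_bd.mp hv
    by_contra hvD
    exact h1 (hcl a ha v (by simp [hvD]) hav)
  refine ⟨hsub, ?_⟩
  by_cases h : D ⊆ bd G K
  · exact hD.trans (card_le_card h)
  · obtain ⟨y, hy, hy'⟩ := not_subset.mp h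
    exact four_le_bd hG hne (fun h => (mem_sdiff.mp (hK h)).2 hy) hy'

/-- A minor-minimal enemy has no proper near-octahedral subgraph. -/
theorem not_octahedral {G : SimpleGraph V} (hG : MinorMinimalEnemy G) {φ : Fin 8 → V}
    (hφ : Function.Injective φ) (hne : univ.image φ ≠ univ) {r s : Fin 8} (hrs : OctAdj r s)
    (ha : ∀ i j, OctAdj i j → (i = r → j ≠ s) → (j = r → i ≠ s) → G.Adj (φ i) (φ j)) : False := by
  obtain ⟨v, hv⟩ : ∃ v, v ∉ univ.image φ := by
    by_contra h
    push Not at h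
    exact hne (eq_univ_of_forall h)
  obtain ⟨C, hC, hvC, hCc, hcl⟩ := exists_component G (M := univ \ univ.image φ) (v := v)
    (by simpa using hv)
  obtain ⟨hb, h4⟩ := four_le_bd_component hG
    (by rw [card_image_of_injective _ hφ]; simp) hC ⟨v, hvC⟩ hcl
  obtain ⟨T, hT, hT4⟩ := exists_subset_card_eq h4
  let e := (T.equivFinOfCardEq hT4).symm
  choose g hg using fun i => mem_image.mp (hb (hT (e i).2))
  obtain ⟨t, ht1, ht2⟩ : ∃ t, OctAdj r t ∧ OctAdj s t := by
    exact (by decide : ∀ r s : Fin 8, OctAdj r s → ∃ t, OctAdj r t ∧ OctAdj s t) r s hrs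
  refine hG.1.2.2.1 (isMinor_of_octahedral_of_four_relabel (B := fun i => {φ i}) (C := C)
    (fun i => conn_singleton _ _) hCc (fun i j h => ?_) (fun i => ?_) hrs ht1 ht2
    (fun i j hij h1 h2 => ⟨φ i, by simp, φ j, by simp, ha i j hij (fun h => (h1 h).1)
      fun h => (h2 h).1⟩) (v := g) (fun i j h => ?_) fun i => ?_)
  · simpa using hφ.ne h
  · rw [disjoint_singleton_left]
    intro h
    simpa using hC h
  · have : (e i).1 = (e j).1 := by rw [← (hg i).2, ← (hg j).2, h]
    exact e.injective (Subtype.ext this)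
  · have := hT (e i).2
    rw [← (hg i).2] at this
    obtain ⟨_, a, ha, hadj⟩ := mem_bd.mp this
    exact ⟨_, mem_singleton_self _, a, ha, hadj.symm⟩

/-- `R` is a proper vertex subset, of minimal size, which spans at least `4|R| - 8` edges. -/
structure MinDense (G : SimpleGraph V) (R : Finset V) : Prop where
  enemy : MinorMinimalEnemy G
  ne_univ : R ≠ univ
  dense : 8 * #R ≤ ec G R + 16
  seven_le : 7 ≤ #R
  sparse : ∀ Q : Finset V, #Q < #R → 3 ≤ #Q → ec G Q + 18 ≤ 8 * #Q

/-- `U` is one side of a separation of order at most three of the subgraph induced on `R`. -/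
structure IsSep (G : SimpleGraph V) (R U : Finset V) : Prop where
  subset : U ⊆ R
  nonempty : U.Nonempty
  exists_far : ∃ y ∈ R, y ∉ U ∧ y ∉ bd G U
  small : #(bd G U ∩ R) ≤ 3

section MinDense

variable {G : SimpleGraph V} {R U : Finset V}

theorem MinDense.counts (hR : MinDense G R) (hU : IsSep G R U) :
    #(bd G U ∩ R) = 3 ∧
    8 * #(U ∪ (bd G U ∩ R)) + ec G (bd G U ∩ R) ≤ ec G (U ∪ (bd G U ∩ R)) + 22 ∧
    (∀ s ∈ bd G U ∩ R, 2 ≤ dg G (R \ U) s) := by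
  obtain ⟨y, hyR, hyU, hyb⟩ := hU.exists_far
  have hsum := ec_add_ec_le (G := G) (R := R) (C := R \ U) (D := U ∪ (bd G U ∩ R))
    (S := bd G U ∩ R) (fun x hx => by
      simp only [mem_union, mem_sdiff]; tauto)
    (fun x hx => by
      simp only [mem_inter, mem_bd, mem_sdiff] at hx ⊢; tauto) subset_union_right
    (fun a ha b hb haC hbD hab => by
      simp only [mem_sdiff, mem_union, mem_inter, not_and, not_not, not_or] at haC hbD
      exact hbD.2 (mem_bd.mpr ⟨hbD.1, a, haC ha, hab⟩) hb)
  have hdisj : Disjoint U (bd G U ∩ R) := by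
    rw [Finset.disjoint_left]
    intro x hx hx'
    exact (mem_bd.mp (mem_inter.mp hx').1).1 hx
  have hd : #(U ∪ (bd G U ∩ R)) = #U + #(bd G U ∩ R) := card_union_of_disjoint hdisj
  have hc : #(R \ U) + #U = #R := card_sdiff_add_card_eq_card hU.subset
  have hlt : #(U ∪ (bd G U ∩ R)) < #R := card_lt_card ⟨union_subset hU.subset inter_subset_right,
    fun h => by
      have := h hyR
      simp [hyU, hyb] at this⟩
  have hu := hU.nonempty.card_pos
  have h7 := hR.seven_le
  have hdense := hR.dense
  have hsm := hU.small
  have hCb := hR.sparse (R \ U) (by omega)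
  have hDb := hR.sparse (U ∪ (bd G U ∩ R)) hlt
  have hC2 := ec_le G (R \ U)
  have hD2 := ec_le G (U ∪ (bd G U ∩ R))
  have small : ∀ m, m ≤ 2 → m * (m - 1) ≤ 2 := by
    intro m hm; interval_cases m <;> simp
  have hC3 := small #(R \ U)
  have hD3 := small #(U ∪ (bd G U ∩ R))
  have h3c : 3 ≤ #(R \ U) := by
    by_contra h
    have := hC3 (by omega)
    by_cases h' : 3 ≤ #(U ∪ (bd G U ∩ R))
    · have := hDb h'
      omega
    · omega
  have h3d : 3 ≤ #(U ∪ (bd G U ∩ R)) := by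
    by_contra h
    have := hD3 (by omega)
    have := hCb h3c
    omega
  have hCb := hCb h3c
  have hDb := hDb h3d
  have hs3 : #(bd G U ∩ R) = 3 := by omega
  refine ⟨hs3, by omega, fun s hs => ?_⟩
  have hsC : s ∈ R \ U := by
    simp only [mem_inter, mem_bd, mem_sdiff] at hs ⊢; tauto
  have e1 := ec_erase G hsC
  have e2 := dg_erase G (R \ U) s
  have e3 := card_erase_of_mem hsC
  have e4 := hR.sparse ((R \ U).erase s) (by omega)
  omega

theorem MinDense.isSep_compl (hR : MinDense G R) (hU : IsSep G R U) :
    IsSep G R (R \ (U ∪ bd G U)) ∧ bd G (R \ (U ∪ bd G U)) ∩ R = bd G U ∩ R := by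
  have hsub : bd G (R \ (U ∪ bd G U)) ∩ R ⊆ bd G U ∩ R := by
    intro x hx
    simp only [mem_inter, mem_bd, mem_sdiff, mem_union] at hx ⊢
    obtain ⟨⟨h1, u, ⟨huR, hu⟩, hux⟩, hxR⟩ := hx
    have hxU : x ∉ U := fun h => hu (Or.inr ⟨fun h' => hu (Or.inl h'), x, h, hux.symm⟩)
    refine ⟨⟨hxU, ?_⟩, hxR⟩
    by_contra h
    exact h1 ⟨hxR, fun h' => h'.elim hxU fun h' => h h'.2⟩
  have hsep : IsSep G R (R \ (U ∪ bd G U)) := by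
    obtain ⟨y, hyR, hyU, hyb⟩ := hU.exists_far
    refine ⟨sdiff_subset, ⟨y, by simp [hyR, hyU, hyb]⟩, ?_, (card_le_card hsub).trans hU.small⟩
    obtain ⟨u, hu⟩ := hU.nonempty
    refine ⟨u, hU.subset hu, by simp [hu], fun h => ?_⟩
    obtain ⟨_, a, ha, hau⟩ := mem_bd.mp h
    simp only [mem_sdiff, mem_union, not_or] at ha
    exact ha.2.2 (mem_bd.mpr ⟨ha.2.1, u, hu, hau.symm⟩)
  refine ⟨hsep, eq_of_subset_of_card_le hsub ?_⟩
  rw [(hR.counts hsep).1, (hR.counts hU).1]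

/-- A part of the far side of a separation of `R` is again a separation of `R`, unless its
boundary is large. -/
theorem MinDense.three_le_of_subset_far (hR : MinDense G R) (hU : IsSep G R U) {F : Finset V}
    (hF : F ⊆ R \ (U ∪ bd G U)) (hne : F.Nonempty) : 3 ≤ #(bd G F ∩ R) := by
  by_contra h
  obtain ⟨u, hu⟩ := hU.nonempty
  have hsep : IsSep G R F := by
    refine ⟨hF.trans sdiff_subset, hne, ⟨u, hU.subset hu, fun h => ?_, fun h => ?_⟩, by omega⟩
    · have := hF h
      simp [hu] at this
    · obtain ⟨_, a, ha, hau⟩ := mem_bd.mp h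
      have := hF ha
      simp only [mem_sdiff, mem_union, not_or] at this
      exact this.2.2 (mem_bd.mpr ⟨this.2.1, u, hu, hau.symm⟩)
  have := (hR.counts hsep).1
  omega

/-- The far side of a separation contains a triangle minor rooted at the separator. -/
theorem MinDense.exists_rooted_triangle (hR : MinDense G R) (hU : IsSep G R U) :
    ∃ bag : V → Finset V, ∀ s ∈ bd G U ∩ R, s ∈ bag s ∧ bag s ⊆ R \ U ∧ Conn G (bag s) ∧
      ∀ t ∈ bd G U ∩ R, s ≠ t → Disjoint (bag s) (bag t) ∧ Touch G (bag s) (bag t) := by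
  obtain ⟨hs3, -, hdeg⟩ := hR.counts hU
  obtain ⟨s1, s2, s3, h12, h13, h23, hS⟩ := card_eq_three.mp hs3
  have hsS : ∀ s, s ∈ bd G U ∩ R ↔ s = s1 ∨ s = s2 ∨ s = s3 := by simp [hS]
  have hSC : ∀ s ∈ bd G U ∩ R, s ∈ R \ U := fun s hs => by
    simp only [mem_inter, mem_bd, mem_sdiff] at hs ⊢; tauto
  have hfar : ∀ x, x ∈ R \ U → x ≠ s1 → x ≠ s2 → x ≠ s3 → x ∈ R \ (U ∪ bd G U) := by
    intro x hx h1 h2 h3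
    have := hsS x
    simp only [mem_sdiff, mem_union, mem_inter] at hx this ⊢
    tauto
  have hnbr : ∀ F ⊆ R \ (U ∪ bd G U), ∀ x ∈ bd G F ∩ R, x ∈ R \ U := by
    intro F hF x hx
    simp only [mem_inter, mem_bd, mem_sdiff] at hx ⊢
    obtain ⟨⟨h1, u, huF, hux⟩, hxR⟩ := hx
    refine ⟨hxR, fun hxU => ?_⟩
    have := hF huF
    simp only [mem_sdiff, mem_union, not_or] at this
    exact this.2.2 (mem_bd.mpr ⟨this.2.1, x, hxU, hux.symm⟩)
  obtain ⟨P, x, y, hc, hPM, hPd, hPx, hPy⟩ := menger (G := G) (M := (R \ U).erase s2)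
      (X := (R \ U).filter fun u => G.Adj s2 u) (Y := {s1, s3}) 2 (fun u hu => by
        simp only [mem_filter, mem_erase] at hu ⊢
        exact ⟨hu.2.ne', hu.1⟩) (fun F hF hd => by
    rcases F.eq_empty_or_nonempty with rfl | hne
    · have := hdeg s2 (by simp [hS])
      refine this.trans (card_le_card fun u hu => mem_union_right _ ?_)
      simpa using hu
    · simp only [disjoint_insert_right, disjoint_singleton_right] at hd
      have hFfar : F ⊆ R \ (U ∪ bd G U) := fun u hu => by
        obtain ⟨h2, h⟩ := mem_erase.mp (hF hu)
        exact hfar u h (fun h => hd.1 (h ▸ hu)) h2 (fun h => hd.2 (h ▸ hu))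
      have h3 := hR.three_le_of_subset_far hU hFfar hne
      have : #(bd G F ∩ R) ≤ #(insert s2 (bd G F ∩ (R \ U).erase s2)) := by
        refine card_le_card fun u hu => ?_
        have := hnbr F hFfar u hu
        by_cases h : u = s2
        · simp [h]
        · exact mem_insert_of_mem (mem_inter.mpr ⟨(mem_inter.mp hu).1, mem_erase.mpr ⟨h, this⟩⟩)
      have h4 := card_insert_le s2 (bd G F ∩ (R \ U).erase s2)
      have h5 := card_le_card
        (subset_union_left : bd G F ∩ (R \ U).erase s2 ⊆ _ ∪ ((R \ U).filter (fun u => G.Adj s2 u)) \ F)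
      omega)
  -- name the two connecting sets by their ends
  obtain ⟨A, B, hA, hB, hAM, hBM, hAB, h1A, h3B, hA2, hB2⟩ : ∃ A B : Finset V, Conn G A ∧
      Conn G B ∧ A ⊆ (R \ U).erase s2 ∧ B ⊆ (R \ U).erase s2 ∧ Disjoint A B ∧ s1 ∈ A ∧ s3 ∈ B ∧
      (∃ a ∈ A, G.Adj s2 a) ∧ ∃ b ∈ B, G.Adj s2 b := by
    have hy : ∀ i, y i ∈ P i ∧ (y i = s1 ∨ y i = s3) := fun i => by
      have : y i ∈ P i ∩ {s1, s3} := by rw [hPy i]; simp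
      simpa using this
    have hx : ∀ i, ∃ a ∈ P i, G.Adj s2 a := fun i => by
      have : x i ∈ P i ∩ (R \ U).filter (fun u => G.Adj s2 u) := by rw [hPx i]; simp
      simp only [mem_inter, mem_filter] at this
      exact ⟨x i, this.1, this.2.2⟩
    have h01 := hPd 0 1 (by decide)
    have hne : y 0 ≠ y 1 := fun h => Finset.disjoint_left.mp h01 (hy 0).1 (h ▸ (hy 1).1)
    rcases (hy 0).2 with h0 | h0
    · have h1 : y 1 = s3 := (hy 1).2.resolve_left fun h => hne (h0.trans h.symm)
      exact ⟨P 0, P 1, hc 0, hc 1, hPM 0, hPM 1, h01, h0 ▸ (hy 0).1, h1 ▸ (hy 1).1, hx 0, hx 1⟩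
    · have h1 : y 1 = s1 := (hy 1).2.resolve_right fun h => hne (h0.trans h.symm)
      exact ⟨P 1, P 0, hc 1, hc 0, hPM 1, hPM 0, h01.symm, h1 ▸ (hy 1).1, h0 ▸ (hy 0).1,
        hx 1, hx 0⟩
  have h1B : s1 ∉ B := fun h => Finset.disjoint_left.mp hAB h1A h
  obtain ⟨Q, hQM, h1Q, hQ, hQcl⟩ := exists_component G (M := (R \ U).erase s2 \ B) (v := s1)
    (by simp only [mem_sdiff]; exact ⟨hAM h1A, h1B⟩)
  have hQB : Disjoint Q B := by
    rw [Finset.disjoint_left]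
    exact fun u hu => (mem_sdiff.mp (hQM hu)).2
  have hQC : Q ⊆ (R \ U).erase s2 := fun u hu => (mem_sdiff.mp (hQM hu)).1
  have hAQ : A ⊆ Q := by
    have := hA.2 (A ∩ Q) inter_subset_left ⟨s1, by simp [h1A, h1Q]⟩ fun a ha b hb hab => by
      simp only [mem_inter] at ha ⊢
      exact ⟨hb, hQcl a ha.2 b (mem_sdiff.mpr ⟨hAM hb, fun h => Finset.disjoint_left.mp hAB hb h⟩) hab⟩
    rw [← this]; exact inter_subset_right
  have hQtB : Touch G Q B := by
    by_contra hno
    have hcl : ∀ a ∈ Q, ∀ b ∈ R \ U, b ∉ Q → G.Adj a b → b = s2 := by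
      intro a ha b hb hbQ hab
      by_contra hb2
      by_cases hbB : b ∈ B
      · exact hno ⟨a, ha, b, hbB, hab⟩
      · exact hbQ (hQcl a ha b (by simp only [mem_sdiff, mem_erase] at hb ⊢; tauto) hab)
    rcases (Q.erase s1).eq_empty_or_nonempty with hemp | hne
    · have h2 := hdeg s1 (by simp [hS])
      have : (R \ U).filter (fun u => G.Adj s1 u) ⊆ {s2} := fun u hu => by
        obtain ⟨hu1, hu2⟩ := mem_filter.mp hu
        refine mem_singleton.mpr (hcl s1 h1Q u hu1 (fun h => ?_) hu2)
        have : u ∈ Q.erase s1 := mem_erase.mpr ⟨hu2.ne', h⟩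
        rw [hemp] at this
        exact absurd this (notMem_empty u)
      have := card_le_card this
      unfold dg at h2
      simp at this
      omega
    · have hF : Q.erase s1 ⊆ R \ (U ∪ bd G U) := fun u hu => by
        obtain ⟨h1, h⟩ := mem_erase.mp hu
        obtain ⟨h2, h'⟩ := mem_erase.mp (hQC h)
        exact hfar u h' h1 h2 fun h3 => Finset.disjoint_left.mp hQB h (h3 ▸ h3B)
      have h3 := hR.three_le_of_subset_far hU hF hne
      have : bd G (Q.erase s1) ∩ R ⊆ {s1, s2} := fun u hu => by
        have huC := hnbr _ hF u hu
        obtain ⟨hu1, a, ha, hau⟩ := mem_bd.mp (mem_inter.mp hu).1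
        simp only [mem_insert, mem_singleton]
        by_cases h : u = s1
        · exact Or.inl h
        · refine Or.inr (hcl a (mem_of_mem_erase ha) u huC (fun hQ => ?_) hau)
          exact hu1 (mem_erase.mpr ⟨h, hQ⟩)
      have := card_le_card this
      have := card_le_two (a := s1) (b := s2)
      omega
  have hBC : B ⊆ R \ U := hBM.trans (erase_subset _ _)
  have h2Q : s2 ∉ Q := fun h => by simpa using hQC h
  have h2B : s2 ∉ B := fun h => by simpa using hBM h
  have hT12 : Touch G Q {s2} := by
    obtain ⟨a, ha, h⟩ := hA2
    exact ⟨a, hAQ ha, s2, by simp, h.symm⟩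
  have hT23 : Touch G {s2} B := by
    obtain ⟨b, hb, h⟩ := hB2
    exact ⟨s2, by simp, b, hb, h⟩
  refine ⟨fun v => if v = s1 then Q else if v = s3 then B else {v}, fun s hs => ?_⟩
  have hs2C : {s2} ⊆ R \ U := by
    rw [singleton_subset_iff]; exact hSC s2 (by simp [hS])
  rcases (hsS s).mp hs with rfl | rfl | rfl
  · simp only [if_true]
    refine ⟨h1Q, hQC.trans (erase_subset _ _), hQ, fun t ht hne => ?_⟩
    rcases (hsS t).mp ht with rfl | rfl | rfl
    · exact absurd rfl hne
    · simp [h12.symm, h23, h2Q, hT12]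
    · simp [h13.symm, hQB, hQtB]
  · simp only [h12.symm, h23, if_false]
    refine ⟨by simp, hs2C, conn_singleton _ _, fun t ht hne => ?_⟩
    rcases (hsS t).mp ht with rfl | rfl | rfl
    · simp [h2Q, hT12.symm]
    · exact absurd rfl hne
    · simp [h13.symm, h2B, hT23]
  · simp only [h13.symm, if_false, if_true]
    refine ⟨h3B, hBC, hB, fun t ht hne => ?_⟩
    rcases (hsS t).mp ht with rfl | rfl | rfl
    · simp [hQB.symm, hQtB.symm]
    · simp [h12.symm, h23, h2B, hT23.symm]
    · exact absurd rfl hne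

end MinDense

/-- The graph obtained from `G` by making `S` a clique. -/
def addClique (G : SimpleGraph V) (S : Finset V) : SimpleGraph V where
  Adj a b := G.Adj a b ∨ (a ∈ S ∧ b ∈ S ∧ a ≠ b)
  symm := ⟨fun _ _ h => h.elim (fun h => Or.inl h.symm) fun h => Or.inr ⟨h.2.1, h.1, h.2.2.symm⟩⟩
  loopless := ⟨fun _ h => h.elim (fun h => h.ne rfl) fun h => h.2.2 rfl⟩

theorem ec_addClique (G : SimpleGraph V) {S D : Finset V} (hS : S ⊆ D) :
    ec G D + #S.offDiag ≤ ec (addClique G S) D + ec G S := by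
  have h1 : #S.offDiag = #(S.offDiag.filter fun p => G.Adj p.1 p.2) +
      #(S.offDiag.filter fun p => ¬ G.Adj p.1 p.2) := (card_filter_add_card_filter_not _).symm
  have h2 : (S.offDiag.filter fun p => G.Adj p.1 p.2) ⊆ (S ×ˢ S).filter fun p => G.Adj p.1 p.2 :=
    fun p hp => by
      simp only [mem_filter, mem_offDiag, mem_product] at hp ⊢
      exact ⟨⟨hp.1.1, hp.1.2.1⟩, hp.2⟩
  have h3 : Disjoint ((D ×ˢ D).filter fun p => G.Adj p.1 p.2)
      (S.offDiag.filter fun p => ¬ G.Adj p.1 p.2) := by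
    rw [Finset.disjoint_left]
    exact fun p hp hp' => (mem_filter.mp hp').2 (mem_filter.mp hp).2
  have h4 : ((D ×ˢ D).filter fun p => G.Adj p.1 p.2) ∪
      (S.offDiag.filter fun p => ¬ G.Adj p.1 p.2) ⊆
      (D ×ˢ D).filter fun p => (addClique G S).Adj p.1 p.2 := fun p hp => by
    simp only [mem_union, mem_filter, mem_offDiag, mem_product] at hp ⊢
    rcases hp with hp | hp
    · exact ⟨hp.1, Or.inl hp.2⟩
    · exact ⟨⟨hS hp.1.1, hS hp.1.2.1⟩, Or.inr hp.1⟩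
  have h5 := card_le_card h4
  rw [card_union_of_disjoint h3] at h5
  have h6 := card_le_card h2
  unfold ec
  omega

section MinDense

variable {G : SimpleGraph V} {R U : Finset V}

/-- A separation of `R` one side of which, with a triangle put on the separator, is octahedral. -/
structure IsLeaf (G : SimpleGraph V) (R U : Finset V) (φ : Fin 8 → V) : Prop where
  isSep : IsSep G R U
  injective : Function.Injective φ
  image : univ.image φ = U ∪ (bd G U ∩ R)
  separator : bd G U ∩ R = {φ 0, φ 2, φ 4}
  adj : ∀ i j, OctAdj i j → ¬ ((i = 0 ∨ i = 2 ∨ i = 4) ∧ (j = 0 ∨ j = 2 ∨ j = 4)) →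
    G.Adj (φ i) (φ j)

theorem disjoint_bd_inter (G : SimpleGraph V) (U R : Finset V) : Disjoint U (bd G U ∩ R) := by
  rw [Finset.disjoint_left]
  exact fun x hx hx' => (mem_bd.mp (mem_inter.mp hx').1).1 hx

theorem MinDense.kConn_addClique (hR : MinDense G R) (hU : IsSep G R U)
    (hmin : ∀ F ⊆ U, IsSep G R F → F = U) :
    KConn (addClique G (bd G U ∩ R)) (U ∪ (bd G U ∩ R)) 4 := by
  obtain ⟨hs3, hcount, -⟩ := hR.counts hU
  have hmono : ∀ {F : Finset V} {x : V}, x ∉ F → x ∈ bd G F →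
      x ∈ bd (addClique G (bd G U ∩ R)) F := fun hx h => by
    obtain ⟨_, a, ha, hab⟩ := mem_bd.mp h
    exact mem_bd.mpr ⟨hx, a, ha, Or.inl hab⟩
  have hD : ∀ {F : Finset V} {x : V}, F ⊆ U → x ∈ bd G F ∩ R → x ∈ U ∪ (bd G U ∩ R) :=
    fun {F x} hF hx => by
      obtain ⟨hx, hxR⟩ := mem_inter.mp hx
      obtain ⟨_, a, ha, hab⟩ := mem_bd.mp hx
      by_cases hxU : x ∈ U
      · exact mem_union_left _ hxU
      · exact mem_union_right _ (mem_inter.mpr ⟨mem_bd.mpr ⟨hxU, a, hF ha, hab⟩, hxR⟩)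
  have hcard : #(U ∪ (bd G U ∩ R)) = #U + 3 := by
    rw [card_union_of_disjoint (disjoint_bd_inter G U R), hs3]
  refine ⟨?_, fun F hF hne hfar => ?_⟩
  · have hpos := hU.nonempty.card_pos
    by_contra h
    obtain ⟨u, hu⟩ := card_eq_one.mp (by omega : #U = 1)
    have huS : u ∉ bd G U ∩ R :=
      fun h => Finset.disjoint_left.mp (disjoint_bd_inter G U R) (by simp [hu]) h
    have e : U ∪ (bd G U ∩ R) = insert u (bd G U ∩ R) := by rw [hu]; rfl
    have e1 := ec_insert G huS
    have e2 := dg_le G (bd G U ∩ R) u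
    rw [← e] at e1
    omega
  by_contra hlt
  obtain ⟨y, hy⟩ := hfar
  have hyD := (mem_sdiff.mp hy).1
  have hyF : y ∉ F := fun h => (mem_sdiff.mp hy).2 (mem_union_left _ h)
  have hyb : y ∉ bd (addClique G (bd G U ∩ R)) F :=
    fun h => (mem_sdiff.mp hy).2 (mem_union_right _ h)
  have hDR : U ∪ (bd G U ∩ R) ⊆ R := union_subset hU.subset inter_subset_right
  by_cases hFS : ∃ s ∈ F, s ∈ bd G U ∩ R
  · obtain ⟨s, hsF, hsS⟩ := hFS
    have hSsub : ∀ t ∈ bd G U ∩ R, t ∈ F ∨ t ∈ bd (addClique G (bd G U ∩ R)) F := fun t ht => by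
      by_cases h : t ∈ F
      · exact Or.inl h
      · exact Or.inr (mem_bd.mpr ⟨h, s, hsF, Or.inr ⟨hsS, ht, fun h' => h (h' ▸ hsF)⟩⟩)
    set F' := (U ∪ (bd G U ∩ R)) \ (F ∪ bd (addClique G (bd G U ∩ R)) F) with hF'
    have hF'U : F' ⊆ U := fun x hx => by
      obtain ⟨h1, h2⟩ := mem_sdiff.mp hx
      refine (mem_union.mp h1).resolve_right fun h => h2 (mem_union.mpr (hSsub x h))
    have hsub : bd G F' ∩ R ⊆ bd (addClique G (bd G U ∩ R)) F ∩ (U ∪ (bd G U ∩ R)) := by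
      intro x hx
      have hxD := hD hF'U hx
      refine mem_inter.mpr ⟨?_, hxD⟩
      obtain ⟨h1, a, ha, hax⟩ := mem_bd.mp (mem_inter.mp hx).1
      by_contra hxb
      have hxF : x ∈ F := by
        by_contra h
        exact h1 (mem_sdiff.mpr ⟨hxD, fun h' => (mem_union.mp h').elim h hxb⟩)
      have ha' := (mem_sdiff.mp ha).2
      simp only [mem_union, not_or] at ha'
      exact ha'.2 (mem_bd.mpr ⟨ha'.1, x, hxF, Or.inl hax.symm⟩)
    have hsF' : s ∉ bd G F' := fun h =>
      (mem_bd.mp (mem_inter.mp (hsub (mem_inter.mpr ⟨h, (mem_inter.mp hsS).2⟩))).1).1 hsF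
    have heq := hmin F' hF'U ⟨hF'U.trans hU.subset, ⟨y, hy⟩, ⟨s, (mem_inter.mp hsS).2, fun h =>
      (mem_sdiff.mp h).2 (mem_union_left _ hsF), hsF'⟩, by
        have := card_le_card hsub
        omega⟩
    exact hsF' (heq ▸ (mem_inter.mp hsS).1)
  · have hFU : F ⊆ U := fun x hx =>
      (mem_union.mp (hF hx)).resolve_right fun h => hFS ⟨x, hx, h⟩
    have hsub : bd G F ∩ R ⊆ bd (addClique G (bd G U ∩ R)) F ∩ (U ∪ (bd G U ∩ R)) := fun x hx =>
      mem_inter.mpr ⟨hmono (mem_bd.mp (mem_inter.mp hx).1).1 (mem_inter.mp hx).1, hD hFU hx⟩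
    have heq := hmin F hFU ⟨hF.trans hDR, hne, ⟨y, hDR hyD, hyF, fun h => hyb (hmono hyF h)⟩, by
      have := card_le_card hsub
      omega⟩
    subst heq
    exact hyb (hmono hyF (mem_inter.mp ((mem_union.mp hyD).resolve_left hyF)).1)

theorem MinDense.exists_isLeaf_of_minimal (hR : MinDense G R) (hU : IsSep G R U)
    (hmin : ∀ F ⊆ U, IsSep G R F → F = U) : ∃ φ, IsLeaf G R U φ := by
  obtain ⟨hs3, hcount, -⟩ := hR.counts hU
  obtain ⟨bag, hbag⟩ := hR.exists_rooted_triangle hU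
  have hec := ec_addClique G (S := bd G U ∩ R) (D := U ∪ (bd G U ∩ R)) subset_union_right
  rw [offDiag_card, hs3] at hec
  have hDR : U ∪ (bd G U ∩ R) ⊆ R := union_subset hU.subset inter_subset_right
  have hself : ∀ v, v ∈ if v ∈ bd G U ∩ R then bag v else {v} := fun v => by
    split_ifs with h
    · exact (hbag v h).1
    · simp
  have hUS : ∀ v ∈ U, ∀ s ∈ bd G U ∩ R, v ∉ bag s := fun v hv s hs h =>
    (mem_sdiff.mp ((hbag s hs).2.1 h)).2 hv
  obtain ⟨φ, hφ⟩ := exists_isOctahedral_of_minor hR.enemy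
    (H := addClique G (bd G U ∩ R)) (R := U ∪ (bd G U ∩ R))
    (fun h => hR.ne_univ (univ_subset_iff.mp (h ▸ hDR)))
    (fun v => if v ∈ bd G U ∩ R then bag v else {v}) (fun v _ => by
      split_ifs with h
      · exact (hbag v h).2.2.1
      · exact conn_singleton _ _) (fun v hv w hw hne => by
      split_ifs with h1 h2 h2
      · exact ((hbag v h1).2.2.2 w h2 hne).1
      · exact disjoint_singleton_right.mpr (hUS w ((mem_union.mp hw).resolve_right h2) v h1)
      · exact disjoint_singleton_left.mpr (hUS v ((mem_union.mp hv).resolve_right h1) w h2)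
      · simpa using hne) (fun v _ w _ hvw => by
      rcases hvw with h | ⟨h1, h2, hne⟩
      · exact ⟨v, hself v, w, hself w, h⟩
      · simp only [h1, h2, if_true]
        exact ((hbag v h1).2.2.2 w h2 hne).2) (hR.kConn_addClique hU hmin) (by omega)
  obtain ⟨s1, s2, s3, h12, h13, h23, hS⟩ := card_eq_three.mp hs3
  have hidx : ∀ s ∈ bd G U ∩ R, ∃ i, φ i = s := fun s hs => by
    have : s ∈ univ.image φ := hφ.image ▸ mem_union_right _ hs
    simpa using this
  have hm1 : s1 ∈ bd G U ∩ R := by simp [hS]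
  have hm2 : s2 ∈ bd G U ∩ R := by simp [hS]
  have hm3 : s3 ∈ bd G U ∩ R := by simp [hS]
  obtain ⟨a, rfl⟩ := hidx s1 hm1
  obtain ⟨b, rfl⟩ := hidx s2 hm2
  obtain ⟨c, rfl⟩ := hidx s3 hm3
  obtain ⟨f, hf0, hf2, hf4, hf⟩ := exists_octahedral_automorphism a b c
    ((hφ.adj a b).mp (Or.inr ⟨hm1, hm2, h12⟩)) ((hφ.adj a c).mp (Or.inr ⟨hm1, hm3, h13⟩))
    ((hφ.adj b c).mp (Or.inr ⟨hm2, hm3, h23⟩))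
  have hfi : Function.Injective f := fun i j => (hf i j).2
  have hfs : Function.Surjective f := Finite.surjective_of_injective hfi
  refine ⟨φ ∘ f, hU, hφ.injective.comp hfi, ?_, ?_, fun i j hij hT => ?_⟩
  · rw [← hφ.image]
    ext x
    simp only [mem_image, mem_univ, true_and, Function.comp]
    exact ⟨fun ⟨i, h⟩ => ⟨f i, h⟩, fun ⟨i, h⟩ => (hfs i).imp fun j hj => by rw [hj, h]⟩
  · simp only [Function.comp, hf0, hf2, hf4, hS]
  · have hmem : ∀ i, φ (f i) ∈ bd G U ∩ R → i = 0 ∨ i = 2 ∨ i = 4 := fun i hi => by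
      simp only [hS, mem_insert, mem_singleton, hφ.injective.eq_iff] at hi
      rw [← hf0, ← hf2, ← hf4, hfi.eq_iff, hfi.eq_iff, hfi.eq_iff] at hi
      exact hi
    rcases (hφ.adj _ _).mpr ((hf i j).1.mpr hij) with h | ⟨h1, h2, -⟩
    · exact h
    · exact absurd ⟨hmem i h1, hmem j h2⟩ hT

theorem MinDense.exists_isLeaf (hR : MinDense G R) (hU : IsSep G R U) :
    ∃ U' ⊆ U, ∃ φ, IsLeaf G R U' φ := by
  obtain ⟨U', hU', hmin⟩ := exists_min_image (univ.filter fun F => F ⊆ U ∧ IsSep G R F) card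
    ⟨U, by simp [hU]⟩
  simp only [mem_filter, mem_univ, true_and] at hU' hmin
  exact ⟨U', hU'.1, hR.exists_isLeaf_of_minimal hU'.2 fun F hF hs =>
    eq_of_subset_of_card_le hF (hmin F ⟨hF.trans hU'.1, hs⟩)⟩

end MinDense

/-- The adjacency of the octahedral graph without the triangle `0, 2, 4`. -/
abbrev RootAdj (i j : Fin 8) : Prop :=
  OctAdj i j ∧ ¬ ((i = 0 ∨ i = 2 ∨ i = 4) ∧ (j = 0 ∨ j = 2 ∨ j = 4))

set_option synthInstance.maxSize 2000 in
set_option synthInstance.maxHeartbeats 400000 in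
theorem rootAdj_spare_of_lt : ∀ a b c d : Fin 8, a < b → c < d → a ≠ c → a ≠ d → b ≠ c → b ≠ d →
    ∃ x y : Fin 8, (∀ u ∈ [a, b, c, d], u ≠ x ∧ u ≠ y ∧ (RootAdj u x ∨ RootAdj u y)) ∧
      (x = y ∨ RootAdj x y) ∧ (RootAdj a b ∨ ∃ k, RootAdj a k ∧ RootAdj b k ∧
        ∀ u ∈ [a, b, c, d, x, y], u ≠ k) := by
  decide +kernel

theorem rootAdj_spare (a b c d : Fin 8) (hab : a ≠ b) (hac : a ≠ c) (had : a ≠ d) (hbc : b ≠ c)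
    (hbd : b ≠ d) (hcd : c ≠ d) :
    ∃ x y : Fin 8, (∀ u, u = a ∨ u = b ∨ u = c ∨ u = d → u ≠ x ∧ u ≠ y ∧
        (RootAdj u x ∨ RootAdj u y)) ∧
      (x = y ∨ RootAdj x y) ∧ ((RootAdj a b ∨ RootAdj b a) ∨ ∃ k, RootAdj a k ∧ RootAdj b k ∧
        ∀ u, u = a ∨ u = b ∨ u = c ∨ u = d ∨ u = x ∨ u = y → u ≠ k) := by
  wlog h1 : a < b generalizing a b
  · obtain ⟨x, y, h, h', h''⟩ := this b a hab.symm hbc hbd hac had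
      (lt_of_le_of_ne (not_lt.mp h1) hab.symm)
    refine ⟨x, y, fun u hu => h u (or_left_comm.mp hu), h', h''.imp Or.symm ?_⟩
    exact fun ⟨k, h1, h2, h3⟩ => ⟨k, h2, h1, fun u hu => h3 u (or_left_comm.mp hu)⟩
  wlog h2 : c < d generalizing c d
  · obtain ⟨x, y, h, h', h''⟩ := this d c hcd.symm had hac hbd hbc
      (lt_of_le_of_ne (not_lt.mp h2) hcd.symm)
    refine ⟨x, y, fun u hu => h u (hu.imp_right (Or.imp_right Or.symm)), h', h''.imp id ?_⟩
    exact fun ⟨k, h1, h2, h3⟩ => ⟨k, h1, h2, fun u hu => h3 u (hu.imp_right (Or.imp_right or_left_comm.mp))⟩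
  obtain ⟨x, y, h, h', h''⟩ := rootAdj_spare_of_lt a b c d h1 h2 hac had hbc hbd
  refine ⟨x, y, fun u hu => h u (by simpa using hu), h', h''.imp Or.inl ?_⟩
  exact fun ⟨k, h1, h2, h3⟩ => ⟨k, h1, h2, fun u hu => h3 u (by simpa using hu)⟩

theorem exists_other_two : ∀ i j : Fin 4, i ≠ j → ∃ k l : Fin 4, i ≠ k ∧ i ≠ l ∧ j ≠ k ∧ j ≠ l ∧
    k ≠ l ∧ ∀ m, m = i ∨ m = j ∨ m = k ∨ m = l := by
  decide

theorem exists_third_root : ∀ s t : Fin 8, (s = 0 ∨ s = 2 ∨ s = 4) → (t = 0 ∨ t = 2 ∨ t = 4) →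
    s ≠ t → ∃ r, OctAdj r s ∧ OctAdj r t ∧ OctAdj s t ∧
      ∀ m : Fin 8, (m = 0 ∨ m = 2 ∨ m = 4) ↔ (m = r ∨ m = s ∨ m = t) := by
  decide +kernel

theorem exists_two_roots : ∀ a b c d : Fin 8, a ≠ b → a ≠ c → a ≠ d → b ≠ c → b ≠ d → c ≠ d →
    (∀ u ∈ [a, b, c, d], u ≠ 1 ∧ u ≠ 3 ∧ u ≠ 5) → ∃ i j : Fin 4, i ≠ j ∧
      (![a, b, c, d] i = 0 ∨ ![a, b, c, d] i = 2 ∨ ![a, b, c, d] i = 4) ∧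
      (![a, b, c, d] j = 0 ∨ ![a, b, c, d] j = 2 ∨ ![a, b, c, d] j = 4) := by
  decide +kernel

theorem isMinor_of_linked_octahedra {G : SimpleGraph V} {φ φ' : Fin 8 → V}
    (hφ : Function.Injective φ) (hφ' : Function.Injective φ')
    (ha : ∀ i j, RootAdj i j → G.Adj (φ i) (φ j)) (ha' : ∀ i j, RootAdj i j → G.Adj (φ' i) (φ' j))
    {P : Fin 4 → Finset V} {v w : Fin 4 → Fin 8} (hv : Function.Injective v)
    (hw : Function.Injective w) (hP : ∀ i, Conn G (P i))
    (hPd : ∀ i j, i ≠ j → Disjoint (P i) (P j)) (hvP : ∀ i, φ (v i) ∈ P i)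
    (hwP : ∀ i, φ' (w i) ∈ P i) (hφP : ∀ m i, φ m ∈ P i → m = v i)
    (hφ'P : ∀ m i, φ' m ∈ P i → m = w i) (hφφ' : ∀ m n, φ m = φ' n → ∃ i, n = w i) {i j : Fin 4}
    (hij : i ≠ j) (hi : v i = 0 ∨ v i = 2 ∨ v i = 4) (hj : v j = 0 ∨ v j = 2 ∨ v j = 4) :
    IsMinor K7vee G := by
  obtain ⟨k, l, hik, hil, hjk, hjl, hkl, hall⟩ := exists_other_two i j hij
  obtain ⟨x, y, hxy, hxyc, hk⟩ := rootAdj_spare (w i) (w j) (w k) (w l) (hw.ne hij) (hw.ne hik)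
    (hw.ne hil) (hw.ne hjk) (hw.ne hjl) (hw.ne hkl)
  have hxy : ∀ m, w m ≠ x ∧ w m ≠ y ∧ (RootAdj (w m) x ∨ RootAdj (w m) y) := fun m => by
    refine hxy _ ?_
    rcases hall m with rfl | rfl | rfl | rfl <;> simp
  obtain ⟨Q, hQc, hPQ, hQφ', hQij⟩ : ∃ Q : Fin 4 → Finset V, (∀ m, Conn G (Q m)) ∧
      (∀ m, P m ⊆ Q m) ∧ (∀ m, ∀ u ∈ Q m, u ∉ P m → m = i ∧ ∃ z, u = φ' z ∧ z ≠ x ∧ z ≠ y ∧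
        ∀ n, z ≠ w n) ∧ Touch G (Q i) (Q j) := by
    rcases hk with h | ⟨z, hz1, hz2, hz⟩
    · exact ⟨P, hP, fun _ => subset_rfl, fun m u hu hu' => absurd hu hu',
        _, hwP i, _, hwP j, h.elim (ha' _ _) fun h => (ha' _ _ h).symm⟩
    · have hz' : ∀ n, z ≠ w n := fun n => by
        refine (hz _ ?_).symm
        rcases hall n with rfl | rfl | rfl | rfl <;> simp
      refine ⟨Function.update P i (insert (φ' z) (P i)), fun m => ?_, fun m => ?_,
        fun m u hu hu' => ?_, ?_⟩
      · by_cases h : m = i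
        · subst h
          rw [Function.update_self]
          exact (hP m).insert_vertex ⟨_, hwP m, ha' _ _ hz1⟩
        · rw [Function.update_of_ne h]
          exact hP m
      · by_cases h : m = i
        · subst h
          rw [Function.update_self]
          exact subset_insert _ _
        · rw [Function.update_of_ne h]
      · by_cases h : m = i
        · subst h
          rw [Function.update_self] at hu
          exact ⟨rfl, z, (mem_insert.mp hu).resolve_right hu', (hz x (by simp)).symm,
            (hz y (by simp)).symm, hz'⟩
        · rw [Function.update_of_ne h] at hu
          exact absurd hu hu'
      · rw [Function.update_self, Function.update_of_ne hij.symm]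
        exact ⟨φ' z, mem_insert_self _ _, _, hwP j, (ha' _ _ hz2).symm⟩
  have hQd : ∀ m n, m ≠ n → Disjoint (Q m) (Q n) := by
    intro m n hmn
    rw [Finset.disjoint_left]
    intro u hum hun
    by_cases h1 : u ∈ P m
    · by_cases h2 : u ∈ P n
      · exact Finset.disjoint_left.mp (hPd m n hmn) h1 h2
      · obtain ⟨-, z, rfl, -, -, hz⟩ := hQφ' n u hun h2
        exact hz m (hφ'P z m h1)
    · obtain ⟨hmi, z, rfl, -, -, hz⟩ := hQφ' m u hum h1
      by_cases h2 : φ' z ∈ P n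
      · exact hz n (hφ'P z n h2)
      · exact hmn (hmi.trans (hQφ' n _ hun h2).1.symm)
  have hQφ : ∀ m n, φ m ∈ Q n → m = v n := fun m n h => by
    by_cases hp : φ m ∈ P n
    · exact hφP m n hp
    · obtain ⟨-, z, hz, -, -, hz'⟩ := hQφ' n _ h hp
      obtain ⟨i, hi⟩ := hφφ' m z hz
      exact absurd hi (hz' i)
  have hQC : ∀ n, Disjoint (Q n) {φ' x, φ' y} := fun n => by
    have key : ∀ u, (∀ m, w m ≠ u) → (u = x ∨ u = y) → φ' u ∉ Q n := fun u hu hxy h => by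
      by_cases hp : φ' u ∈ P n
      · exact hu n (hφ'P u n hp).symm
      · obtain ⟨-, z, hz, hzx, hzy, -⟩ := hQφ' n _ h hp
        have := hφ' hz
        rcases hxy with h | h
        exacts [hzx (this.symm.trans h), hzy (this.symm.trans h)]
    rw [disjoint_insert_right, disjoint_singleton_right]
    exact ⟨key x (fun m => (hxy m).1) (Or.inl rfl), key y (fun m => (hxy m).2.1) (Or.inr rfl)⟩
  have hφC : ∀ m, Disjoint {φ m} ({φ' x, φ' y} : Finset V) := fun m => by
    rw [disjoint_singleton_left]
    simp only [mem_insert, mem_singleton, not_or]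
    refine ⟨fun h => ?_, fun h => ?_⟩
    · obtain ⟨n, hn⟩ := hφφ' _ _ h
      exact (hxy n).1 hn.symm
    · obtain ⟨n, hn⟩ := hφφ' _ _ h
      exact (hxy n).2.1 hn.symm
  obtain ⟨B, hBv, hBm⟩ : ∃ B : Fin 8 → Finset V, (∀ n, B (v n) = Q n) ∧
      ∀ m, (∀ n, v n ≠ m) → B m = {φ m} := by
    refine ⟨fun m => if h : ∃ n, v n = m then Q h.choose else {φ m}, fun n => ?_, fun m hm => ?_⟩
    · have h : ∃ n', v n' = v n := ⟨n, rfl⟩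
      exact (dif_pos h).trans (by rw [hv h.choose_spec])
    · exact dif_neg (by simpa using hm)
  have hBφ : ∀ m, φ m ∈ B m := fun m => by
    by_cases h : ∃ n, v n = m
    · obtain ⟨n, rfl⟩ := h
      rw [hBv]
      exact hPQ n (hvP n)
    · rw [hBm m (by simpa using h)]
      simp
  have hCc : Conn G {φ' x, φ' y} := by
    rcases hxyc with rfl | h
    · simpa using conn_singleton G (φ' x)
    · exact conn_pair (ha' _ _ h)
  obtain ⟨r, hr1, hr2, hr3, hr⟩ := exists_third_root (v i) (v j) hi hj (hv.ne hij)
  refine isMinor_of_octahedral_of_four_relabel (B := B) (C := {φ' x, φ' y}) (fun m => ?_) hCc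
    (fun m n hmn => ?_) (fun m => ?_) hr1 hr2 hr3 (fun m n hmn h1 h2 => ?_) hv fun n => ?_
  · by_cases h : ∃ n, v n = m
    · obtain ⟨n, rfl⟩ := h
      rw [hBv]
      exact hQc n
    · rw [hBm m (by simpa using h)]
      exact conn_singleton _ _
  · by_cases h : ∃ m', v m' = m <;> by_cases h' : ∃ n', v n' = n
    · obtain ⟨m, rfl⟩ := h
      obtain ⟨n, rfl⟩ := h'
      rw [hBv, hBv]
      exact hQd m n fun h => hmn (h ▸ rfl)
    · obtain ⟨m, rfl⟩ := h
      rw [hBv, hBm n (by simpa using h'), disjoint_singleton_right]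
      exact fun h => hmn (hQφ _ _ h).symm
    · obtain ⟨n, rfl⟩ := h'
      rw [hBv, hBm m (by simpa using h), disjoint_singleton_left]
      exact fun h => hmn (hQφ _ _ h)
    · rw [hBm m (by simpa using h), hBm n (by simpa using h'), disjoint_singleton]
      exact hφ.ne hmn
  · by_cases h : ∃ n, v n = m
    · obtain ⟨n, rfl⟩ := h
      rw [hBv]
      exact hQC n
    · rw [hBm m (by simpa using h)]
      exact hφC m
  · by_cases hT : (m = 0 ∨ m = 2 ∨ m = 4) ∧ (n = 0 ∨ n = 2 ∨ n = 4)
    · rw [hr, hr] at hT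
      have hne : m ≠ n := fun h => hmn (h ▸ rfl)
      rcases hT with ⟨rfl | rfl | rfl, h' | h' | h'⟩
      · exact absurd h'.symm hne
      · exact absurd h' (h1 rfl).1
      · exact absurd h' (h1 rfl).2
      · exact absurd rfl (h2 h').1
      · exact absurd h'.symm hne
      · rw [h', hBv, hBv]
        exact hQij
      · exact absurd rfl (h2 h').2
      · rw [h', hBv, hBv]
        exact hQij.symm
      · exact absurd h'.symm hne
    · exact ⟨_, hBφ m, _, hBφ n, ha _ _ ⟨hmn, hT⟩⟩
  · rw [hBv]
    rcases (hxy n).2.2 with h | h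
    · exact ⟨_, hPQ n (hwP n), φ' x, by simp, ha' _ _ h⟩
    · exact ⟨_, hPQ n (hwP n), φ' y, by simp, ha' _ _ h⟩

/-- A connected subset of `M` which meets a union of components of `M` lies inside it. -/
theorem Conn.subset_of_closed {G : SimpleGraph V} {s K M : Finset V} (hs : Conn G s) (hM : s ⊆ M)
    (hcl : ∀ a ∈ K, ∀ b ∈ M, G.Adj a b → b ∈ K) {v : V} (hvs : v ∈ s) (hvK : v ∈ K) : s ⊆ K := by
  by_contra h
  obtain ⟨y, hy, hyK⟩ := not_subset.mp h
  obtain ⟨a, -, haK, b, hb, hbK, hab⟩ := hs.exists_adj hvs hvK hy hyK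
  exact hbK (hcl a haK b (hM hb) hab)

theorem MinDense.not_isSep {G : SimpleGraph V} {R U₀ : Finset V} (hR : MinDense G R) :
    ¬ IsSep G R U₀ := by
  intro hU₀
  have hG := hR.enemy
  obtain ⟨U, hUU₀, φ, hφ⟩ := hR.exists_isLeaf hU₀
  obtain ⟨U', hU'U₀, φ', hφ'⟩ := hR.exists_isLeaf (hR.isSep_compl hU₀).1
  have haφ : ∀ i j, RootAdj i j → G.Adj (φ i) (φ j) := fun i j h => hφ.adj i j h.1 h.2
  have haφ' : ∀ i j, RootAdj i j → G.Adj (φ' i) (φ' j) := fun i j h => hφ'.adj i j h.1 h.2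
  have hUU' : ∀ u ∈ U', u ∉ U ∧ ∀ a ∈ U, ¬ G.Adj a u := fun u hu => by
    have := (mem_sdiff.mp (hU'U₀ hu)).2
    simp only [mem_union, not_or] at this
    exact ⟨fun h => this.1 (hUU₀ h), fun a ha hau => this.2 (mem_bd.mpr ⟨this.1, a, hUU₀ ha, hau⟩)⟩
  set S := bd G U ∩ R with hS
  set S' := bd G U' ∩ R with hS'
  have hSbd : ∀ s ∈ S, s ∉ U ∧ s ∈ R ∧ ∃ a ∈ U, G.Adj a s := fun s hs => by
    obtain ⟨h1, h2⟩ := mem_inter.mp hs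
    exact ⟨(mem_bd.mp h1).1, h2, (mem_bd.mp h1).2⟩
  have hS'bd : ∀ s ∈ S', s ∉ U' ∧ s ∈ R ∧ ∃ a ∈ U', G.Adj a s := fun s hs => by
    obtain ⟨h1, h2⟩ := mem_inter.mp hs
    exact ⟨(mem_bd.mp h1).1, h2, (mem_bd.mp h1).2⟩
  set D := U ∪ S with hD
  have hU'D : ∀ u ∈ U', u ∉ D := fun u hu h => by
    rcases mem_union.mp h with h | h
    · exact (hUU' u hu).1 h
    · obtain ⟨-, -, a, ha, hau⟩ := hSbd u h
      exact (hUU' u hu).2 a ha hau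
  have hS'U : ∀ s ∈ S', s ∉ U := fun s hs h => by
    obtain ⟨-, -, a, ha, hau⟩ := hS'bd s hs
    exact (hUU' a ha).2 s h hau.symm
  have himg : univ.image φ = D := hφ.image
  have himg' : univ.image φ' = U' ∪ S' := hφ'.image
  have hSeq : S = {φ 0, φ 2, φ 4} := hφ.separator
  have hS'eq : S' = {φ' 0, φ' 2, φ' 4} := hφ'.separator
  have hφD : ∀ m, φ m ∈ D := fun m => by rw [← himg]; simp
  have hmemφ : ∀ u ∈ D, ∃ m, φ m = u := fun u hu => by
    rw [← himg] at hu; simpa using hu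
  have hmemφ' : ∀ u ∈ U' ∪ S', ∃ m, φ' m = u := fun u hu => by
    rw [← himg'] at hu; simpa using hu
  have hφ'D : ∀ m, φ' m ∈ U' ∪ S' := fun m => by rw [← himg']; simp
  have hSφ : ∀ m, φ m ∈ S ↔ m = 0 ∨ m = 2 ∨ m = 4 := fun m => by
    rw [hSeq]
    simp only [mem_insert, mem_singleton, hφ.injective.eq_iff]
  have hS'φ : ∀ m, φ' m ∈ S' ↔ m = 0 ∨ m = 2 ∨ m = 4 := fun m => by
    rw [hS'eq]
    simp only [mem_insert, mem_singleton, hφ'.injective.eq_iff]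
  have hUφ : ∀ m, ¬ (m = 0 ∨ m = 2 ∨ m = 4) → φ m ∈ U := fun m hm =>
    (mem_union.mp (hφD m)).resolve_right fun h => hm ((hSφ m).mp h)
  have hU'φ : ∀ m, ¬ (m = 0 ∨ m = 2 ∨ m = 4) → φ' m ∈ U' := fun m hm =>
    (mem_union.mp (hφ'D m)).resolve_right fun h => hm ((hS'φ m).mp h)
  have h1U : φ 1 ∈ U := hUφ 1 (by decide)
  have h1U' : φ' 1 ∈ U' := hU'φ 1 (by decide)
  have hcardD : #D = 8 := by
    rw [← himg, card_image_of_injective _ hφ.injective]; simp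
  obtain ⟨K, hKD, h1K, hKc, hKcl⟩ := exists_component G (M := univ \ D) (v := φ' 1)
    (by simpa using hU'D _ h1U')
  have hKD' : ∀ u ∈ K, u ∉ D := fun u hu => (mem_sdiff.mp (hKD hu)).2
  have hcl : ∀ a ∈ K, ∀ b, b ∉ D → G.Adj a b → b ∈ K := fun a ha b hb hab =>
    hKcl a ha b (by simpa using hb) hab
  have hU'K : U' ⊆ K := fun u hu => by
    obtain ⟨m, rfl⟩ := hmemφ' u (mem_union_left _ hu)
    have key : ∀ m : Fin 8, (m = 0 ∨ m = 2 ∨ m = 4) ∨ m = 1 ∨ RootAdj 1 m := by decide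
    rcases key m with h | rfl | h
    · exact absurd hu (hS'bd _ ((hS'φ m).mpr h)).1
    · exact h1K
    · exact hcl _ h1K _ (hU'D _ hu) (haφ' _ _ h)
  have hD'K : ∀ u ∈ U' ∪ S', u ∈ K ∨ u ∈ S := fun u hu => by
    rcases mem_union.mp hu with h | h
    · exact Or.inl (hU'K h)
    · by_cases hu : u ∈ D
      · exact Or.inr ((mem_union.mp hu).resolve_left (hS'U u h))
      · obtain ⟨-, -, a, ha, hau⟩ := hS'bd u h
        exact Or.inl (hcl a (hU'K ha) u hu hau)
  obtain ⟨hND, hN4⟩ := four_le_bd_component hG (by omega) hKD ⟨_, h1K⟩ hKcl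
  set N := bd G K with hN
  have hNK : ∀ u ∈ N, u ∉ K := fun u hu => (mem_bd.mp hu).1
  -- the component sees the whole separator, already within `R`
  have hSN : S ⊆ N := by
    obtain ⟨K', hK'D, h1K', hK'c, hK'cl⟩ := exists_component G (M := R \ D) (v := φ' 1)
      (mem_sdiff.mpr ⟨hφ'.isSep.subset h1U', hU'D _ h1U'⟩)
    have hK'K : K' ⊆ K := hK'c.subset_of_closed (M := univ \ D)
      (fun u hu => by simpa using (mem_sdiff.mp (hK'D hu)).2) hKcl h1K' h1K
    have hsub : bd G K' ∩ R ⊆ S := fun u hu => by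
      obtain ⟨hu, huR⟩ := mem_inter.mp hu
      obtain ⟨h1, a, ha, hau⟩ := mem_bd.mp hu
      have huD : u ∈ D := by
        by_contra h
        exact h1 (hK'cl a ha u (mem_sdiff.mpr ⟨huR, h⟩) hau)
      refine (mem_union.mp huD).resolve_left fun huU => ?_
      obtain ⟨haR, haD⟩ := mem_sdiff.mp (hK'D ha)
      exact haD (mem_union_right _ (mem_inter.mpr ⟨mem_bd.mpr
        ⟨fun h => haD (mem_union_left _ h), u, huU, hau.symm⟩, haR⟩))
    have hsep : IsSep G R K' := by
      refine ⟨hK'D.trans sdiff_subset, ⟨_, h1K'⟩, ⟨φ 1, hφ.isSep.subset h1U, fun h =>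
        (mem_sdiff.mp (hK'D h)).2 (hφD 1), fun h => ?_⟩, ?_⟩
      · exact (hSbd _ (hsub (mem_inter.mpr ⟨h, hφ.isSep.subset h1U⟩))).1 h1U
      · exact (card_le_card hsub).trans (hR.counts hφ.isSep).1.le
    have heq := eq_of_subset_of_card_le hsub
      (by rw [(hR.counts hsep).1, hS, (hR.counts hφ.isSep).1])
    intro s hs
    rw [← heq] at hs
    obtain ⟨h1, a, ha, has⟩ := mem_bd.mp (mem_inter.mp hs).1
    have : s ∈ S := heq ▸ hs
    exact mem_bd.mpr ⟨fun h => hKD' s h (mem_union_right _ this), a, hK'K ha, has⟩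
  by_cases hcase : ∃ e : Fin 8, (e = 1 ∨ e = 3 ∨ e = 5) ∧ φ e ∈ N
  · obtain ⟨e, he, heN⟩ := hcase
    have ht : ∀ m, φ m ∈ N → Touch G {φ m} K := fun m hm => by
      obtain ⟨-, a, ha, h⟩ := mem_bd.mp hm
      exact ⟨φ m, by simp, a, ha, h.symm⟩
    refine hG.1.2.2.1 (isMinor_of_octahedral_of_three (B := fun m => {φ m}) (C := K)
      (fun m => conn_singleton _ _) hKc (fun i j hij => ?_) (fun i => ?_) (fun i j h1 h2 => ?_)
      (ht 0 (hSN ((hSφ 0).mpr (by simp)))) (ht 2 (hSN ((hSφ 2).mpr (by simp))))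
      (ht 4 (hSN ((hSφ 4).mpr (by simp)))) he (ht e heN))
    · exact disjoint_singleton.mpr (hφ.injective.ne hij)
    · exact disjoint_singleton_left.mpr fun h => hKD' _ h (hφD i)
    · exact ⟨_, mem_singleton_self _, _, mem_singleton_self _, hφ.adj i j h1 h2⟩
  push Not at hcase
  have hmeet : (U' ∪ S') ∩ N ⊆ S := fun u hu => by
    obtain ⟨h1, h2⟩ := mem_inter.mp hu
    exact (hD'K u h1).resolve_left (hNK u h2)
  have hcardS : #S = 3 := (hR.counts hφ.isSep).1
  have hcardD' : #(U' ∪ S') = 8 := by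
    rw [← himg', card_image_of_injective _ hφ'.injective]; simp
  obtain ⟨P, x, y, hPc, hPM, hPd, hPx, hPy, hthr⟩ := menger_through (G := G) (M := K ∪ N)
    (X := U' ∪ S') (Y := N) 4
    (fun u hu => mem_union.mpr ((hD'K u hu).imp_right fun h => hSN h))
    ((card_le_card hmeet).trans (by omega)) (fun F hF hFN => by
      have hFK : F ⊆ K := fun u hu =>
        (mem_union.mp (hF hu)).resolve_right (Finset.disjoint_left.mp hFN hu)
      rcases F.eq_empty_or_nonempty with rfl | hne
      · refine le_trans ?_ (card_le_card subset_union_right)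
        simp [hcardD']
      · have hbF : bd G F ⊆ K ∪ N := fun u hu => by
          obtain ⟨_, a, ha, hau⟩ := mem_bd.mp hu
          by_cases h : u ∈ K
          · exact mem_union_left _ h
          · exact mem_union_right _ (mem_bd.mpr ⟨h, a, hFK ha, hau⟩)
        have h1N := hcase 1 (by simp)
        have h1K : φ 1 ∉ K := fun h => hKD' _ h (hφD 1)
        have := four_le_bd hG hne (y := φ 1) (fun h => h1K (hFK h)) fun h =>
          (mem_union.mp (hbF h)).elim h1K h1N
        refine this.trans (card_le_card fun u hu => ?_)
        exact mem_union_left _ (mem_inter.mpr ⟨hu, hbF hu⟩))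
  have hx : ∀ i, x i ∈ P i ∧ x i ∈ U' ∪ S' := fun i => by
    rw [← mem_inter, hPx i]; simp
  have hy : ∀ i, y i ∈ P i ∧ y i ∈ N := fun i => by
    rw [← mem_inter, hPy i]; simp
  choose w hw using fun i => hmemφ' (x i) (hx i).2
  choose v hv using fun i => hmemφ (y i) (hND (hy i).2)
  have hwP : ∀ i, φ' (w i) ∈ P i := fun i => by rw [hw]; exact (hx i).1
  have hvP : ∀ i, φ (v i) ∈ P i := fun i => by rw [hv]; exact (hy i).1
  have hwi : Function.Injective w := fun i j h => by
    by_contra hij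
    exact Finset.disjoint_left.mp (hPd i j hij) (hwP i) (h ▸ hwP j)
  have hvi : Function.Injective v := fun i j h => by
    by_contra hij
    exact Finset.disjoint_left.mp (hPd i j hij) (hvP i) (h ▸ hvP j)
  have hφ'P : ∀ m i, φ' m ∈ P i → m = w i := fun m i h => by
    have : φ' m ∈ P i ∩ (U' ∪ S') := mem_inter.mpr ⟨h, hφ'D m⟩
    rw [hPx i, mem_singleton, ← hw] at this
    exact hφ'.injective this
  have hφP : ∀ m i, φ m ∈ P i → m = v i := fun m i h => by
    have hmN : φ m ∈ N := (mem_union.mp (hPM i h)).resolve_left fun h => hKD' _ h (hφD m)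
    have : φ m ∈ P i ∩ N := mem_inter.mpr ⟨h, hmN⟩
    rw [hPy i, mem_singleton, ← hv] at this
    exact hφ.injective this
  have hφφ' : ∀ m n, φ m = φ' n → ∃ i, n = w i := fun m n h => by
    have h1 : φ' n ∈ S := (hD'K _ (hφ'D n)).resolve_left fun h' => hKD' _ h' (h ▸ hφD m)
    obtain ⟨i, hi⟩ := hthr (φ' n) (mem_inter.mpr ⟨hφ'D n, hSN h1⟩)
    exact ⟨i, hφ'P n i hi⟩
  have hvN : ∀ i, v i ≠ 1 ∧ v i ≠ 3 ∧ v i ≠ 5 := fun i => by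
    have h : φ (v i) ∈ N := by rw [hv]; exact (hy i).2
    refine ⟨fun h' => ?_, fun h' => ?_, fun h' => ?_⟩ <;> exact hcase _ (by simp [h']) h
  obtain ⟨i, j, hij, hi, hj⟩ := exists_two_roots (v 0) (v 1) (v 2) (v 3) (hvi.ne (by decide))
    (hvi.ne (by decide)) (hvi.ne (by decide)) (hvi.ne (by decide)) (hvi.ne (by decide))
    (hvi.ne (by decide)) (by simp [hvN])
  have hvec : ![v 0, v 1, v 2, v 3] = v := by
    funext n; fin_cases n <;> rfl
  rw [hvec] at hi hj
  exact hG.1.2.2.1 (isMinor_of_linked_octahedra hφ.injective hφ'.injective haφ haφ' hvi hwi hPc hPd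
    hvP hwP hφP hφ'P hφφ' hij hi hj)

/-- A proper subset of at least three vertices of a minor-minimal enemy is sparse. -/
theorem ec_add_le {G : SimpleGraph V} (hG : MinorMinimalEnemy G) {R : Finset V} (hR : R ≠ univ)
    (h3 : 3 ≤ #R) : ec G R + 18 ≤ 8 * #R := by
  induction hn : #R using Nat.strong_induction_on generalizing R with
  | _ n ih =>
  subst hn
  by_contra hlt
  obtain ⟨m, hm⟩ := ec_even G R
  have hle := ec_le G R
  have h7 : 7 ≤ #R := by
    by_contra h
    have : #R = 3 ∨ #R = 4 ∨ #R = 5 ∨ #R = 6 := by omega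
    rcases this with h | h | h | h <;> rw [h] at hle hlt <;> omega
  have hcardR : #R < Fintype.card V := by
    rw [← card_univ]
    exact card_lt_card ⟨subset_univ _, fun h => hR (univ_subset_iff.mp h)⟩
  have hmin : MinDense G R := ⟨hG, hR, by omega, h7, fun Q hQ hQ3 => ih #Q hQ (fun h => by
    rw [h, card_univ] at hQ
    omega) hQ3 rfl⟩
  have hconn : KConn G R 4 := by
    refine ⟨by omega, fun U hU hne hfar => ?_⟩
    by_contra hsm
    obtain ⟨y, hy⟩ := hfar
    simp only [mem_sdiff, mem_union, not_or] at hy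
    exact hmin.not_isSep ⟨hU, hne, ⟨y, hy.1, hy.2.1, hy.2.2⟩, by omega⟩
  obtain ⟨φ, hφ⟩ := exists_isOctahedral_of_minor hG hR (fun v => {v})
    (fun v _ => conn_singleton G v) (fun v _ w _ h => disjoint_singleton.mpr h)
    (fun v _ w _ h => ⟨v, by simp, w, by simp, h⟩) hconn hmin.dense
  exact not_octahedral hG hφ.injective (hφ.image ▸ hR) (r := 0) (s := 2) (by decide)
    fun i j h _ _ => (hφ.adj i j).mpr h

/-- The graph `G` with the neighbours of `v` made adjacent to `u`. -/
def mergeNbrs (G : SimpleGraph V) (u v : V) : SimpleGraph V where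
  Adj a b := G.Adj a b ∨ (a ≠ b ∧ ((a = u ∧ G.Adj v b) ∨ (b = u ∧ G.Adj v a)))
  symm := ⟨fun _ _ h => h.imp (fun h => h.symm) fun h => ⟨h.1.symm, h.2.symm⟩⟩
  loopless := ⟨fun _ h => h.elim (fun h => h.ne rfl) fun h => h.1 rfl⟩

theorem kConn_mergeNbrs {G : SimpleGraph V} (hG : MinorMinimalEnemy G) {u v : V}
    (hcut : ∀ D : Finset V, D.Nonempty → (∃ y, y ∉ D ∧ y ∉ bd G D) → #(bd G D) = 4 →
      ¬ (u ∈ bd G D ∧ v ∈ bd G D)) :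
    KConn (mergeNbrs G u v) (univ.erase v) 4 := by
  have h7 := seven_le_card hG
  refine ⟨by rw [card_erase_of_mem (mem_univ v), card_univ]; omega, fun F hF hne hfar => ?_⟩
  by_contra hlt
  obtain ⟨y, hy⟩ := hfar
  simp only [mem_sdiff, mem_union, not_or, mem_erase, mem_univ, and_true] at hy
  obtain ⟨hyv, hyF, hyb⟩ := hy
  have hvF : v ∉ F := fun h => by simpa using hF h
  by_cases huF : u ∈ F
  · have hsub : bd G (insert v F) ⊆ bd (mergeNbrs G u v) F ∩ univ.erase v := fun x hx => by
      obtain ⟨h1, a, ha, hax⟩ := mem_bd.mp hx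
      simp only [mem_insert, not_or] at h1
      refine mem_inter.mpr ⟨mem_bd.mpr ⟨h1.2, ?_⟩, by simpa using h1.1⟩
      rcases mem_insert.mp ha with rfl | ha
      · exact ⟨u, huF, Or.inr ⟨fun h => h1.2 (h ▸ huF), Or.inl ⟨rfl, hax⟩⟩⟩
      · exact ⟨a, ha, Or.inl hax⟩
    have := four_le_bd hG (U := insert v F) (y := y) (insert_nonempty _ _) (by simp [hyv, hyF])
      fun h => hyb (mem_inter.mp (hsub h)).1
    have := card_le_card hsub
    omega
  · have hsub : bd G F ⊆ insert v (bd (mergeNbrs G u v) F ∩ univ.erase v) := fun x hx => by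
      obtain ⟨h1, a, ha, hax⟩ := mem_bd.mp hx
      by_cases hxv : x = v
      · simp [hxv]
      · exact mem_insert_of_mem (mem_inter.mpr ⟨mem_bd.mpr ⟨h1, a, ha, Or.inl hax⟩, by simp [hxv]⟩)
    have hyb' : y ∉ bd G F := fun h => by
      rcases mem_insert.mp (hsub h) with h | h
      · exact hyv h
      · exact hyb (mem_inter.mp h).1
    have h4 := four_le_bd hG hne hyF hyb'
    by_cases hub : u ∈ bd (mergeNbrs G u v) F
    · have h5 := card_insert_le v (bd (mergeNbrs G u v) F ∩ univ.erase v)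
      have heq := eq_of_subset_of_card_le hsub (by omega)
      have := card_le_card hsub
      refine hcut F hne ⟨y, hyF, hyb'⟩ (by omega) ?_
      rw [heq]
      by_cases huv : u = v
      · simp [huv]
      · simp [hub, huv]
    · have hvb : v ∉ bd G F := fun h => by
        obtain ⟨-, a, ha, hav⟩ := mem_bd.mp h
        have hau : a ≠ u := fun h => huF (h ▸ ha)
        exact hub (mem_bd.mpr ⟨huF, a, ha, Or.inr ⟨hau, Or.inr ⟨rfl, hav.symm⟩⟩⟩)
      have := card_le_card fun x hx =>
        (mem_insert.mp (hsub hx)).resolve_left fun h => hvb (h ▸ hx)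
      omega

theorem card_oct_nbrs : ∀ r : Fin 8, #(univ.filter fun j : Fin 8 => OctAdj r j) = 6 := by
  decide +kernel

theorem card_oct_edges : ∀ r : Fin 8,
    #(univ.filter fun p : Fin 8 × Fin 8 => OctAdj p.1 p.2 ∧ p.1 ≠ r ∧ p.2 ≠ r) = 36 := by
  decide +kernel

theorem exists_oct_nbr : ∀ r : Fin 8, ∃ s, OctAdj r s := by
  decide +kernel

theorem four_le_card_common_of_degree_le {G : SimpleGraph V} (hG : MinorMinimalEnemy G) {u v : V}
    (huv : G.Adj u v)
    (hcut : ∀ D : Finset V, D.Nonempty → (∃ y, y ∉ D ∧ y ∉ bd G D) → #(bd G D) = 4 →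
      ¬ (u ∈ bd G D ∧ v ∈ bd G D)) (hdeg : dg G univ v ≤ dg G univ u) :
    4 ≤ #(univ.filter fun w => G.Adj u w ∧ G.Adj v w) := by
  by_contra ht
  set R : Finset V := univ.erase v with hR
  set Q : Finset V := R.erase u with hQ
  have huR : u ∈ R := by simp [hR, huv.ne]
  have hQmem : ∀ w, w ∈ Q ↔ w ≠ u ∧ w ≠ v := by simp [hQ, hR]
  have hn : #R + 1 = Fintype.card V := by
    rw [hR, card_erase_of_mem (mem_univ v), card_univ]
    have := seven_le_card hG
    omega
  have e1 : ec G univ = ec G R + 2 * dg G R v := ec_erase G (mem_univ v)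
  have e2 : ec G R = ec G Q + 2 * dg G Q u := ec_erase G huR
  have e3 : ec (mergeNbrs G u v) R = ec (mergeNbrs G u v) Q + 2 * dg (mergeNbrs G u v) Q u :=
    ec_erase _ huR
  have e4 : dg G R v = dg G Q v + 1 := by
    unfold dg
    rw [← insert_erase huR, filter_insert, if_pos huv.symm, card_insert_of_notMem (by simp)]
  have e4' : dg G univ u = dg G Q u + 1 := by
    rw [← dg_erase]
    have h : (univ : Finset V).erase u = insert v Q := by
      ext w
      simp only [mem_erase, mem_insert, hQmem, mem_univ, and_true]
      have := huv.ne
      by_cases h : w = v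
      · simp [h, huv.ne.symm]
      · simp [h]
    unfold dg
    rw [h, filter_insert, if_pos huv, card_insert_of_notMem (by simp [hQmem])]
  have e4'' : dg G univ v = dg G R v := (dg_erase G univ v).symm
  have e5 : dg (mergeNbrs G u v) Q u + #(univ.filter fun w => G.Adj u w ∧ G.Adj v w) =
      dg G Q u + dg G Q v := by
    have hU : Q.filter ((mergeNbrs G u v).Adj u) = Q.filter (G.Adj u) ∪ Q.filter (G.Adj v) := by
      ext w
      simp only [mem_filter, mem_union, hQmem, mergeNbrs]
      constructor
      · rintro ⟨h, h1 | ⟨-, h1 | h1⟩⟩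
        exacts [Or.inl ⟨h, h1⟩, Or.inr ⟨h, h1.2⟩, absurd h1.1 h.1]
      · rintro (⟨h, h1⟩ | ⟨h, h1⟩)
        exacts [⟨h, Or.inl h1⟩, ⟨h, Or.inr ⟨h.1.symm, Or.inl ⟨trivial, h1⟩⟩⟩]
    have hI : (univ.filter fun w => G.Adj u w ∧ G.Adj v w) =
        Q.filter (G.Adj u) ∩ Q.filter (G.Adj v) := by
      ext w
      simp only [mem_filter, mem_inter, hQmem, mem_univ, true_and]
      exact ⟨fun h => ⟨⟨⟨h.1.ne', h.2.ne'⟩, h.1⟩, ⟨h.1.ne', h.2.ne'⟩, h.2⟩,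
        fun h => ⟨h.1.2, h.2.2⟩⟩
    unfold dg
    rw [hU, hI, card_union_add_card_inter]
  have e6 : ec G Q ≤ ec (mergeNbrs G u v) Q :=
    card_le_card (monotone_filter_right _ fun p _ h => Or.inl h)
  have e7 := le_ec_univ hG
  have hRne : R ≠ univ := fun h => notMem_erase v univ (by rw [← hR, h]; simp)
  obtain ⟨φ, hφ⟩ := exists_isOctahedral_of_minor hG (H := mergeNbrs G u v) hRne
    (fun w => if w = u then {u, v} else {w}) (fun w _ => by
      split_ifs
      · exact conn_pair huv
      · exact conn_singleton _ _) (fun w hw w' hw' hne => by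
      have h1 : w ≠ v := by simpa [hR] using hw
      have h2 : w' ≠ v := by simpa [hR] using hw'
      split_ifs with h h' h'
      · exact absurd (h.trans h'.symm) hne
      · simp [h', h2]
      · simp [h, h1]
      · simpa using hne) (fun w _ w' _ h => by
      have hself : ∀ w, w ∈ if w = u then ({u, v} : Finset V) else {w} := fun w => by
        split_ifs with h <;> simp [h]
      rcases h with h | ⟨-, ⟨rfl, h⟩ | ⟨rfl, h⟩⟩
      · exact ⟨w, hself w, w', hself w', h⟩
      · exact ⟨v, by simp, w', hself w', h⟩
      · exact ⟨w, hself w, v, by simp, h.symm⟩) (kConn_mergeNbrs hG hcut) (by omega)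
  have hR8 : #R = 8 := by
    rw [← hφ.image, card_image_of_injective _ hφ.injective]; simp
  obtain ⟨r, hr⟩ : ∃ r, φ r = u := by
    rw [← hφ.image] at huR
    simpa using huR
  have hmem : ∀ w ∈ Q, ∃ i, φ i = w ∧ i ≠ r := fun w hw => by
    have : w ∈ univ.image φ := hφ.image ▸ mem_of_mem_erase hw
    obtain ⟨i, -, hi⟩ := mem_image.mp this
    exact ⟨i, hi, fun h => ((hQmem w).mp hw).1 (by rw [← hi, h, hr])⟩
  have h36 : ec (mergeNbrs G u v) Q ≤ 36 := by
    rw [← card_oct_edges r]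
    refine le_trans (card_le_card fun p hp => ?_)
      (card_image_le (f := fun p : Fin 8 × Fin 8 => (φ p.1, φ p.2)))
    simp only [mem_filter, mem_product] at hp
    obtain ⟨i, hi, hir⟩ := hmem _ hp.1.1
    obtain ⟨j, hj, hjr⟩ := hmem _ hp.1.2
    refine mem_image.mpr ⟨(i, j), ?_, by simp [hi, hj]⟩
    simp only [mem_filter, mem_univ, true_and]
    exact ⟨(hφ.adj i j).mp (by rw [hi, hj]; exact hp.2), hir, hjr⟩
  have hO := card_oct_nbrs r
  have hJ : dg G Q u ≤ #(univ.filter fun j : Fin 8 => G.Adj u (φ j)) := by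
    refine le_trans (card_le_card fun w hw => ?_) (card_image_le (f := φ))
    obtain ⟨hw, h⟩ := mem_filter.mp hw
    obtain ⟨i, rfl, -⟩ := hmem w hw
    exact mem_image.mpr ⟨i, by simpa using h, rfl⟩
  have hJO : (univ.filter fun j : Fin 8 => G.Adj u (φ j)) ⊆ univ.filter fun j => OctAdj r j :=
    fun j hj => by
      simp only [mem_filter, mem_univ, true_and] at hj ⊢
      exact (hφ.adj r j).mp (by rw [hr]; exact Or.inl hj)
  have hdiff := card_sdiff_add_card_eq_card hJO
  obtain ⟨s, hs, hs'⟩ : ∃ s, OctAdj r s ∧ ∀ j, OctAdj r j → j ≠ s → G.Adj u (φ j) := by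
    have h1 : #((univ.filter fun j => OctAdj r j) \ univ.filter fun j : Fin 8 => G.Adj u (φ j)) ≤ 1 := by
      omega
    by_cases hex : ∃ s, OctAdj r s ∧ ¬ G.Adj u (φ s)
    · obtain ⟨s, hs, hs'⟩ := hex
      refine ⟨s, hs, fun j hj hjs => ?_⟩
      by_contra hno
      exact hjs (card_le_one.mp h1 j (by simp [hj, hno]) s (by simp [hs, hs']))
    · push Not at hex
      exact (exists_oct_nbr r).imp fun s hs => ⟨hs, fun j hj _ => hex j hj⟩
  refine not_octahedral hG hφ.injective (hφ.image ▸ hRne) hs fun i j hij h1 h2 => ?_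
  by_cases hi : i = r
  · rw [hi, hr]
    exact hs' j (hi ▸ hij) (h1 hi)
  by_cases hj : j = r
  · rw [hj, hr]
    exact (hs' i (hj ▸ Ne.symm hij) (h2 hj)).symm
  rcases (hφ.adj i j).mpr hij with h | ⟨-, ⟨h, -⟩ | ⟨h, -⟩⟩
  · exact h
  · exact absurd (hφ.injective (h.trans hr.symm)) hi
  · exact absurd (hφ.injective (h.trans hr.symm)) hj

/-- The ends of an edge of a minor-minimal enemy have at least four common neighbours, unless they
lie in a common cutset of size four. -/
theorem four_le_card_common {G : SimpleGraph V} (hG : MinorMinimalEnemy G) {u v : V}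
    (huv : G.Adj u v)
    (hcut : ∀ D : Finset V, D.Nonempty → (∃ y, y ∉ D ∧ y ∉ bd G D) → #(bd G D) = 4 →
      ¬ (u ∈ bd G D ∧ v ∈ bd G D)) :
    4 ≤ #(univ.filter fun w => G.Adj u w ∧ G.Adj v w) := by
  rcases le_total (dg G univ v) (dg G univ u) with h | h
  · exact four_le_card_common_of_degree_le hG huv hcut h
  · simp only [and_comm (a := G.Adj u _)]
    exact four_le_card_common_of_degree_le hG huv.symm
      (fun D h1 h2 h3 h4 => hcut D h1 h2 h3 h4.symm) h

theorem isMinor_K7vee_of_four {G : SimpleGraph V} {K A B : Finset V} (P : Fin 4 → Finset V)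
    (hK : Conn G K) (hA : Conn G A) (hB : Conn G B) (hP : ∀ i, Conn G (P i))
    (hKA : Disjoint K A) (hKB : Disjoint K B) (hAB : Disjoint A B)
    (hKP : ∀ i, Disjoint K (P i)) (hAP : ∀ i, Disjoint A (P i)) (hBP : ∀ i, Disjoint B (P i))
    (hPP : ∀ i j, i ≠ j → Disjoint (P i) (P j))
    (tAB : Touch G A B) (tK : ∀ i, Touch G K (P i)) (tA : ∀ i, Touch G A (P i))
    (tB : ∀ i, Touch G B (P i)) (tP : ∀ i j, i ≠ j → Touch G (P i) (P j)) :
    IsMinor K7vee G := by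
  refine isMinor_K7vee_of_bags ![K, A, B, P 0, P 1, P 2, P 3] ?_ ?_ ?_
  · intro i
    fin_cases i
    exacts [hK, hA, hB, hP 0, hP 1, hP 2, hP 3]
  · intro i j hij
    fin_cases i <;> fin_cases j <;> first
      | exact absurd hij (by decide)
      | exact hKA
      | exact hKB
      | exact hAB
      | exact hKP _
      | exact hAP _
      | exact hBP _
      | exact hPP _ _ (by decide)
  · intro i j hij h
    fin_cases i <;> fin_cases j <;> first
      | exact absurd hij (by decide)
      | exact absurd (h rfl) (by decide)
      | exact tAB
      | exact tK _
      | exact tA _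
      | exact tB _
      | exact tP _ _ (by decide)

/-- A fragment is a nonempty vertex set whose boundary is a cutset of size four. -/
structure IsFrag (G : SimpleGraph V) (F : Finset V) : Prop where
  nonempty : F.Nonempty
  rest : ∃ y, y ∉ F ∧ y ∉ bd G F
  card : #(bd G F) = 4

/-- The vertices neither in `F` nor in its boundary. -/
noncomputable def co (G : SimpleGraph V) (F : Finset V) : Finset V := univ \ (F ∪ bd G F)

theorem mem_co {G : SimpleGraph V} {F : Finset V} {v : V} :
    v ∈ co G F ↔ v ∉ F ∧ v ∉ bd G F := by
  simp [co]

theorem not_adj_co {G : SimpleGraph V} {F : Finset V} {u v : V} (hu : u ∈ F) (hv : v ∈ co G F) :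
    ¬ G.Adj u v := fun h =>
  (mem_co.mp hv).2 ((mem_bd).mpr ⟨(mem_co.mp hv).1, u, hu, h⟩)

theorem bd_co_subset (G : SimpleGraph V) (F : Finset V) : bd G (co G F) ⊆ bd G F := by
  intro v hv
  obtain ⟨hv, u, hu, h⟩ := mem_bd.mp hv
  by_contra hno
  exact not_adj_co (by_contra fun hvF => hv (mem_co.mpr ⟨hvF, hno⟩)) hu h.symm

theorem IsFrag.bd_co {G : SimpleGraph V} (hG : MinorMinimalEnemy G) {F : Finset V}
    (hF : IsFrag G F) : bd G (co G F) = bd G F := by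
  obtain ⟨y, hy, hy'⟩ := hF.rest
  obtain ⟨x, hx⟩ := hF.nonempty
  have hxco : x ∉ co G F := fun h => (mem_co.mp h).1 hx
  have hxbd : x ∉ bd G (co G F) := fun h => (mem_bd.mp (bd_co_subset G F h)).1 hx
  have := four_le_bd hG ⟨y, mem_co.mpr ⟨hy, hy'⟩⟩ hxco hxbd
  exact eq_of_subset_of_card_le (bd_co_subset G F) (hF.card.trans_le this)

theorem IsFrag.compl {G : SimpleGraph V} (hG : MinorMinimalEnemy G) {F : Finset V}
    (hF : IsFrag G F) : IsFrag G (co G F) := by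
  obtain ⟨y, hy, hy'⟩ := hF.rest
  obtain ⟨x, hx⟩ := hF.nonempty
  refine ⟨⟨y, mem_co.mpr ⟨hy, hy'⟩⟩, ⟨x, fun h => (mem_co.mp h).1 hx, fun h => ?_⟩, ?_⟩
  · exact (mem_bd.mp (bd_co_subset G F h)).1 hx
  · rw [hF.bd_co hG, hF.card]

theorem card_split (G : SimpleGraph V) (D S : Finset V) :
    #S = #(S ∩ D) + #(S ∩ bd G D) + #(S ∩ co G D) := by
  have h : S = (S ∩ D ∪ S ∩ bd G D) ∪ S ∩ co G D := by
    ext v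
    simp only [mem_union, mem_inter, mem_co]
    tauto
  conv_lhs => rw [h]
  rw [card_union_of_disjoint, card_union_of_disjoint]
  · rw [Finset.disjoint_left]
    exact fun v h1 h2 => (mem_bd.mp (mem_inter.mp h2).2).1 (mem_inter.mp h1).2
  · rw [Finset.disjoint_left]
    intro v h1 h2
    have := mem_co.mp (mem_inter.mp h2).2
    simp only [mem_union, mem_inter] at h1
    tauto

theorem bd_inter_card_le (G : SimpleGraph V) (A B : Finset V) :
    #(bd G (A ∩ B)) ≤ #(bd G A ∩ B) + #(bd G A ∩ bd G B) + #(A ∩ bd G B) := by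
  refine le_trans (card_le_card (t := bd G A ∩ B ∪ bd G A ∩ bd G B ∪ A ∩ bd G B) ?_)
    ((card_union_le _ _).trans (Nat.add_le_add_right (card_union_le _ _) _))
  intro v hv
  obtain ⟨hv, u, hu, h⟩ := mem_bd.mp hv
  simp only [mem_inter] at hv hu
  simp only [mem_union, mem_inter, mem_bd]
  by_cases hA : v ∈ A <;> by_cases hB : v ∈ B
  · exact absurd ⟨hA, hB⟩ hv
  · exact Or.inr ⟨hA, hB, u, hu.2, h⟩
  · exact Or.inl (Or.inl ⟨⟨hA, u, hu.1, h⟩, hB⟩)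
  · exact Or.inl (Or.inr ⟨⟨hA, u, hu.1, h⟩, hB, u, hu.2, h⟩)

/-- If all fragments have at least three vertices, then no four-element cutset meets an
inclusion-minimal fragment. -/
theorem disjoint_of_minimal {G : SimpleGraph V} (hG : MinorMinimalEnemy G)
    (h3 : ∀ F, IsFrag G F → 3 ≤ #F) {F D : Finset V} (hF : IsFrag G F)
    (hmin : ∀ F', F' ⊂ F → ¬ IsFrag G F') (hD : IsFrag G D) : Disjoint (bd G D) F := by
  rw [Finset.disjoint_left]
  intro x hxT hxF
  have hFT : 0 < #(F ∩ bd G D) := card_pos.mpr ⟨x, mem_inter.mpr ⟨hxF, hxT⟩⟩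
  have five : ∀ D', IsFrag G D' → bd G D' = bd G D → 0 < #(F ∩ D') →
      5 ≤ #(bd G F ∩ D') + #(bd G F ∩ bd G D) + #(F ∩ bd G D) := by
    intro D' hD' hbd hpos
    rw [← hbd]
    refine le_trans ?_ (bd_inter_card_le G F D')
    obtain ⟨y, hy, hy'⟩ := hF.rest
    have hyn : y ∉ bd G (F ∩ D') := fun h => by
      obtain ⟨-, u, hu, h⟩ := mem_bd.mp h
      exact hy' (mem_bd.mpr ⟨hy, u, (mem_inter.mp hu).1, h⟩)
    have hyF : y ∉ F ∩ D' := fun h => hy (mem_inter.mp h).1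
    have h4 := four_le_bd hG (card_pos.mp hpos) hyF hyn
    have hss : F ∩ D' ⊂ F := by
      refine (ssubset_iff_of_subset inter_subset_left).mpr ⟨x, hxF, fun h => ?_⟩
      exact (mem_bd.mp (hbd ▸ hxT)).1 (mem_inter.mp h).2
    have : #(bd G (F ∩ D')) ≠ 4 := fun h => hmin _ hss ⟨card_pos.mp hpos, ⟨y, hyF, hyn⟩, h⟩
    omega
  have four : ∀ D', bd G D' = bd G D → 0 < #(co G F ∩ D') →
      4 ≤ #(bd G F ∩ D') + #(bd G F ∩ bd G D) + #(co G F ∩ bd G D) := by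
    intro D' hbd hpos
    rw [← hbd, ← hF.bd_co hG]
    refine le_trans ?_ (bd_inter_card_le G (co G F) D')
    refine four_le_bd hG (card_pos.mp hpos) (y := x)
      (fun h => (mem_co.mp (mem_inter.mp h).1).1 hxF) fun h => ?_
    obtain ⟨-, u, hu, h⟩ := mem_bd.mp h
    exact not_adj_co hxF (mem_inter.mp hu).1 h.symm
  have hF' := hF.compl hG
  have hD' := hD.compl hG
  have hDbd := hD.bd_co hG
  have a1 := five D hD rfl
  have a2 := five _ hD' hDbd
  have a3 := four D rfl
  have a4 := four _ hDbd
  have b1 := card_split G D F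
  have b2 := card_split G D (bd G F)
  have b3 := card_split G D (co G F)
  have c1 := card_split G F D
  have c2 := card_split G F (bd G D)
  have c3 := card_split G F (co G D)
  have s1 := h3 _ hF
  have s2 := h3 _ hF'
  have s3 := h3 _ hD
  have s4 := h3 _ hD'
  have z1 := hF.card
  have z2 := hD.card
  simp only [inter_comm D, inter_comm (bd G D), inter_comm (co G D)] at c1 c2 c3
  omega

theorem IsFrag.card_ne_one {G : SimpleGraph V} (hG : MinorMinimalEnemy G) {F : Finset V}
    (hF : IsFrag G F) : #F ≠ 1 := by
  intro h
  obtain ⟨x, rfl⟩ := card_eq_one.mp h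
  have h1 := ec_erase G (mem_univ x)
  have h2 : dg G (univ.erase x) x ≤ 4 := by
    rw [← hF.card]
    refine card_le_card fun v hv => ?_
    obtain ⟨hv, ha⟩ := mem_filter.mp hv
    exact mem_bd.mpr ⟨by simpa using ne_of_mem_erase hv, x, mem_singleton_self x, ha⟩
  have h3 := seven_le_card hG
  have h4 : #((univ : Finset V).erase x) = Fintype.card V - 1 := by
    rw [card_erase_of_mem (mem_univ x), card_univ]
  have h5 := ec_add_le hG (R := univ.erase x) (fun h => notMem_erase x univ (by rw [h]; simp))
    (by omega)
  have h6 := le_ec_univ hG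
  omega

theorem IsFrag.card_ne_two {G : SimpleGraph V} (hG : MinorMinimalEnemy G) {F : Finset V}
    (hF : IsFrag G F) : #F ≠ 2 := by
  intro h
  obtain ⟨x, y, hxy, rfl⟩ := card_eq_two.mp h
  set Z := bd G {x, y} with hZ
  set R : Finset V := (univ.erase x).erase y with hR
  have hZ4 : #Z = 4 := hF.card
  have hRmem : ∀ v, v ∈ R ↔ v ≠ y ∧ v ≠ x := by simp [hR]
  have hZmem : ∀ v, v ∈ Z ↔ (v ≠ x ∧ v ≠ y) ∧ (G.Adj x v ∨ G.Adj y v) := by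
    intro v
    simp [hZ, mem_bd]
  have hxZ : x ∉ Z := fun h => ((hZmem x).mp h).1.1 rfl
  have hyZ : y ∉ Z := fun h => ((hZmem y).mp h).1.2 rfl
  have e1 : ec G univ = ec G (univ.erase x) + 2 * dg G (univ.erase x) x := ec_erase G (mem_univ x)
  have e2 : ec G (univ.erase x) = ec G R + 2 * dg G R y :=
    ec_erase G (mem_erase.mpr ⟨hxy.symm, mem_univ y⟩)
  have hsx : (univ.erase x).filter (G.Adj x) ⊆ insert y Z := fun v hv => by
    obtain ⟨hv, ha⟩ := mem_filter.mp hv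
    by_cases hvy : v = y
    · exact mem_insert.mpr (Or.inl hvy)
    · exact mem_insert.mpr (Or.inr ((hZmem v).mpr ⟨⟨ne_of_mem_erase hv, hvy⟩, Or.inl ha⟩))
  have hsy : R.filter (G.Adj y) ⊆ Z := fun v hv => by
    obtain ⟨hv, ha⟩ := mem_filter.mp hv
    exact (hZmem v).mpr ⟨((hRmem v).mp hv).symm, Or.inr ha⟩
  have c5 : #(insert y Z) = 5 := by rw [card_insert_of_notMem hyZ, hZ4]
  have d1 : dg G (univ.erase x) x ≤ 5 := c5 ▸ card_le_card hsx
  have d2 : dg G R y ≤ 4 := hZ4 ▸ card_le_card hsy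
  have h7 := seven_le_card hG
  have hn : #R + 2 = Fintype.card V := by
    rw [hR, card_erase_of_mem (mem_erase.mpr ⟨hxy.symm, mem_univ y⟩),
      card_erase_of_mem (mem_univ x), card_univ]
    omega
  have hRne : R ≠ univ := fun h => ((hRmem x).mp (h ▸ mem_univ x)).2 rfl
  have h6 := le_ec_univ hG
  have h8 := ec_add_le hG hRne (by omega)
  have hx : ∀ v ∈ insert y Z, G.Adj x v := fun v hv => by
    rw [← eq_of_subset_of_card_le hsx (by rw [c5]; change 5 ≤ dg G (univ.erase x) x; omega)] at hv
    exact (mem_filter.mp hv).2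
  have hy : ∀ v ∈ Z, G.Adj y v := fun v hv => by
    rw [← eq_of_subset_of_card_le hsy (by rw [hZ4]; change 4 ≤ dg G R y; omega)] at hv
    exact (mem_filter.mp hv).2
  have hxy' : G.Adj x y := hx y (mem_insert_self _ _)
  have hclique : ∀ z ∈ Z, ∀ w ∈ Z, z ≠ w → G.Adj z w := by
    intro z hz w hw hzw
    have key : ∀ D, IsFrag G D → ¬ (x ∈ bd G D ∧ z ∈ bd G D) := by
      rintro D hD ⟨hxT, hzT⟩
      have hout : ∀ D', IsFrag G D' → bd G D' = bd G D → y ∉ D' := by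
        intro D' hD' hbd hyD
        obtain ⟨-, v, hv, hvx⟩ := mem_bd.mp (hD'.bd_co hG ▸ hbd ▸ hxT)
        by_cases hvy : v = y
        · exact (mem_co.mp (hvy ▸ hv)).1 hyD
        · exact not_adj_co hyD hv (hy v ((hZmem v).mpr ⟨⟨hvx.ne, hvy⟩, Or.inl hvx.symm⟩))
      have hyT : y ∈ bd G D := by
        by_contra hyT
        exact hout _ (hD.compl hG) (hD.bd_co hG) (mem_co.mpr ⟨hout D hD rfl, hyT⟩)
      set S := bd G D \ {x, y} with hS
      have hS2 : #S = 2 := by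
        rw [hS, card_sdiff_of_subset (by simp [insert_subset_iff, hxT, hyT]), hD.card,
          card_pair hxy]
      have hDx : ∀ D', bd G D' = bd G D → x ∉ D' ∧ y ∉ D' := fun D' h =>
        ⟨fun h' => (mem_bd.mp (h ▸ hxT)).1 h', fun h' => (mem_bd.mp (h ▸ hyT)).1 h'⟩
      have hSx : x ∉ S ∧ y ∉ S := by simp [hS]
      have bound : ∀ D', IsFrag G D' → bd G D' = bd G D →
          ec G (D' ∪ S) + 18 ≤ 8 * #(D' ∪ S) ∧ #(D' ∪ S) = #D' + 2 := by
        intro D' hD' hbd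
        have hdisj : Disjoint D' S := by
          rw [Finset.disjoint_left]
          intro v h1 h2
          exact (mem_bd.mp (hbd ▸ (mem_sdiff.mp h2).1)).1 h1
        have hc : #(D' ∪ S) = #D' + 2 := by rw [card_union_of_disjoint hdisj, hS2]
        refine ⟨ec_add_le hG (fun h => ?_) ?_, hc⟩
        · have : x ∈ D' ∪ S := h ▸ mem_univ x
          rcases mem_union.mp this with h | h
          exacts [(hDx D' hbd).1 h, hSx.1 h]
        · have := hD'.nonempty.card_pos
          omega
      obtain ⟨b1, b1'⟩ := bound D hD rfl
      obtain ⟨b2, b2'⟩ := bound _ (hD.compl hG) (hD.bd_co hG)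
      have hle := ec_add_ec_le (G := G) (R := R) (C := D ∪ S) (D := co G D ∪ S) (S := S)
        (fun v hv => by
          have := (hRmem v).mp hv
          simp only [mem_union, mem_co, hS, mem_sdiff, mem_insert, mem_singleton]
          tauto) subset_union_right subset_union_right (by
          intro a ha b hb haC hbD
          simp only [mem_union, not_or, mem_co, not_and_or, not_not] at haC hbD
          have ha' := (hRmem a).mp ha
          have hb' := (hRmem b).mp hb
          have hST : ∀ v, v ∈ bd G D → v ≠ y ∧ v ≠ x → v ∈ S := fun v h h' => by
            simp [hS, h, h'.1, h'.2]
          have h1 : a ∈ co G D :=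
            mem_co.mpr ⟨haC.1, fun h => haC.2 (hST a h ha')⟩
          have h2 : b ∈ D := hbD.1.resolve_right fun h => hbD.2 (hST b h hb')
          exact fun h => not_adj_co h2 h1 h.symm)
      have hcount : #R + 2 = #D + 4 + #(co G D) := by
        rw [hn, ← card_univ, card_split G D univ]
        simp [hD.card]
      omega
    have h4 := four_le_card_common hG (hx z (mem_insert_of_mem hz))
      fun D h1 h2 h3 => key D ⟨h1, h2, h3⟩
    have hsub : (univ.filter fun v => G.Adj x v ∧ G.Adj z v) ⊆ (insert y Z).erase z := by
      intro v hv
      simp only [mem_filter, mem_univ, true_and] at hv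
      exact mem_erase.mpr ⟨hv.2.ne', hsx (mem_filter.mpr ⟨by simpa using hv.1.ne', hv.1⟩)⟩
    have hw' : w ∈ (insert y Z).erase z := mem_erase.mpr ⟨hzw.symm, mem_insert_of_mem hw⟩
    rw [← eq_of_subset_of_card_le hsub (by
      rw [card_erase_of_mem (mem_insert_of_mem hz), c5]; exact h4)] at hw'
    exact (mem_filter.mp hw').2.2
  obtain ⟨u, hu⟩ := (hF.compl hG).nonempty
  obtain ⟨K, hK, huK, hKc, hcl⟩ := exists_component G hu
  have hKbd : bd G K ⊆ Z := by
    intro v hv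
    obtain ⟨hvK, a, ha, hav⟩ := mem_bd.mp hv
    by_contra hvZ
    by_cases hvF : v ∈ ({x, y} : Finset V)
    · exact not_adj_co hvF (hK ha) hav.symm
    · exact hvK (hcl a ha v (mem_co.mpr ⟨hvF, hvZ⟩) hav)
  have hxK : x ∉ K := fun h => (mem_co.mp (hK h)).1 (by simp)
  have hyK : y ∉ K := fun h => (mem_co.mp (hK h)).1 (by simp)
  have hKbd' : bd G K = Z := eq_of_subset_of_card_le hKbd
    (hZ4.trans_le (four_le_bd hG ⟨u, huK⟩ hxK fun h => hxZ (hKbd h)))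
  let e : Fin 4 ≃ Z := (Finset.equivFinOfCardEq hZ4).symm
  have he : ∀ i, (e i : V) ∈ Z := fun i => (e i).2
  refine hG.1.2.2.1 (isMinor_K7vee_of_four (K := K) (A := {x}) (B := {y}) (fun i => {(e i : V)})
    hKc (conn_singleton G x) (conn_singleton G y) (fun i => conn_singleton G _)
    (by simpa using hxK) (by simpa using hyK) (by simpa using hxy) (fun i => ?_) (fun i => ?_)
    (fun i => ?_) (fun i j hij => ?_) ⟨x, by simp, y, by simp, hxy'⟩ (fun i => ?_)
    (fun i => ⟨x, by simp, e i, by simp, hx _ (mem_insert_of_mem (he i))⟩)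
    (fun i => ⟨y, by simp, e i, by simp, hy _ (he i)⟩) (fun i j hij => ?_))
  · simpa using fun h => (mem_co.mp (hK h)).2 (he i)
  · rw [disjoint_singleton]
    exact fun h => hxZ (h ▸ he i)
  · rw [disjoint_singleton]
    exact fun h => hyZ (h ▸ he i)
  · simpa using fun h => hij (e.injective (Subtype.ext h))
  · obtain ⟨-, a, ha, h⟩ := mem_bd.mp (hKbd'.ge (he i))
    exact ⟨a, ha, e i, by simp, h⟩
  · exact ⟨e i, by simp, e j, by simp, hclique _ (he i) _ (he j) fun h =>
      hij (e.injective (Subtype.ext h))⟩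

/-- Fragments of a minor-minimal enemy have at least three vertices. -/
theorem IsFrag.three_le_card {G : SimpleGraph V} (hG : MinorMinimalEnemy G) {F : Finset V}
    (hF : IsFrag G F) : 3 ≤ #F := by
  have h1 := hF.nonempty.card_pos
  have h2 := hF.card_ne_one hG
  have h3 := hF.card_ne_two hG
  omega

theorem exists_minimal_frag {G : SimpleGraph V} {F : Finset V} (hF : IsFrag G F) :
    ∃ F' ⊆ F, IsFrag G F' ∧ ∀ F'', F'' ⊂ F' → ¬ IsFrag G F'' := by
  induction F using Finset.strongInduction with
  | H F ih =>
    by_cases h : ∃ F', F' ⊂ F ∧ IsFrag G F'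
    · obtain ⟨F', h1, h2⟩ := h
      obtain ⟨F'', h3, h4⟩ := ih F' h1 h2
      exact ⟨F'', h3.trans h1.1, h4⟩
    · push Not at h
      exact ⟨F, Subset.rfl, hF, h⟩

/-- The vertices of `S` can be extended by disjoint subsets of `Q` to the bags of a complete
minor. -/
def Rooted (G : SimpleGraph V) (Q S : Finset V) : Prop :=
  ∃ A : V → Finset V, (∀ v ∈ S, A v ⊆ Q ∧ Conn G (insert v (A v))) ∧
    ∀ u ∈ S, ∀ v ∈ S, u ≠ v →
      Disjoint (A u) (A v) ∧ Touch G (insert u (A u)) (insert v (A v))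

theorem rooted_of_two {G : SimpleGraph V} {Q S : Finset V} (a c : V) (A C : Finset V)
    (hac : a ≠ c) (hA : A ⊆ Q) (hC : C ⊆ Q) (hAC : Disjoint A C) (hAc : Conn G (insert a A))
    (hCc : Conn G (insert c C))
    (h : ∀ u ∈ S, ∀ v ∈ S, u ≠ v → ¬ G.Adj u v →
      (u = a ∧ ∃ q ∈ A, G.Adj q v) ∨ (u = c ∧ ∃ q ∈ C, G.Adj q v) ∨
      (v = a ∧ ∃ q ∈ A, G.Adj q u) ∨ (v = c ∧ ∃ q ∈ C, G.Adj q u)) :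
    Rooted G Q S := by
  let B : V → Finset V := fun v => if v = a then A else if v = c then C else ∅
  have hBa : B a = A := if_pos rfl
  have hBc : B c = C := by simp [B, hac.symm]
  refine ⟨B, fun v _ => ?_, fun u hu v hv huv => ⟨?_, ?_⟩⟩
  · by_cases h1 : v = a
    · rw [h1, hBa]
      exact ⟨hA, hAc⟩
    by_cases h2 : v = c
    · rw [h2, hBc]
      exact ⟨hC, hCc⟩
    · simp [B, h1, h2, conn_singleton]
  · by_cases h1 : u = a <;> by_cases h2 : v = a <;> by_cases h3 : u = c <;>
      by_cases h4 : v = c <;> simp_all [B, disjoint_comm]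
  · by_cases hadj : G.Adj u v
    · exact ⟨u, mem_insert_self _ _, v, mem_insert_self _ _, hadj⟩
    rcases h u hu v hv huv hadj with ⟨rfl, q, hq, h⟩ | ⟨rfl, q, hq, h⟩ | ⟨rfl, q, hq, h⟩ |
      ⟨rfl, q, hq, h⟩
    · exact ⟨q, mem_insert_of_mem (hBa ▸ hq), v, mem_insert_self _ _, h⟩
    · exact ⟨q, mem_insert_of_mem (hBc ▸ hq), v, mem_insert_self _ _, h⟩
    · exact ⟨u, mem_insert_self _ _, q, mem_insert_of_mem (hBa ▸ hq), h.symm⟩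
    · exact ⟨u, mem_insert_self _ _, q, mem_insert_of_mem (hBc ▸ hq), h.symm⟩

theorem rooted_of_quad {G : SimpleGraph V} {Q S : Finset V} {a b c d : V} {A C : Finset V}
    (hS : ∀ v ∈ S, v = a ∨ v = b ∨ v = c ∨ v = d) (hac : a ≠ c) (hA : A ⊆ Q) (hC : C ⊆ Q)
    (hAC : Disjoint A C) (hAc : Conn G (insert a A)) (hCc : Conn G (insert c C))
    (ab : G.Adj a b ∨ ∃ q ∈ A, G.Adj q b) (ad : G.Adj a d ∨ ∃ q ∈ A, G.Adj q d)
    (cb : G.Adj c b ∨ ∃ q ∈ C, G.Adj q b) (cd : G.Adj c d ∨ ∃ q ∈ C, G.Adj q d)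
    (ac : G.Adj a c ∨ ∃ q ∈ A, G.Adj q c) (bd : G.Adj b d) : Rooted G Q S := by
  refine rooted_of_two a c A C hac hA hC hAC hAc hCc fun u hu v hv huv nuv => ?_
  have nvu : ¬ G.Adj v u := fun h => nuv h.symm
  rcases hS u hu with rfl | rfl | rfl | rfl <;> rcases hS v hv with rfl | rfl | rfl | rfl
  · exact absurd rfl huv
  · exact Or.inl ⟨rfl, ab.resolve_left nuv⟩
  · exact Or.inl ⟨rfl, ac.resolve_left nuv⟩
  · exact Or.inl ⟨rfl, ad.resolve_left nuv⟩
  · exact Or.inr (Or.inr (Or.inl ⟨rfl, ab.resolve_left nvu⟩))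
  · exact absurd rfl huv
  · exact Or.inr (Or.inr (Or.inr ⟨rfl, cb.resolve_left nvu⟩))
  · exact absurd bd nuv
  · exact Or.inr (Or.inr (Or.inl ⟨rfl, ac.resolve_left nvu⟩))
  · exact Or.inr (Or.inl ⟨rfl, cb.resolve_left nuv⟩)
  · exact absurd rfl huv
  · exact Or.inr (Or.inl ⟨rfl, cd.resolve_left nuv⟩)
  · exact Or.inr (Or.inr (Or.inl ⟨rfl, ad.resolve_left nvu⟩))
  · exact absurd bd nvu
  · exact Or.inr (Or.inr (Or.inr ⟨rfl, cd.resolve_left nvu⟩))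
  · exact absurd rfl huv

/-- `rooted_of_quad` with one vertex added to each of the bags of `a` and `c`. -/
theorem rooted_of_pairs {G : SimpleGraph V} {Q S : Finset V} {a b c d q r : V}
    (hS : ∀ v ∈ S, v = a ∨ v = b ∨ v = c ∨ v = d) (hac : a ≠ c) (hq : q ∈ Q) (hr : r ∈ Q)
    (hqr : q ≠ r) (haq : G.Adj a q) (hcr : G.Adj c r)
    (ab : G.Adj a b ∨ G.Adj q b) (ad : G.Adj a d ∨ G.Adj q d) (cb : G.Adj c b ∨ G.Adj r b)
    (cd : G.Adj c d ∨ G.Adj r d) (ac : G.Adj a c ∨ G.Adj q c) (bd : G.Adj b d) :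
    Rooted G Q S :=
  rooted_of_quad (A := {q}) (C := {r}) hS hac (by simpa) (by simpa) (by simpa) (conn_pair haq)
    (conn_pair hcr) (by simpa) (by simpa) (by simpa) (by simpa) (by simpa) bd

/-- `rooted_of_quad` with one vertex added to the bag of `a`. -/
theorem rooted_of_single {G : SimpleGraph V} {Q S : Finset V} {a b c d q : V}
    (hS : ∀ v ∈ S, v = a ∨ v = b ∨ v = c ∨ v = d) (hac : a ≠ c) (hq : q ∈ Q) (haq : G.Adj a q)
    (ab : G.Adj a b ∨ G.Adj q b) (ad : G.Adj a d ∨ G.Adj q d) (ac : G.Adj a c ∨ G.Adj q c)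
    (cb : G.Adj c b) (cd : G.Adj c d) (bd : G.Adj b d) : Rooted G Q S :=
  rooted_of_quad (A := {q}) (C := ∅) hS hac (by simpa) (by simp) (by simp) (conn_pair haq)
    (by simpa using conn_singleton G c) (by simpa) (by simpa) (Or.inl cb) (Or.inl cd) (by simpa) bd

theorem exists_common {Q : Finset V} {P R : V → Prop} {q₁ q₂ q₃ : V}
    (m1 : q₁ ∈ Q) (m2 : q₂ ∈ Q) (m3 : q₃ ∈ Q)
    (hP : (P q₁ ∨ P q₂) ∧ (P q₁ ∨ P q₃) ∧ (P q₂ ∨ P q₃))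
    (hR : (R q₁ ∨ R q₂) ∧ (R q₁ ∨ R q₃) ∧ (R q₂ ∨ R q₃)) : ∃ q ∈ Q, P q ∧ R q := by
  by_contra! hno
  have n1 := hno _ m1
  have n2 := hno _ m2
  have n3 := hno _ m3
  tauto

/-- The case of a vertex `b` of degree two and its neighbours `a`, `d` in the complement of the
graph induced on the four roots. -/
theorem rooted_of_path {G : SimpleGraph V} {Q S : Finset V} {a b c d q₁ q₂ q₃ : V}
    (hS : ∀ v ∈ S, v = a ∨ v = b ∨ v = c ∨ v = d) (had : a ≠ d)
    (h12 : q₁ ≠ q₂) (h13 : q₁ ≠ q₃) (h23 : q₂ ≠ q₃) (m1 : q₁ ∈ Q) (m2 : q₂ ∈ Q) (m3 : q₃ ∈ Q)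
    (aQ : ∀ q ∈ Q, G.Adj a q) (bQ : ∀ q ∈ Q, G.Adj b q)
    (tc : (G.Adj c q₁ ∨ G.Adj c q₂) ∧ (G.Adj c q₁ ∨ G.Adj c q₃) ∧ (G.Adj c q₂ ∨ G.Adj c q₃))
    (td : (G.Adj d q₁ ∨ G.Adj d q₂) ∧ (G.Adj d q₁ ∨ G.Adj d q₃) ∧ (G.Adj d q₂ ∨ G.Adj d q₃))
    (ad : G.Adj a d) (bc : G.Adj b c) (hcd : G.Adj c d ∨ ∀ q ∈ Q, G.Adj c q) : Rooted G Q S := by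
  obtain ⟨q, hq, r, hr, hqr, hcq, hdr⟩ : ∃ q ∈ Q, ∃ r ∈ Q, q ≠ r ∧ G.Adj c q ∧ G.Adj d r := by
    by_cases c1 : G.Adj c q₁
    · by_cases d2 : G.Adj d q₂
      · exact ⟨q₁, m1, q₂, m2, h12, c1, d2⟩
      · exact ⟨q₁, m1, q₃, m3, h13, c1, td.2.2.resolve_left d2⟩
    · have c2 := tc.1.resolve_left c1
      by_cases d1 : G.Adj d q₁
      · exact ⟨q₂, m2, q₁, m1, h12.symm, c2, d1⟩
      · exact ⟨q₂, m2, q₃, m3, h23, c2, td.2.1.resolve_left d1⟩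
  exact rooted_of_pairs (a := a) (b := b) (c := d) (d := c) (q := q) (r := r)
    (fun v hv => by rcases hS v hv with h | h | h | h <;> simp [h]) had hq hr hqr (aQ q hq) hdr (Or.inr (bQ q hq).symm)
    (Or.inr hcq.symm) (Or.inr (bQ r hr).symm) (hcd.imp (·.symm) fun h => (h r hr).symm)
    (Or.inl ad) bc

theorem rooted_of_card_le {G : SimpleGraph V} {Q S : Finset V} (hS : #S = 4) (hQ : #Q ≤ 3)
    (hSQ : ∀ s ∈ S, ∀ q ∈ Q, s ≠ q)
    (hmiss : ∀ v ∈ S ∪ Q, ∀ W ⊆ S ∪ Q, (∀ w ∈ W, w ≠ v ∧ ¬ G.Adj v w) → #W + 1 ≤ #Q) :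
    Rooted G Q S := by
  have miss3 : ∀ v ∈ S ∪ Q, ∀ w₁ ∈ S ∪ Q, ∀ w₂ ∈ S ∪ Q, ∀ w₃ ∈ S ∪ Q, w₁ ≠ v → w₂ ≠ v → w₃ ≠ v →
      w₁ ≠ w₂ → w₁ ≠ w₃ → w₂ ≠ w₃ → G.Adj v w₁ ∨ G.Adj v w₂ ∨ G.Adj v w₃ := by
    intro v hv w₁ h₁ w₂ h₂ w₃ h₃ n₁ n₂ n₃ n₁₂ n₁₃ n₂₃
    by_contra hno
    push Not at hno
    have := hmiss v hv {w₁, w₂, w₃} (by simp [insert_subset_iff, h₁, h₂, h₃])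
      (by simp [n₁, n₂, n₃, hno])
    rw [card_eq_three.mpr ⟨w₁, w₂, w₃, n₁₂, n₁₃, n₂₃, rfl⟩] at this
    omega
  have inS : ∀ {s}, s ∈ S → s ∈ S ∪ Q := fun h => mem_union_left _ h
  have inQ : ∀ {s}, s ∈ Q → s ∈ S ∪ Q := fun h => mem_union_right _ h
  have full : ∀ p ∈ S, ∀ r ∈ S, ∀ r' ∈ S, r ≠ p → r' ≠ p → r ≠ r' → ¬ G.Adj p r → ¬ G.Adj p r' →
      ∀ q ∈ Q, G.Adj p q := by
    intro p hp r hr r' hr' h1 h2 h3 h4 h5 q hq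
    have := miss3 p (inS hp) r (inS hr) r' (inS hr') q (inQ hq) h1 h2 (hSQ p hp q hq).symm h3
      (hSQ r hr q hq) (hSQ r' hr' q hq)
    exact (this.resolve_left h4).resolve_left h5
  have almost : ∀ p ∈ S, ∀ r ∈ S, r ≠ p → ¬ G.Adj p r → ∀ q ∈ Q, ∀ q' ∈ Q, q ≠ q' →
      G.Adj p q ∨ G.Adj p q' := by
    intro p hp r hr h1 h2 q hq q' hq' hne
    have := miss3 p (inS hp) r (inS hr) q (inQ hq) q' (inQ hq') h1 (hSQ p hp q hq).symm
      (hSQ p hp q' hq').symm (hSQ r hr q hq) (hSQ r hr q' hq') hne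
    exact this.resolve_left h2
  by_cases hdeg : ∃ a ∈ S, ∃ b ∈ S, ∃ c ∈ S, b ≠ a ∧ c ≠ a ∧ b ≠ c ∧ ¬ G.Adj a b ∧ ¬ G.Adj a c
  · obtain ⟨a, ha, b, hb, c, hc, hba, hca, hbc, nab, nac⟩ := hdeg
    have hQ3 : #Q = 3 := by
      have := hmiss a (inS ha) {b, c} (by simp [insert_subset_iff, hb, hc])
        (by simp [hba, hca, nab, nac])
      rw [card_pair hbc] at this
      omega
    obtain ⟨q₁, q₂, q₃, h12, h13, h23, hQeq⟩ := card_eq_three.mp hQ3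
    have m1 : q₁ ∈ Q := by simp [hQeq]
    have m2 : q₂ ∈ Q := by simp [hQeq]
    have m3 : q₃ ∈ Q := by simp [hQeq]
    obtain ⟨d, hd⟩ : ∃ d, S \ {a, b, c} = {d} := by
      rw [← card_eq_one, card_sdiff_of_subset (by simp [insert_subset_iff, ha, hb, hc]), hS,
        card_eq_three.mpr ⟨a, b, c, hba.symm, hca.symm, hbc, rfl⟩]
    have hdS : d ∈ S \ {a, b, c} := by simp [hd]
    simp only [mem_sdiff, mem_insert, mem_singleton, not_or] at hdS
    obtain ⟨hdS, hda, hdb, hdc⟩ := hdS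
    have hSeq : ∀ v ∈ S, v = a ∨ v = b ∨ v = c ∨ v = d := fun v hv => by
      by_contra hno
      simp only [not_or] at hno
      have : v ∈ S \ {a, b, c} := by simp [hv, hno]
      rw [hd, mem_singleton] at this
      exact hno.2.2.2 this
    have aQ := full a ha b hb c hc hba hca hbc nab nac
    have had : G.Adj a d := by
      exact ((miss3 a (inS ha) b (inS hb) c (inS hc) d (inS hdS) hba hca hda hbc (Ne.symm hdb)
        (Ne.symm hdc)).resolve_left nab).resolve_left nac
    have two : ∀ p ∈ S, ∀ r ∈ S, r ≠ p → ¬ G.Adj p r →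
        (G.Adj p q₁ ∨ G.Adj p q₂) ∧ (G.Adj p q₁ ∨ G.Adj p q₃) ∧ (G.Adj p q₂ ∨ G.Adj p q₃) :=
      fun p hp r hr h1 h2 => ⟨almost p hp r hr h1 h2 _ m1 _ m2 h12,
        almost p hp r hr h1 h2 _ m1 _ m3 h13, almost p hp r hr h1 h2 _ m2 _ m3 h23⟩
    have tb := two b hb a ha hba.symm fun h => nab h.symm
    have tc := two c hc a ha hca.symm fun h => nac h.symm
    have path : ∀ b ∈ S, ∀ c ∈ S, b ≠ a → c ≠ a → b ≠ c → d ≠ b → d ≠ c → ¬ G.Adj b a →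
        ¬ G.Adj c a → (∀ v ∈ S, v = a ∨ v = b ∨ v = c ∨ v = d) → ¬ G.Adj b d → Rooted G Q S := by
      intro b hb c hc hba hca hbc hdb hdc nba nca hSeq nbd
      have bQ := full b hb a ha d hdS (Ne.symm hba) hdb (Ne.symm hda) nba nbd
      have hbc' : G.Adj b c := by
        exact ((miss3 b (inS hb) a (inS ha) c (inS hc) d (inS hdS) (Ne.symm hba) (Ne.symm hbc) hdb
          (Ne.symm hca) (Ne.symm hda) (Ne.symm hdc)).resolve_left nba).resolve_right nbd
      have hcd : G.Adj c d ∨ ∀ q ∈ Q, G.Adj c q := by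
        by_contra! h
        obtain ⟨h1, q, hq, h2⟩ := h
        exact h2 (full c hc a ha d hdS (Ne.symm hca) hdc (Ne.symm hda) nca h1 q hq)
      exact rooted_of_path hSeq (Ne.symm hda) h12 h13 h23 m1 m2 m3 aQ bQ
        (two c hc a ha (Ne.symm hca) nca)
        (two d hdS b hb (Ne.symm hdb) fun h => nbd h.symm) had hbc' hcd
    have nba : ¬ G.Adj b a := fun h => nab h.symm
    have nca : ¬ G.Adj c a := fun h => nac h.symm
    by_cases nbd : G.Adj b d
    · by_cases ncd : G.Adj c d
      · by_cases nbc : G.Adj b c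
        · obtain ⟨q, hq, hbq, hcq⟩ : ∃ q ∈ Q, G.Adj b q ∧ G.Adj c q := by
            exact exists_common m1 m2 m3 tb tc
          exact rooted_of_single (a := a) (b := b) (c := c) (d := d) hSeq hca.symm hq (aQ q hq)
            (Or.inr hbq.symm) (Or.inl had) (Or.inr hcq.symm) nbc.symm ncd nbd
        · have bQ := full b hb a ha c hc hba.symm hbc.symm hca.symm nba nbc
          have cQ := full c hc a ha b hb hca.symm hbc hba.symm nca fun h => nbc h.symm
          exact rooted_of_pairs (a := a) (b := c) (c := b) (d := d)
            (fun v hv => by rcases hSeq v hv with h | h | h | h <;> simp [h]) hba.symm m1 m2 h12 (aQ _ m1) (bQ _ m2)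
            (Or.inr (cQ _ m1).symm) (Or.inl had) (Or.inr (cQ _ m2).symm) (Or.inl nbd)
            (Or.inr (bQ _ m1).symm) ncd
      · exact path c hc b hb hca hba hbc.symm hdc hdb nca nba (fun v hv => by
          rcases hSeq v hv with h | h | h | h <;> simp [h]) ncd
    · exact path b hb c hc hba hca hbc hdb hdc nba nca hSeq nbd
  push Not at hdeg
  by_cases hcomp : ∀ u ∈ S, ∀ v ∈ S, u ≠ v → G.Adj u v
  · obtain ⟨a, ha, c, hc, hac⟩ := one_lt_card.mp (by omega : 1 < #S)
    exact rooted_of_two a c ∅ ∅ hac (by simp) (by simp) (by simp)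
      (by simpa using conn_singleton G a) (by simpa using conn_singleton G c)
      fun u hu v hv huv nuv => absurd (hcomp u hu v hv huv) nuv
  push Not at hcomp
  obtain ⟨a, ha, b, hb, hab, nab⟩ := hcomp
  obtain ⟨c, d, hcd, hcdeq⟩ : ∃ c d, c ≠ d ∧ S \ {a, b} = {c, d} := by
    rw [← card_eq_two, card_sdiff_of_subset (by simp [insert_subset_iff, ha, hb]), hS,
      card_pair hab]
  have hcS : c ∈ S \ {a, b} := by simp [hcdeq]
  have hdS : d ∈ S \ {a, b} := by simp [hcdeq]
  simp only [mem_sdiff, mem_insert, mem_singleton, not_or] at hcS hdS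
  obtain ⟨hc, hca, hcb⟩ := hcS
  obtain ⟨hd, hda, hdb⟩ := hdS
  have hSeq : ∀ v ∈ S, v = a ∨ v = b ∨ v = c ∨ v = d := fun v hv => by
    by_contra hno
    simp only [not_or] at hno
    have : v ∈ S \ {a, b} := by simp [hv, hno]
    rw [hcdeq, mem_insert, mem_singleton] at this
    exact this.elim hno.2.2.1 hno.2.2.2
  have nba : ¬ G.Adj b a := fun h => nab h.symm
  have ac := hdeg a ha b hb c hc (Ne.symm hab) hca (Ne.symm hcb) nab
  have ad := hdeg a ha b hb d hd (Ne.symm hab) hda (Ne.symm hdb) nab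
  have bc := hdeg b hb a ha c hc hab hcb (Ne.symm hca) nba
  have bd := hdeg b hb a ha d hd hab hdb (Ne.symm hda) nba
  have hac : a ≠ c := Ne.symm hca
  have hQ2 : 2 ≤ #Q := hmiss a (inS ha) {b} (by simpa using inS hb) (by simp [Ne.symm hab, nab])
  obtain hQ2 | hQ3 : #Q = 2 ∨ #Q = 3 := by omega
  · have full2 : ∀ p ∈ S, ∀ r ∈ S, r ≠ p → ¬ G.Adj p r → ∀ q ∈ Q, G.Adj p q := by
      intro p hp r hr h1 h2 q hq
      by_contra hno
      have := hmiss p (inS hp) {r, q} (by simp [insert_subset_iff, hr, hq])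
        (by simp [h1, h2, hno, (hSQ p hp q hq).symm])
      rw [card_pair (hSQ r hr q hq)] at this
      omega
    obtain ⟨q, r, hqr, hQeq⟩ := card_eq_two.mp hQ2
    have m1 : q ∈ Q := by simp [hQeq]
    have m2 : r ∈ Q := by simp [hQeq]
    have aQ := full2 a ha b hb (Ne.symm hab) nab
    have bQ := full2 b hb a ha hab nba
    by_cases ncd : G.Adj c d
    · exact rooted_of_single hSeq hac m1 (aQ q m1) (Or.inr (bQ q m1).symm) (Or.inl ad)
        (Or.inl ac) bc.symm ncd bd
    · have cQ := full2 c hc d hd (Ne.symm hcd) ncd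
      have dQ := full2 d hd c hc hcd fun h => ncd h.symm
      exact rooted_of_pairs hSeq hac m1 m2 hqr (aQ q m1) (cQ r m2) (Or.inr (bQ q m1).symm)
        (Or.inl ad) (Or.inl bc.symm) (Or.inr (dQ r m2).symm) (Or.inl ac) bd
  · obtain ⟨q₁, q₂, q₃, h12, h13, h23, hQeq⟩ := card_eq_three.mp hQ3
    have m1 : q₁ ∈ Q := by simp [hQeq]
    have m2 : q₂ ∈ Q := by simp [hQeq]
    have m3 : q₃ ∈ Q := by simp [hQeq]
    have common : ∀ p ∈ S, ∀ r ∈ S, p ≠ r → ¬ G.Adj p r → ∃ q ∈ Q, G.Adj p q ∧ G.Adj r q := by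
      intro p hp r hr hpr npr
      have two : ∀ p ∈ S, ∀ r ∈ S, r ≠ p → ¬ G.Adj p r →
          (G.Adj p q₁ ∨ G.Adj p q₂) ∧ (G.Adj p q₁ ∨ G.Adj p q₃) ∧ (G.Adj p q₂ ∨ G.Adj p q₃) :=
        fun p hp r hr h1 h2 => ⟨almost p hp r hr h1 h2 _ m1 _ m2 h12,
          almost p hp r hr h1 h2 _ m1 _ m3 h13, almost p hp r hr h1 h2 _ m2 _ m3 h23⟩
      exact exists_common m1 m2 m3 (two p hp r hr hpr.symm npr)
        (two r hr p hp hpr fun h => npr h.symm)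
    obtain ⟨g, hg, hag, hbg⟩ := common a ha b hb hab nab
    by_cases ncd : G.Adj c d
    · exact rooted_of_single hSeq hac hg hag (Or.inr hbg.symm) (Or.inl ad) (Or.inl ac) bc.symm
        ncd bd
    obtain ⟨g', hg', hcg, hdg⟩ := common c hc d hd hcd ncd
    have distinct : ∀ q ∈ Q, ∀ r ∈ Q, q ≠ r → G.Adj a q → G.Adj b q → G.Adj c r → G.Adj d r →
        Rooted G Q S := fun q hq r hr hqr h1 h2 h3 h4 =>
      rooted_of_pairs hSeq hac hq hr hqr h1 h3 (Or.inr h2.symm) (Or.inl ad) (Or.inl bc.symm)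
        (Or.inr h4.symm) (Or.inl ac) bd
    by_cases hgg : g = g'
    swap
    · exact distinct g hg g' hg' hgg hag hbg hcg hdg
    subst hgg
    obtain ⟨r, s, hrs, hQg⟩ : ∃ r s, r ≠ s ∧ Q.erase g = {r, s} := by
      rw [← card_eq_two, card_erase_of_mem hg, hQ3]
    have hr : r ∈ Q.erase g := by simp [hQg]
    have hs : s ∈ Q.erase g := by simp [hQg]
    obtain ⟨hrg, hr⟩ := mem_erase.mp hr
    obtain ⟨hsg, hs⟩ := mem_erase.mp hs
    by_cases hr1 : G.Adj a r ∧ G.Adj b r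
    · exact distinct r hr g hg hrg hr1.1 hr1.2 hcg hdg
    by_cases hs1 : G.Adj a s ∧ G.Adj b s
    · exact distinct s hs g hg hsg hs1.1 hs1.2 hcg hdg
    by_cases hr2 : G.Adj c r ∧ G.Adj d r
    · exact distinct g hg r hr hrg.symm hag hbg hr2.1 hr2.2
    have hadj : G.Adj r s := by
      have aux : ∀ p p' : V, p ∈ S → p' ∈ S → ¬ (G.Adj p r ∧ G.Adj p' r) →
          ∃ w ∈ S, (w = p ∨ w = p') ∧ ¬ G.Adj r w := fun p p' hp hp' h => by
        by_cases h' : G.Adj p r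
        · exact ⟨p', hp', Or.inr rfl, fun h'' => h ⟨h', h''.symm⟩⟩
        · exact ⟨p, hp, Or.inl rfl, fun h'' => h' h''.symm⟩
      obtain ⟨w, hw, hwe, hwr⟩ := aux a b ha hb hr1
      obtain ⟨w', hw', hwe', hwr'⟩ := aux c d hc hd hr2
      have hww : w ≠ w' := by
        rcases hwe with rfl | rfl <;> rcases hwe' with rfl | rfl
        exacts [hac, Ne.symm hda, Ne.symm hcb, Ne.symm hdb]
      exact ((miss3 r (inQ hr) w (inS hw) w' (inS hw') s (inQ hs) (hSQ w hw r hr)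
        (hSQ w' hw' r hr) hrs.symm hww (hSQ w hw s hs) (hSQ w' hw' s hs)).resolve_left
        hwr).resolve_left hwr'
    have final : ∀ r ∈ Q, ∀ s ∈ Q, r ≠ g → s ≠ g → G.Adj r s → G.Adj a r → G.Adj b s →
        Rooted G Q S := fun r hr s hs hrg hsg hrs har hbs =>
      rooted_of_quad (A := {r, s}) (C := {g}) hSeq hac (by simp [insert_subset_iff, hr, hs])
        (by simpa) (by simp [Ne.symm hrg, Ne.symm hsg])
        ((conn_pair hrs).insert_vertex ⟨r, by simp, har.symm⟩) (conn_pair hcg)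
        (Or.inr ⟨s, by simp, hbs.symm⟩) (Or.inl ad) (Or.inl bc.symm)
        (Or.inr ⟨g, by simp, hdg.symm⟩) (Or.inl ac) bd
    by_cases har : G.Adj a r
    · refine final r hr s hs hrg hsg hadj har ?_
      exact (almost b hb a ha hab nba r hr s hs hrs).resolve_left fun h => hr1 ⟨har, h⟩
    · have has := (almost a ha b hb (Ne.symm hab) nab r hr s hs hrs).resolve_left har
      refine final s hs r hr hsg hrg hadj.symm has ?_
      exact (almost b hb a ha hab nba r hr s hs hrs).resolve_right fun h => hs1 ⟨has, h⟩

/-- Some connected subset of `Q` is adjacent to all vertices of `S`. -/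
theorem exists_conn_of_card_le {G : SimpleGraph V} {Q S : Finset V} (hQ0 : Q.Nonempty)
    (hQ : #Q ≤ 3) (hSQ : ∀ s ∈ S, ∀ q ∈ Q, s ≠ q)
    (hmiss : ∀ v ∈ S ∪ Q, ∀ W ⊆ S ∪ Q, (∀ w ∈ W, w ≠ v ∧ ¬ G.Adj v w) → #W + 1 ≤ #Q) :
    ∃ C ⊆ Q, Conn G C ∧ ∀ s ∈ S, ∃ q ∈ C, G.Adj q s := by
  by_cases hq : ∃ q ∈ Q, ∀ s ∈ S, G.Adj q s
  · obtain ⟨q, hq, h⟩ := hq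
    exact ⟨{q}, by simpa, conn_singleton G q, by simpa using h⟩
  push Not at hq
  refine ⟨Q, Subset.rfl, ⟨hQ0, fun U hU hU0 hcl => ?_⟩, fun s hs => ?_⟩
  · by_contra hne
    obtain ⟨w, hw, hwU⟩ : ∃ w ∈ Q, w ∉ U := by
      by_contra! h
      exact hne (hU.antisymm h)
    obtain ⟨u, hu⟩ := hU0
    obtain ⟨s, hs, hus⟩ := hq u (hU hu)
    obtain ⟨t, ht, hwt⟩ := hq w hw
    have h1 := hmiss u (mem_union_right _ (hU hu)) (insert s (Q \ U))
      (insert_subset (mem_union_left _ hs) (sdiff_subset.trans subset_union_right)) (by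
        simp only [mem_insert, mem_sdiff]
        rintro v (rfl | ⟨h, h'⟩)
        · exact ⟨hSQ _ hs u (hU hu), hus⟩
        · exact ⟨fun e => h' (e ▸ hu), fun e => h' (hcl u hu v h e)⟩)
    have h2 := hmiss w (mem_union_right _ hw) (insert t U)
      (insert_subset (mem_union_left _ ht) (hU.trans subset_union_right)) (by
        simp only [mem_insert]
        rintro v (rfl | h)
        · exact ⟨hSQ _ ht w hw, hwt⟩
        · exact ⟨fun e => hwU (e ▸ h), fun e => hwU (hcl v h w hw e.symm)⟩)
    rw [card_insert_of_notMem fun h => hSQ s hs s (mem_sdiff.mp h).1 rfl] at h1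
    rw [card_insert_of_notMem fun h => hSQ t ht t (hU h) rfl] at h2
    have := card_sdiff_add_card_eq_card hU
    omega
  · by_contra! hno
    have := hmiss s (mem_union_left _ hs) Q subset_union_right
      fun q hq' => ⟨(hSQ s hs q hq').symm, fun h => hno q hq' h.symm⟩
    omega

/-- Some vertex of a minimal fragment has degree at most seven. -/
theorem exists_degree_le {G : SimpleGraph V} (hG : MinorMinimalEnemy G) {F : Finset V}
    (hF : IsFrag G F)
    (hcom : ∀ u ∈ F, ∀ v, G.Adj u v → 4 ≤ #(univ.filter fun w => G.Adj u w ∧ G.Adj v w)) :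
    ∃ x ∈ F, dg G univ x ≤ 7 := by
  by_contra! hno
  have hdisj : Disjoint F (bd G F) := by
    rw [Finset.disjoint_left]
    exact fun v h1 h2 => (mem_bd.mp h2).1 h1
  have hnb : ∀ u ∈ F, ∀ v, G.Adj u v → v ∈ F ∪ bd G F := fun u hu v h => by
    by_cases hv : v ∈ F
    · exact mem_union_left _ hv
    · exact mem_union_right _ (mem_bd.mpr ⟨hv, u, hu, h⟩)
  have hne : F ∪ bd G F ≠ univ := fun h => by
    obtain ⟨y, h1, h2⟩ := hF.rest
    have : y ∈ F ∪ bd G F := h ▸ mem_univ y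
    simp [h1, h2] at this
  have hcard : #(F ∪ bd G F) = #F + 4 := by rw [card_union_of_disjoint hdisj, hF.card]
  have h1 := ec_add_le hG hne (by omega)
  rw [ec_eq_sum, sum_union hdisj] at h1
  have h2 : #F * 8 ≤ ∑ v ∈ F, dg G (F ∪ bd G F) v := by
    rw [← smul_eq_mul]
    refine card_nsmul_le_sum _ _ _ fun u hu => le_trans (Nat.succ_le_of_lt (hno u hu))
      (card_le_card fun w hw => ?_)
    have hw := (mem_filter.mp hw).2
    exact mem_filter.mpr ⟨hnb u hu w hw, hw⟩
  have h3 : #(bd G F) * 5 ≤ ∑ v ∈ bd G F, dg G (F ∪ bd G F) v := by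
    rw [← smul_eq_mul]
    refine card_nsmul_le_sum _ _ _ fun z hz => ?_
    obtain ⟨-, u, hu, huz⟩ := mem_bd.mp hz
    have hsub : insert u (univ.filter fun w => G.Adj u w ∧ G.Adj z w) ⊆
        (F ∪ bd G F).filter (G.Adj z) := by
      refine insert_subset (mem_filter.mpr ⟨mem_union_left _ hu, huz.symm⟩) fun w hw => ?_
      have hw := (mem_filter.mp hw).2
      exact mem_filter.mpr ⟨hnb u hu w hw.1, hw.2⟩
    have := card_le_card hsub
    rw [card_insert_of_notMem (by simp)] at this
    exact (Nat.succ_le_succ (hcom u hu z huz)).trans this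
  rw [hF.card] at h3
  omega

/-- Four disjoint connected sets inside a fragment and its boundary, each containing exactly one
boundary vertex. -/
structure Linkage (G : SimpleGraph V) (F : Finset V) (P : Fin 4 → Finset V) (z : Fin 4 → V) :
    Prop where
  conn : ∀ i, Conn G (P i)
  subset : ∀ i, P i ⊆ F ∪ bd G F
  disjoint : ∀ i j, i ≠ j → Disjoint (P i) (P j)
  inter : ∀ i, P i ∩ bd G F = {z i}

theorem Linkage.mem {G : SimpleGraph V} {F : Finset V} {P : Fin 4 → Finset V} {z : Fin 4 → V}
    (h : Linkage G F P z) (i : Fin 4) : z i ∈ P i ∧ z i ∈ bd G F := by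
  rw [← mem_inter, h.inter]
  exact mem_singleton_self _

theorem Linkage.injective {G : SimpleGraph V} {F : Finset V} {P : Fin 4 → Finset V}
    {z : Fin 4 → V} (h : Linkage G F P z) : Function.Injective z := fun i j hij => by
  by_contra hne
  exact Finset.disjoint_left.mp (h.disjoint i j hne) (h.mem i).1 (hij ▸ (h.mem j).1)

theorem exists_linkage {G : SimpleGraph V} (hG : MinorMinimalEnemy G) {F : Finset V}
    (hF : IsFrag G F) : ∃ (x : V) (Q : Finset V) (P : Fin 4 → Finset V) (n z : Fin 4 → V),
      Linkage G F P z ∧ x ∈ F ∧ Q ⊆ F ∧ Q.Nonempty ∧ #Q ≤ 3 ∧ (∀ q ∈ Q, G.Adj x q) ∧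
      (∀ i, G.Adj x (n i)) ∧ (∀ i, n i ∈ P i) ∧ (∀ i, x ∉ P i) ∧ (∀ i, Disjoint Q (P i)) ∧
      ∀ v ∈ univ.image n ∪ Q, ∀ W ⊆ univ.image n ∪ Q,
        (∀ w ∈ W, w ≠ v ∧ ¬ G.Adj v w) → #W + 1 ≤ #Q := by
  obtain ⟨F', hF'F, hF', hmin⟩ := exists_minimal_frag hF
  have hcut : ∀ D, IsFrag G D → Disjoint (bd G D) F' := fun D hD =>
    disjoint_of_minimal hG (fun _ h => h.three_le_card hG) hF' hmin hD
  have hcom : ∀ u ∈ F', ∀ v, G.Adj u v →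
      4 ≤ #(univ.filter fun w => G.Adj u w ∧ G.Adj v w) := fun u hu v huv =>
    four_le_card_common hG huv fun D h1 h2 h3 h4 =>
      Finset.disjoint_left.mp (hcut D ⟨h1, h2, h3⟩) h4.1 hu
  obtain ⟨x, hx, hx7⟩ := exists_degree_le hG hF' hcom
  set N : Finset V := univ.filter (G.Adj x) with hN
  have hNmem : ∀ v, v ∈ N ↔ G.Adj x v := by simp [hN]
  have hN7 : #N ≤ 7 := hx7
  have hxF : x ∈ F := hF'F hx
  have hnb : ∀ u ∈ F, ∀ v, G.Adj u v → v ∈ F ∪ bd G F := fun u hu v h => by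
    by_cases hv : v ∈ F
    · exact mem_union_left _ hv
    · exact mem_union_right _ (mem_bd.mpr ⟨hv, u, hu, h⟩)
  have hN5 : 5 ≤ #N := by
    obtain ⟨u, hu⟩ : N.Nonempty := by
      obtain ⟨y, h1, h2⟩ := hF.rest
      have := four_le_bd hG (singleton_nonempty x) (y := y)
        (fun h => h1 (mem_singleton.mp h ▸ hxF)) (fun h => by
          obtain ⟨-, u, hu, h⟩ := mem_bd.mp h
          rw [mem_singleton] at hu
          exact h2 (mem_bd.mpr ⟨h1, x, hxF, hu ▸ h⟩))
      obtain ⟨u, hu⟩ := card_pos.mp (by omega : 0 < #(bd G {x}))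
      exact ⟨u, (hNmem u).mpr (by simpa using (mem_bd.mp hu).2)⟩
    have h4 := hcom x hx u ((hNmem u).mp hu)
    have hsub : insert u (univ.filter fun w => G.Adj x w ∧ G.Adj u w) ⊆ N :=
      insert_subset hu fun w hw => (hNmem w).mpr (mem_filter.mp hw).2.1
    have := card_le_card hsub
    rw [card_insert_of_notMem (by simp)] at this
    omega
  have hxN : x ∉ N := by simp [hN]
  have hM : ∀ v, v ∈ (F ∪ bd G F).erase x ↔ v ≠ x ∧ v ∈ F ∪ bd G F := fun v => mem_erase
  obtain ⟨P, n, z, Pc, Ps, Pd, Pn, Pz⟩ := menger (G := G) (M := (F ∪ bd G F).erase x) (X := N)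
    (Y := bd G F) 4 (fun v hv => (hM v).mpr
      ⟨fun h => hxN (h ▸ hv), hnb x hxF v ((hNmem v).mp hv)⟩) (by
    intro U hU hUY
    rcases U.eq_empty_or_nonempty with rfl | hU0
    · refine le_trans (by omega : 4 ≤ #N) (card_le_card ?_)
      simp
    by_contra! hlt
    have hUF : ∀ u ∈ U, u ≠ x ∧ u ∈ F := fun u hu => by
      obtain ⟨h1, h2⟩ := (hM u).mp (hU hu)
      exact ⟨h1, (mem_union.mp h2).resolve_right fun h => Finset.disjoint_left.mp hUY hu h⟩
    have hbd : bd G U ⊆ insert x (bd G U ∩ (F ∪ bd G F).erase x) := fun v hv => by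
      obtain ⟨-, u, hu, h⟩ := mem_bd.mp hv
      by_cases hvx : v = x
      · simp [hvx]
      · exact mem_insert_of_mem (mem_inter.mpr ⟨hv, (hM v).mpr ⟨hvx, hnb u (hUF u hu).2 v h⟩⟩)
    obtain ⟨y, h1, h2⟩ := hF.rest
    have hyU : y ∉ U := fun h => h1 (hUF y h).2
    have hybd : y ∉ bd G U := fun h => by
      obtain ⟨-, u, hu, h⟩ := mem_bd.mp h
      exact h2 (mem_bd.mpr ⟨h1, u, (hUF u hu).2, h⟩)
    have h4 := four_le_bd hG hU0 hyU hybd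
    have h5 := card_le_card hbd
    have h6 := card_insert_le x (bd G U ∩ (F ∪ bd G F).erase x)
    have h7 : #(bd G U ∩ (F ∪ bd G F).erase x) ≤ 3 :=
      (card_le_card subset_union_left).trans (Nat.le_of_lt_succ hlt)
    have hxU : x ∈ bd G U := by
      by_contra hxU
      have : bd G U ⊆ bd G U ∩ (F ∪ bd G F).erase x := fun v hv =>
        (mem_insert.mp (hbd hv)).resolve_left fun h => hxU (h ▸ hv)
      have := card_le_card this
      omega
    exact Finset.disjoint_left.mp (hcut U ⟨hU0, ⟨y, hyU, hybd⟩, by omega⟩) hxU hx)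
  have hL : Linkage G F P z := ⟨Pc, fun i => (Ps i).trans (erase_subset _ _), Pd, Pz⟩
  have hn : ∀ i, n i ∈ P i ∧ n i ∈ N := fun i => by
    rw [← mem_inter, Pn]
    exact mem_singleton_self _
  have hninj : Function.Injective n := fun i j hij => by
    by_contra hne
    exact Finset.disjoint_left.mp (Pd i j hne) (hn i).1 (hij ▸ (hn j).1)
  have hsub : univ.image n ⊆ N := by
    intro v hv
    obtain ⟨i, -, rfl⟩ := mem_image.mp hv
    exact (hn i).2
  have hun : univ.image n ∪ N \ univ.image n = N := union_sdiff_of_subset hsub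
  have hQcard : #(N \ univ.image n) + 4 = #N := by
    have := card_sdiff_add_card_eq_card hsub
    rwa [card_image_of_injective _ hninj, card_univ, Fintype.card_fin] at this
  have hQP : ∀ i, Disjoint (N \ univ.image n) (P i) := fun i => by
    rw [Finset.disjoint_left]
    intro v h1 h2
    obtain ⟨h1, h3⟩ := mem_sdiff.mp h1
    have : v ∈ P i ∩ N := mem_inter.mpr ⟨h2, h1⟩
    rw [Pn, mem_singleton] at this
    exact h3 (this ▸ mem_image_of_mem n (mem_univ i))
  refine ⟨x, N \ univ.image n, P, n, z, hL, hxF, fun v hv => ?_, card_pos.mp (by omega), by omega,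
    fun q hq => (hNmem q).mp (mem_sdiff.mp hq).1, fun i => (hNmem _).mp (hn i).2,
    fun i => (hn i).1, fun i h => (notMem_erase x _ (Ps i h)), hQP, ?_⟩
  · refine (mem_union.mp (hnb x hxF v ((hNmem v).mp (mem_sdiff.mp hv).1))).resolve_right fun h => ?_
    obtain ⟨i, rfl⟩ := exists_index_of_injective hL.injective (fun i => (hL.mem i).2) hF.card h
    exact Finset.disjoint_left.mp (hQP i) hv (hL.mem i).1
  · rw [hun]
    intro v hv W hW hWv
    have h4 := hcom x hx v ((hNmem v).mp hv)
    have hvW : v ∉ W := fun h => (hWv v h).1 rfl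
    have hdisj : Disjoint (insert v W) (univ.filter fun w => G.Adj x w ∧ G.Adj v w) := by
      rw [Finset.disjoint_left]
      intro w h1 h2
      have h2 := (mem_filter.mp h2).2.2
      rcases mem_insert.mp h1 with rfl | h1
      · exact G.irrefl h2
      · exact (hWv w h1).2 h2
    have hle := card_le_card (union_subset (insert_subset hv hW) (fun w hw =>
      (hNmem w).mpr (mem_filter.mp hw).2.1 : (univ.filter fun w => G.Adj x w ∧ G.Adj v w) ⊆ N))
    rw [card_union_of_disjoint hdisj, card_insert_of_notMem hvW] at hle
    omega

/-- A linkage together with two adjacent connected sets that see all its members. -/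
theorem exists_linkage_apices {G : SimpleGraph V} (hG : MinorMinimalEnemy G) {F : Finset V}
    (hF : IsFrag G F) : ∃ (A B : Finset V) (P : Fin 4 → Finset V) (z : Fin 4 → V),
      Linkage G F P z ∧ A ⊆ F ∧ B ⊆ F ∧ Conn G A ∧ Conn G B ∧ Disjoint A B ∧ Touch G A B ∧
      (∀ i, Disjoint A (P i)) ∧ (∀ i, Disjoint B (P i)) ∧ (∀ i, Touch G A (P i)) ∧
      ∀ i, Touch G B (P i) := by
  obtain ⟨x, Q, P, n, z, hL, hx, hQF, hQ0, hQ3, hxQ, hxn, hn, hxP, hQP, hmiss⟩ :=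
    exists_linkage hG hF
  obtain ⟨C, hCQ, hC, hCn⟩ := exists_conn_of_card_le hQ0 hQ3 (fun s hs q hq h => by
    obtain ⟨i, -, rfl⟩ := mem_image.mp hs
    exact Finset.disjoint_left.mp (hQP i) hq (h ▸ hn i)) hmiss
  obtain ⟨c, hc⟩ := hC.1
  refine ⟨{x}, C, P, z, hL, by simpa, hCQ.trans hQF, conn_singleton G x, hC, ?_,
    ⟨x, by simp, c, hc, hxQ c (hCQ hc)⟩, fun i => ?_,
    fun i => disjoint_of_subset_left hCQ (hQP i), fun i => ⟨x, by simp, n i, hn i, hxn i⟩,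
    fun i => ?_⟩
  · rw [disjoint_singleton_left]
    exact fun h => G.irrefl (hxQ x (hCQ h))
  · rw [disjoint_singleton_left]
    exact hxP i
  · obtain ⟨q, hq, h⟩ := hCn (n i) (mem_image_of_mem n (mem_univ i))
    exact ⟨q, hq, n i, hn i, h⟩

/-- A linkage with pairwise adjacent members together with a vertex that sees all of them. -/
theorem exists_linkage_touch {G : SimpleGraph V} (hG : MinorMinimalEnemy G) {F : Finset V}
    (hF : IsFrag G F) : ∃ (x : V) (P : Fin 4 → Finset V) (z : Fin 4 → V),
      Linkage G F P z ∧ x ∈ F ∧ (∀ i, x ∉ P i) ∧ (∀ i, Touch G {x} (P i)) ∧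
      ∀ i j, i ≠ j → Touch G (P i) (P j) := by
  obtain ⟨x, Q, P, n, z, hL, hx, hQF, hQ0, hQ3, hxQ, hxn, hn, hxP, hQP, hmiss⟩ :=
    exists_linkage hG hF
  have hninj : Function.Injective n := fun i j hij => by
    by_contra hne
    exact Finset.disjoint_left.mp (hL.disjoint i j hne) (hn i) (hij ▸ hn j)
  obtain ⟨A, hA, hAA⟩ := rooted_of_card_le
    (by rw [card_image_of_injective _ hninj, card_univ, Fintype.card_fin]) hQ3
    (fun s hs q hq h => by
      obtain ⟨i, -, rfl⟩ := mem_image.mp hs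
      exact Finset.disjoint_left.mp (hQP i) hq (h ▸ hn i)) hmiss
  have hmem : ∀ i, n i ∈ univ.image n := fun i => mem_image_of_mem n (mem_univ i)
  have hsub : ∀ i, insert (n i) (A (n i)) ⊆ P i ∪ A (n i) := fun i =>
    insert_subset (mem_union_left _ (hn i)) subset_union_right
  have hAF : ∀ i, A (n i) ⊆ F := fun i => ((hA _ (hmem i)).1).trans hQF
  refine ⟨x, fun i => P i ∪ A (n i), z, ⟨fun i => ?_, fun i => ?_, fun i j hij => ?_, fun i => ?_⟩,
    hx, fun i => ?_, fun i => ⟨x, by simp, n i, mem_union_left _ (hn i), hxn i⟩, fun i j hij => ?_⟩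
  · have := (hL.conn i).union (hA _ (hmem i)).2
      (Or.inl ⟨n i, mem_inter.mpr ⟨hn i, mem_insert_self _ _⟩⟩)
    rwa [union_insert, insert_eq_self.mpr (mem_union_left _ (hn i))] at this
  · exact union_subset (hL.subset i) ((hAF i).trans subset_union_left)
  · rw [disjoint_union_left, disjoint_union_right, disjoint_union_right]
    exact ⟨⟨hL.disjoint i j hij, (disjoint_of_subset_left (hA _ (hmem j)).1 (hQP i)).symm⟩,
      disjoint_of_subset_left (hA _ (hmem i)).1 (hQP j),
      (hAA _ (hmem i) _ (hmem j) (hninj.ne hij)).1⟩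
  · rw [union_inter_distrib_right, hL.inter]
    refine union_eq_left.mpr fun v hv => ?_
    obtain ⟨h1, h2⟩ := mem_inter.mp hv
    exact absurd (hAF i h1) (mem_bd.mp h2).1
  · rw [mem_union, not_or]
    exact ⟨hxP i, fun h => G.irrefl (hxQ x ((hA _ (hmem i)).1 h))⟩
  · exact (hAA _ (hmem i) _ (hmem j) (hninj.ne hij)).2.mono (hsub i) (hsub j)

theorem not_isFrag {G : SimpleGraph V} (hG : MinorMinimalEnemy G) (F : Finset V) :
    ¬ IsFrag G F := by
  intro hF
  obtain ⟨A, B, P, z, hL, hAF, hBF, hA, hB, hAB, tAB, hAP, hBP, tA, tB⟩ :=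
    exists_linkage_apices hG hF
  obtain ⟨x, P', z', hL', hx, hxP', tx, tP'⟩ := exists_linkage_touch hG (hF.compl hG)
  have hbd := hF.bd_co hG
  choose σ hσ using fun i => exists_index_of_injective hL'.injective (fun i => (hL'.mem i).2)
    (hF.compl hG).card (hbd ▸ (hL.mem i).2 : z i ∈ bd G (co G F))
  have hσinj : Function.Injective σ := fun i j h =>
    hL.injective (by rw [← hσ i, ← hσ j, h])
  have hF_P' : ∀ v ∈ F, ∀ i, v ∉ P' i := fun v hv i h => by
    rcases mem_union.mp (hL'.subset i h) with h | h
    · exact (mem_co.mp h).1 hv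
    · exact (mem_bd.mp (hbd ▸ h)).1 hv
  have hco_P : ∀ v ∈ co G F, ∀ i, v ∉ P i := fun v hv i h => by
    rcases mem_union.mp (hL.subset i h) with h | h
    · exact (mem_co.mp hv).1 h
    · exact (mem_co.mp hv).2 h
  have hPP' : ∀ i j, i ≠ j → Disjoint (P i) (P' (σ j)) := fun i j hij => by
    rw [Finset.disjoint_left]
    intro v h1 h2
    have hv : v ∈ bd G F :=
      (mem_union.mp (hL.subset i h1)).resolve_left fun h => hF_P' v h _ h2
    have e1 : v ∈ P i ∩ bd G F := mem_inter.mpr ⟨h1, hv⟩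
    have e2 : v ∈ P' (σ j) ∩ bd G (co G F) := mem_inter.mpr ⟨h2, hbd.symm ▸ hv⟩
    rw [hL.inter, mem_singleton] at e1
    rw [hL'.inter, mem_singleton, hσ] at e2
    exact hij (hL.injective (e1.symm.trans e2))
  have hxF : x ∉ F := (mem_co.mp hx).1
  refine hG.1.2.2.1 (isMinor_K7vee_of_four (K := {x}) (fun i => P i ∪ P' (σ i))
    (conn_singleton G x) hA hB (fun i => (hL.conn i).union (hL'.conn _)
      (Or.inl ⟨z i, mem_inter.mpr ⟨(hL.mem i).1, hσ i ▸ (hL'.mem (σ i)).1⟩⟩))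
    (by simpa using fun h => hxF (hAF h)) (by simpa using fun h => hxF (hBF h)) hAB
    (fun i => ?_) (fun i => ?_) (fun i => ?_) (fun i j hij => ?_) tAB
    (fun i => (tx (σ i)).mono Subset.rfl subset_union_right)
    (fun i => (tA i).mono Subset.rfl subset_union_left)
    (fun i => (tB i).mono Subset.rfl subset_union_left)
    (fun i j hij => (tP' _ _ (hσinj.ne hij)).mono subset_union_right subset_union_right))
  · rw [disjoint_singleton_left, mem_union, not_or]
    exact ⟨hco_P x hx i, hxP' _⟩
  · rw [disjoint_union_right]
    exact ⟨hAP i, Finset.disjoint_left.mpr fun v hv => hF_P' v (hAF hv) _⟩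
  · rw [disjoint_union_right]
    exact ⟨hBP i, Finset.disjoint_left.mpr fun v hv => hF_P' v (hBF hv) _⟩
  · rw [disjoint_union_left, disjoint_union_right, disjoint_union_right]
    exact ⟨⟨hL.disjoint i j hij, hPP' i j hij⟩, (hPP' j i hij.symm).symm,
      hL'.disjoint _ _ (hσinj.ne hij)⟩

theorem isKConnected_five {G : SimpleGraph V} (hG : MinorMinimalEnemy G) : IsKConnected 5 G := by
  rw [isKConnected_iff]
  refine ⟨?_, fun U _ hU ⟨y, hy⟩ => ?_⟩
  · have := seven_le_card hG
    rw [card_univ]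
    omega
  · simp only [mem_sdiff, mem_univ, true_and, mem_union, not_or] at hy
    rw [inter_univ]
    have h1 := four_le_bd hG hU hy.1 hy.2
    have h2 : #(bd G U) ≠ 4 := fun h => not_isFrag hG U ⟨hU, ⟨y, hy⟩, h⟩
    omega

end EnemyProof

/-- every minor-minimal enemy is 5-connected. -/
theorem statement_11 (V : Type) [Fintype V] (G : SimpleGraph V)
    (h : MinorMinimalEnemy G) : IsKConnected 5 G := by
  exact EnemyProof.isKConnected_five h
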